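/- Let R be a non-negatively graded Cohen-Macaulay ring with R_0 an Artinian local ring, d = dim R, 𝔪 the maximal homogeneous ideal, and ω_R the graded canonical module. Let C_• be a graded complex of finitely generated graded R-modules with M = H_0(C_•). Fix integers i, t with 1 ≤ t ≤ i ≤ d and assume: (1) d − i + t ≤ depth(M/H^0_𝔪(M)); (2) dim H_j(C_•) ≤ d − i + j for all 1 ≤ j ≤ i − 1; (3) min{d, d − i + t + j + 1} ≤ depth C_j for all 0 ≤ j ≤ i − 1; (4) i − j + 1 ≤ depth Hom_R(C_j, ω_R) for all i − t + 1 ≤ j ≤ i. Assume also that H^{d−i}_𝔪(M) is finitely generated as an R-module. Then b_0(H^{d−i}_𝔪(M)) ≤ b_0(C_{i−t}) + Θ_t + a(R). -/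

import Mathlib

open CategoryTheory

noncomputable section
namespace Paper

variable {R : Type} [CommRing R]

abbrev extModule (R : Type) [CommRing R] (A B : Type) [AddCommGroup A] [Module R A]
    [AddCommGroup B] [Module R B] (n : ℕ) : Type :=
  ((Ext R (ModuleCat R) n).obj (Opposite.op (ModuleCat.of R A))).obj (ModuleCat.of R B)

def maxHomIdeal (𝒜 : ℤ → AddSubgroup R) [GradedRing 𝒜] : Ideal R :=
  Ideal.span ({ r : R | ∃ h : r ∈ 𝒜 0, ¬ IsUnit (⟨r, h⟩ : 𝒜 0) } ∪
    ⋃ (i : ℤ) (_ : i ≠ 0), (𝒜 i : Set R))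

def GenDegLE {M : Type} [AddCommGroup M] [Module R M] (ℳ : ℤ → AddSubgroup M) (b : ℤ) : Prop :=
  Submodule.span R (⋃ (j : ℤ) (_ : j ≤ b), (ℳ j : Set M)) = ⊤

def depthGE (I : Ideal R) (N : Type) [AddCommGroup N] [Module R N] (k : ℕ) : Prop :=
  Subsingleton N ∨ ∃ rs : List R, rs.length = k ∧ (∀ r ∈ rs, r ∈ I) ∧
    RingTheory.Sequence.IsRegular N rs

def modDimLE (N : Type) [AddCommGroup N] [Module R N] (b : ℕ) : Prop :=
  ringKrullDim (R ⧸ Module.annihilator R N) ≤ (b : WithBot (WithTop ℕ))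

def torsionSubmodule (I : Ideal R) (M : Type) [AddCommGroup M] [Module R M] :
    Submodule R M where
  carrier := { x | ∃ t : ℕ, ∀ r ∈ I ^ t, r • x = 0 }
  zero_mem' := ⟨0, fun r _ => smul_zero r⟩
  add_mem' := by
    rintro a b ⟨t, ht⟩ ⟨m, hm⟩
    refine ⟨t + m, fun r hr => ?_⟩
    have h1 : r ∈ I ^ t := Ideal.pow_le_pow_right (Nat.le_add_right t m) hr
    have h2 : r ∈ I ^ m := Ideal.pow_le_pow_right (Nat.le_add_left m t) hr
    rw [smul_add, ht r h1, hm r h2, add_zero]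
  smul_mem' := by
    rintro c x ⟨t, ht⟩
    exact ⟨t, fun r hr => by rw [smul_comm, ht r hr, smul_zero]⟩

def injDimFinite (S : Type) [CommRing S] (W : Type) [AddCommGroup W] [Module S W] : Prop :=
  ∃ nb : ℕ, ∀ (A : Type) [AddCommGroup A] [Module S A], ∀ j : ℕ, nb < j →
    Subsingleton (extModule S A W j)

def IsCanonicalModule (𝔪 : Ideal R) (d : ℕ) (ω : Type) [AddCommGroup ω] [Module R ω] :
    Prop :=
  Module.Finite R ω ∧ depthGE 𝔪 ω d ∧
  Nonempty ((extModule R (R ⧸ 𝔪) ω d) ≃ₗ[R] (R ⧸ 𝔪)) ∧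
  injDimFinite R ω

abbrev Hmod (C : ℕ → Type) [∀ j, AddCommGroup (C j)] [∀ j, Module R (C j)]
    (dl : ∀ j, C (j + 1) →ₗ[R] C j) (j : ℕ) : Type :=
  ↥(LinearMap.ker (dl j)) ⧸
    (Submodule.comap (LinearMap.ker (dl j)).subtype (LinearMap.range (dl (j + 1))))

abbrev KCochain (n : ℕ) (M : Type) (i : ℕ) : Type := {S : Finset (Fin n) // S.card = i} → M

variable {n : ℕ} (y : Fin n → R) {M : Type} [AddCommGroup M] [Module R M]

def kd (t i : ℕ) (f : KCochain n M i) : KCochain n M (i + 1) := fun T =>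
  ∑ j ∈ T.1.attach,
    ((-1 : ℤ) ^ ((T.1.filter (fun a => a < j.1)).card)) •
      ((y j.1 ^ t) • f ⟨T.1.erase j.1, by simp [Finset.card_erase_of_mem j.2, T.2]⟩)

def kTrans (s : ℕ) (i : ℕ) (f : KCochain n M i) : KCochain n M i := fun S =>
  ((∏ j ∈ S.1, y j) ^ s) • f S

def KHomog (ℳ : ℤ → AddSubgroup M) (e : Fin n → ℤ) (t : ℕ) (ℓ : ℤ) {i : ℕ}
    (f : KCochain n M i) : Prop :=
  ∀ S, f S ∈ ℳ (ℓ + (t : ℤ) * ∑ j ∈ S.1, e j)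

def IsKBoundary (t : ℕ) : (i : ℕ) → KCochain n M i → Prop
  | 0, f => f = 0
  | (i + 1), f => ∃ g : KCochain n M i, kd y t i g = f

def KVanish (ℳ : ℤ → AddSubgroup M) (e : Fin n → ℤ) (i : ℕ) (ℓ : ℤ) : Prop :=
  ∀ (t : ℕ) (f : KCochain n M i), kd y t i f = 0 → KHomog ℳ e t ℓ f →
    ∃ s : ℕ, IsKBoundary y (t + s) i (kTrans y s i f)

/-- `b₀(H^i_{(y)}(M)) ≤ β`: the `i`-th (graded) local cohomology of `M`, computed as
the direct limit of Koszul cohomology on powers of `y`, is generated in degrees `≤ β`. -/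
def KGenLE (ℳ : ℤ → AddSubgroup M) (e : Fin n → ℤ) (i : ℕ) (β : ℤ) : Prop :=
  ∀ (t : ℕ) (ℓ : ℤ) (f : KCochain n M i), kd y t i f = 0 → KHomog ℳ e t ℓ f →
    ∃ (s : ℕ) (b g : KCochain n M i), IsKBoundary y (t + s) i b ∧
      g ∈ Submodule.span R {h : KCochain n M i | kd y (t + s) i h = 0 ∧
        ∃ ℓ' ≤ β, KHomog ℳ e (t + s) ℓ' h} ∧
      kTrans y s i f = b + g

section KoszulAlgebra

/-- The Koszul sign `(-1) ^ #{a ∈ S | a < j}`. -/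
def ksgn {n : ℕ} (j : Fin n) (S : Finset (Fin n)) : ℤ :=
  (-1) ^ (S.filter (fun a => a < j)).card

lemma ksgn_mul_self {n : ℕ} (j : Fin n) (S : Finset (Fin n)) : ksgn j S * ksgn j S = 1 := by
  simp [ksgn, ← mul_pow]

lemma ksgn_erase_self {n : ℕ} (j : Fin n) (S : Finset (Fin n)) :
    ksgn j (S.erase j) = ksgn j S := by
  unfold ksgn
  congr 2
  ext a
  simp only [Finset.mem_filter, Finset.mem_erase]
  constructor
  · rintro ⟨⟨-, h⟩, h'⟩
    exact ⟨h, h'⟩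
  · rintro ⟨h, h'⟩
    exact ⟨⟨h'.ne, h⟩, h'⟩

lemma ksgn_insert_self {n : ℕ} (j : Fin n) (S : Finset (Fin n)) :
    ksgn j (insert j S) = ksgn j S := by
  by_cases h : j ∈ S
  · rw [Finset.insert_eq_of_mem h]
  · rw [← ksgn_erase_self j (insert j S), Finset.erase_insert h]

lemma ksgn_erase_of_lt {n : ℕ} {j k : Fin n} {S : Finset (Fin n)} (hk : k ∈ S) (h : k < j) :
    ksgn j S = -ksgn j (S.erase k) := by
  unfold ksgn
  have : S.filter (fun a => a < j) = insert k ((S.erase k).filter (fun a => a < j)) := by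
    ext a
    simp only [Finset.mem_filter, Finset.mem_insert, Finset.mem_erase]
    by_cases ha : a = k
    · subst ha; simp [hk, h]
    · simp [ha]
  rw [this, Finset.card_insert_of_notMem (by simp), pow_succ]
  ring

lemma ksgn_erase_of_not_lt {n : ℕ} {j k : Fin n} {S : Finset (Fin n)} (h : ¬ k < j) :
    ksgn j (S.erase k) = ksgn j S := by
  unfold ksgn
  congr 2
  ext a
  simp only [Finset.mem_filter, Finset.mem_erase]
  constructor
  · rintro ⟨⟨-, h⟩, h'⟩
    exact ⟨h, h'⟩
  · rintro ⟨h1, h2⟩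
    exact ⟨⟨fun h3 => h (h3 ▸ h2), h1⟩, h2⟩

lemma ksgn_swap {n : ℕ} {j k : Fin n} {S : Finset (Fin n)} (hj : j ∈ S) (hk : k ∈ S)
    (hjk : j ≠ k) :
    ksgn j S * ksgn k (S.erase j) = -(ksgn k S * ksgn j (S.erase k)) := by
  rcases lt_or_gt_of_ne hjk with h | h
  · rw [ksgn_erase_of_lt hj h, ksgn_erase_of_not_lt (j := j) (k := k) h.not_gt]
    ring
  · rw [ksgn_erase_of_lt hk h, ksgn_erase_of_not_lt (j := k) (k := j) h.not_gt]
    ring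

variable {N : Type*} [AddCommGroup N] [Module R N] {N' : Type*} [AddCommGroup N'] [Module R N']

/-- The Koszul differential (exterior multiplication by `∑ x j • e j`) on functions of finsets. -/
def kos {n : ℕ} (x : Fin n → R) : (Finset (Fin n) → N) →ₗ[R] (Finset (Fin n) → N) where
  toFun f S := ∑ j ∈ S, ksgn j S • x j • f (S.erase j)
  map_add' f g := by ext S; simp [smul_add, Finset.sum_add_distrib]
  map_smul' r f := by
    ext S
    simp only [Pi.smul_apply, RingHom.id_apply, Finset.smul_sum]
    refine Finset.sum_congr rfl fun j _ => ?_
    rw [smul_comm (x j) r, smul_comm (ksgn j S) r]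

/-- The dual Koszul differential (contraction with `y`). -/
def kosb {n : ℕ} (x : Fin n → R) : (Finset (Fin n) → N) →ₗ[R] (Finset (Fin n) → N) where
  toFun f S := ∑ j ∈ Sᶜ, ksgn j S • x j • f (insert j S)
  map_add' f g := by ext S; simp [smul_add, Finset.sum_add_distrib]
  map_smul' r f := by
    ext S
    simp only [Pi.smul_apply, RingHom.id_apply, Finset.smul_sum]
    refine Finset.sum_congr rfl fun j _ => ?_
    rw [smul_comm (x j) r, smul_comm (ksgn j S) r]

/-- The transition maps of the Koszul system. -/
def ktr {n : ℕ} (x : Fin n → R) (r : ℕ) : (Finset (Fin n) → N) →ₗ[R] (Finset (Fin n) → N) where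
  toFun f S := (∏ j ∈ S, x j) ^ r • f S
  map_add' f g := by ext S; simp [smul_add]
  map_smul' a f := by
    ext S
    exact smul_comm _ _ _

lemma kos_apply {n : ℕ} (x : Fin n → R) (f : Finset (Fin n) → N) (S : Finset (Fin n)) :
    kos x f S = ∑ j ∈ S, ksgn j S • x j • f (S.erase j) := rfl

lemma kosb_apply {n : ℕ} (x : Fin n → R) (f : Finset (Fin n) → N) (S : Finset (Fin n)) :
    kosb x f S = ∑ j ∈ Sᶜ, ksgn j S • x j • f (insert j S) := rfl

lemma ktr_apply {n : ℕ} (x : Fin n → R) (r : ℕ) (f : Finset (Fin n) → N) (S : Finset (Fin n)) :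
    ktr x r f S = (∏ j ∈ S, x j) ^ r • f S := rfl

lemma sum_sum_erase_eq_zero {n : ℕ} {A : Type*} [AddCommGroup A] (S : Finset (Fin n))
    (F : Fin n → Fin n → A) (h : ∀ j ∈ S, ∀ k ∈ S, j ≠ k → F j k = -F k j) :
    ∑ j ∈ S, ∑ k ∈ S.erase j, F j k = 0 := by
  rw [Finset.sum_sigma']
  refine Finset.sum_involution (fun p _ => ⟨p.2, p.1⟩) ?_ ?_ ?_ ?_
  · rintro ⟨j, k⟩ hp
    simp only [Finset.mem_sigma, Finset.mem_erase] at hp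
    simp only
    rw [h j hp.1 k hp.2.2 (Ne.symm hp.2.1), neg_add_cancel]
  · rintro ⟨j, k⟩ hp - h2
    simp only [Finset.mem_sigma, Finset.mem_erase] at hp
    simp only [Sigma.mk.injEq, heq_eq_eq] at h2
    exact hp.2.1 h2.1
  · rintro ⟨j, k⟩ hp
    simp only [Finset.mem_sigma, Finset.mem_erase] at hp ⊢
    exact ⟨hp.2.2, Ne.symm hp.2.1, hp.1⟩
  · rintro ⟨j, k⟩ hp
    rfl

lemma kos_kos {n : ℕ} (x : Fin n → R) (f : Finset (Fin n) → N) : kos x (kos x f) = 0 := by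
  ext S
  simp only [kos_apply, Finset.smul_sum, Pi.zero_apply]
  apply sum_sum_erase_eq_zero S
    (fun j k => ksgn j S • x j • ksgn k (S.erase j) • x k • f ((S.erase j).erase k))
  intro j hj k hk hjk
  simp only [smul_comm (x _) (ksgn _ _), smul_smul, ← neg_smul]
  rw [ksgn_swap hj hk hjk, Finset.erase_right_comm, mul_comm (x j)]

lemma kosb_kosb {n : ℕ} (x : Fin n → R) (f : Finset (Fin n) → N) : kosb x (kosb x f) = 0 := by
  ext S
  simp only [kosb_apply, Finset.smul_sum, Pi.zero_apply, Finset.compl_insert]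
  apply sum_sum_erase_eq_zero Sᶜ
    (fun j k => ksgn j S • x j • ksgn k (insert j S) • x k • f (insert k (insert j S)))
  intro j hj k hk hjk
  rw [Finset.mem_compl] at hj hk
  simp only [smul_comm (x _) (ksgn _ _)]
  have key := ksgn_swap (j := k) (k := j) (S := insert k (insert j S)) (by simp) (by simp) hjk.symm
  rw [Finset.erase_insert (by simp [hk, hjk.symm]), ksgn_insert_self,
    Finset.insert_comm k j, Finset.erase_insert (by simp [hj, hjk]), ksgn_insert_self] at key
  rw [smul_comm (x j) (x k), smul_smul (ksgn j S), smul_smul (ksgn k S),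
    Finset.insert_comm k j, ← neg_smul, mul_comm (ksgn j S), key, ksgn_insert_self j, ksgn_insert_self k,
    mul_comm (ksgn k S)]

lemma kos_congr {n : ℕ} (x : Fin n → R) {f g : Finset (Fin n) → N} {S : Finset (Fin n)}
    (h : ∀ T : Finset (Fin n), T.card + 1 = S.card → f T = g T) : kos x f S = kos x g S := by
  refine Finset.sum_congr rfl fun j hj => ?_
  rw [h _ (Finset.card_erase_add_one hj)]

lemma kos_comp {n : ℕ} (x : Fin n → R) (φ : N →ₗ[R] N') (f : Finset (Fin n) → N) :
    kos x (fun S => φ (f S)) = fun S => φ (kos x f S) := by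
  ext S
  simp [kos_apply, map_sum]

lemma kosb_comp {n : ℕ} (x : Fin n → R) (φ : N →ₗ[R] N') (f : Finset (Fin n) → N) :
    kosb x (fun S => φ (f S)) = fun S => φ (kosb x f S) := by
  ext S
  simp [kosb_apply, map_sum]

lemma ktr_comp {n : ℕ} (x : Fin n → R) (r : ℕ) (φ : N →ₗ[R] N') (f : Finset (Fin n) → N) :
    ktr x r (fun S => φ (f S)) = fun S => φ (ktr x r f S) := by
  ext S
  simp [ktr_apply]

lemma kos_ktr {n : ℕ} (x : Fin n → R) (s r : ℕ) (f : Finset (Fin n) → N) :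
    kos (x ^ (s + r)) (ktr x r f) = ktr x r (kos (x ^ s) f) := by
  ext S
  simp only [kos_apply, ktr_apply, Finset.smul_sum]
  refine Finset.sum_congr rfl fun j hj => ?_
  rw [smul_comm _ (ksgn j S), ← Finset.mul_prod_erase S x hj, smul_smul, smul_smul,
    Pi.pow_apply, Pi.pow_apply]
  congr 2
  ring

lemma ktr_ktr {n : ℕ} (x : Fin n → R) (s r : ℕ) (f : Finset (Fin n) → N) :
    ktr x s (ktr x r f) = ktr x (r + s) f := by
  ext S
  simp only [ktr_apply, smul_smul]
  congr 1
  ring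

lemma ktr_zero {n : ℕ} (x : Fin n → R) (f : Finset (Fin n) → N) : ktr x 0 f = f := by
  ext S
  simp [ktr_apply]

/-- Contraction with the `j`-th basis vector. -/
def kcontr {n : ℕ} (j : Fin n) (f : Finset (Fin n) → N) : Finset (Fin n) → N :=
  fun S => if j ∈ S then 0 else ksgn j S • f (insert j S)

lemma kos_kcontr {n : ℕ} (x : Fin n → R) (j : Fin n) (f : Finset (Fin n) → N)
    (S : Finset (Fin n)) :
    kos x (kcontr j f) S + kcontr j (kos x f) S = x j • f S := by
  by_cases hj : j ∈ S
  · simp only [kcontr, hj, if_true, add_zero, kos_apply]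
    rw [Finset.sum_eq_single j]
    · simp only [Finset.notMem_erase, if_false, Finset.insert_erase hj, ksgn_erase_self]
      rw [smul_comm (x j), smul_smul, ksgn_mul_self, one_smul]
    · intro b hb hbj
      rw [if_pos (Finset.mem_erase.2 ⟨hbj.symm, hj⟩), smul_zero, smul_zero]
    · exact fun h => absurd hj h
  · simp only [kcontr, hj, if_false, kos_apply]
    rw [Finset.sum_insert hj, Finset.erase_insert hj, smul_add, ksgn_insert_self, smul_smul,
      ksgn_mul_self, one_smul, add_comm (x j • f S), ← add_assoc, add_eq_right,
      Finset.smul_sum, ← Finset.sum_add_distrib]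
    refine Finset.sum_eq_zero fun k hk => ?_
    have hkj : k ≠ j := fun h => hj (h ▸ hk)
    have hjS : j ∉ S.erase k := fun h => hj (Finset.mem_of_mem_erase h)
    have key := ksgn_swap (j := j) (k := k) (S := insert j S) (by simp) (by simp [hk]) hkj.symm
    rw [Finset.erase_insert hj, Finset.erase_insert_of_ne hkj.symm, ksgn_insert_self,
      ksgn_insert_self] at key
    rw [if_neg hjS, Finset.erase_insert_of_ne hkj.symm, smul_comm (x k), smul_smul, smul_smul,
      ← add_smul]
    have : ksgn k S * ksgn j (S.erase k) + ksgn j S * ksgn k (insert j S) = 0 := by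
      have h1 := ksgn_mul_self j S
      have h2 := ksgn_mul_self k (insert j S)
      have h3 := ksgn_mul_self j (S.erase k)
      have h4 := ksgn_mul_self k S
      have e1 : ksgn k S = -(ksgn k (insert j S) * ksgn j (S.erase k)) * ksgn j S := by
        rw [← key]; linear_combination (-ksgn k S) * h1
      rw [e1]
      linear_combination (-(ksgn k (insert j S) * ksgn j S)) * h3
    rw [this, zero_smul]

/-- Cochains on which the Koszul differential vanishes in degree `k`. -/
def KCyc {n : ℕ} (x : Fin n → R) (k : ℕ) (f : Finset (Fin n) → N) : Prop :=
  ∀ S : Finset (Fin n), S.card = k + 1 → kos x f S = 0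

/-- Cochains that agree with a Koszul coboundary in degree `k`. -/
def KBdy {n : ℕ} (x : Fin n → R) (k : ℕ) (f : Finset (Fin n) → N) : Prop :=
  ∃ g : Finset (Fin n) → N, ∀ S : Finset (Fin n), S.card = k → f S = kos x g S

lemma KBdy.add {n : ℕ} {x : Fin n → R} {k : ℕ} {f g : Finset (Fin n) → N}
    (hf : KBdy x k f) (hg : KBdy x k g) : KBdy x k (f + g) := by
  obtain ⟨u, hu⟩ := hf
  obtain ⟨v, hv⟩ := hg
  exact ⟨u + v, fun S hS => by rw [map_add, Pi.add_apply, Pi.add_apply, hu S hS, hv S hS]⟩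

lemma KBdy.smul {n : ℕ} {x : Fin n → R} {k : ℕ} {f : Finset (Fin n) → N} (r : R)
    (hf : KBdy x k f) : KBdy x k (r • f) := by
  obtain ⟨u, hu⟩ := hf
  exact ⟨r • u, fun S hS => by rw [map_smul, Pi.smul_apply, Pi.smul_apply, hu S hS]⟩

lemma KBdy.ktr {n : ℕ} {x : Fin n → R} {s k : ℕ} {f : Finset (Fin n) → N} (r : ℕ)
    (hf : KBdy (x ^ s) k f) : KBdy (x ^ (s + r)) k (ktr x r f) := by
  obtain ⟨u, hu⟩ := hf
  exact ⟨Paper.ktr x r u, fun S hS => by rw [kos_ktr, ktr_apply, ktr_apply, hu S hS]⟩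

lemma KCyc.ktr {n : ℕ} {x : Fin n → R} {s k : ℕ} {f : Finset (Fin n) → N} (r : ℕ)
    (hf : KCyc (x ^ s) k f) : KCyc (x ^ (s + r)) k (ktr x r f) := by
  intro S hS
  rw [kos_ktr, ktr_apply, hf S hS, smul_zero]

lemma KCyc.kBdy_smul_of_mem {n : ℕ} {x : Fin n → R} {k : ℕ} {f : Finset (Fin n) → N}
    (hf : KCyc x k f) {a : R} (ha : a ∈ Ideal.span (Set.range x)) : KBdy x k (a • f) := by
  induction ha using Submodule.span_induction with
  | mem a ha =>
    obtain ⟨j, rfl⟩ := ha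
    refine ⟨kcontr j f, fun S hS => ?_⟩
    rw [Pi.smul_apply, ← kos_kcontr x j f S, add_eq_left]
    unfold kcontr
    split_ifs with h
    · rfl
    · rw [hf _ (by rw [Finset.card_insert_of_notMem h, hS]), smul_zero]
  | zero => exact ⟨0, fun S _ => by simp⟩
  | add a b _ _ iha ihb => rw [add_smul]; exact iha.add ihb
  | smul r a _ ih => rw [smul_eq_mul, mul_smul]; exact ih.smul r

end KoszulAlgebra

section KoszulVanishing

open scoped Pointwise

/-- The direct limit (along shifts in `ρ`) of the degree `k` Koszul cohomology of `N` vanishes. -/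
def KLim {n : ℕ} (ρ : AddSubmonoid ℕ) (x : Fin n → R) (k : ℕ) (N : Type*) [AddCommGroup N]
    [Module R N] : Prop :=
  ∀ (s : ℕ) (f : Finset (Fin n) → N), KCyc (x ^ s) k f →
    ∃ r ∈ ρ, KBdy (x ^ (s + r)) k (ktr x r f)

variable {N : Type*} [AddCommGroup N] [Module R N]

lemma KLim.top {n : ℕ} {ρ : AddSubmonoid ℕ} {x : Fin n → R} {k : ℕ} (h : KLim ρ x k N) :
    KLim ⊤ x k N := fun s f hf =>
  let ⟨r, _, hr⟩ := h s f hf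
  ⟨r, trivial, hr⟩

lemma KLim.kBdy {n : ℕ} {x : Fin n → R} {k : ℕ} (h : KLim ⊥ x k N) {s : ℕ}
    {f : Finset (Fin n) → N} (hf : KCyc (x ^ s) k f) : KBdy (x ^ s) k f := by
  obtain ⟨r, hr, h⟩ := h s f hf
  obtain rfl : r = 0 := by simpa using hr
  simpa [ktr_zero] using h

lemma KLim.of_subsingleton [Subsingleton N] {n : ℕ} (ρ : AddSubmonoid ℕ) (x : Fin n → R) (k : ℕ) :
    KLim ρ x k N := fun _ _ _ => ⟨0, ρ.zero_mem, 0, fun _ _ => Subsingleton.elim _ _⟩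

lemma exists_pow_mem_span_range_pow {n : ℕ} {x : Fin n → R} {a : R}
    (ha : a ∈ (Ideal.span (Set.range x)).radical) (s : ℕ) :
    ∃ m, a ^ m ∈ Ideal.span (Set.range (x ^ s)) := by
  have h : (Ideal.span (Set.range x)).radical ≤ (Ideal.span (Set.range (x ^ s))).radical := by
    rw [Ideal.radical_le_radical_iff, Ideal.span_le]
    rintro _ ⟨j, rfl⟩
    exact ⟨s, Ideal.subset_span ⟨j, rfl⟩⟩
  exact h ha

lemma kBdy_ktr_of_smul {n : ℕ} {ρ : AddSubmonoid ℕ} {x : Fin n → R} {k : ℕ} {a : R}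
    (ha : IsSMulRegular N a) (h : KLim ρ x k (QuotSMulTop a N)) (s : ℕ)
    (f : Finset (Fin n) → N) (hf : KBdy (x ^ s) (k + 1) (a • f)) :
    ∃ r ∈ ρ, KBdy (x ^ (s + r)) (k + 1) (ktr x r f) := by
  obtain ⟨g, hg⟩ := hf
  let q : N →ₗ[R] QuotSMulTop a N := Submodule.mkQ _
  have hq : Function.Surjective q := Submodule.mkQ_surjective _
  have hqa : ∀ u : N, q u = 0 → ∃ v, a • v = u := by
    intro u hu
    obtain ⟨v, -, hv⟩ := (Submodule.mem_smul_pointwise_iff_exists u a ⊤).1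
      ((Submodule.Quotient.mk_eq_zero _).1 hu)
    exact ⟨v, hv⟩
  have hqz : ∀ u : N, q (a • u) = 0 := fun u =>
    (Submodule.Quotient.mk_eq_zero _).2 (Submodule.smul_mem_pointwise_smul u a ⊤ trivial)
  obtain ⟨r, hr, u, hu⟩ := h s (fun S => q (g S)) (fun S hS => by
    rw [kos_comp]
    change q (kos (x ^ s) g S) = 0
    rw [← hg S hS]
    exact hqz _)
  choose v hv using fun S => hq (u S)
  obtain rfl : (fun S => q (v S)) = u := funext hv
  rw [ktr_comp, kos_comp] at hu
  have : ∀ S : Finset (Fin n), ∃ w : N, S.card = k →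
      a • w = ktr x r g S - kos (x ^ (s + r)) v S := by
    intro S
    by_cases hS : S.card = k
    · obtain ⟨w, hw⟩ := hqa (ktr x r g S - kos (x ^ (s + r)) v S) (by
        rw [map_sub, sub_eq_zero]; exact hu S hS)
      exact ⟨w, fun _ => hw⟩
    · exact ⟨0, fun h => absurd h hS⟩
  choose w hw using this
  refine ⟨r, hr, w, fun S hS => ha ?_⟩
  change a • _ = a • _
  have e1 : a • ktr x r f S = kos (x ^ (s + r)) (ktr x r g) S := by
    rw [kos_ktr, ktr_apply, ktr_apply, ← hg S hS, Pi.smul_apply, smul_comm]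
  have e2 : kos (x ^ (s + r)) (a • w) S =
      kos (x ^ (s + r)) (ktr x r g - kos (x ^ (s + r)) v) S :=
    kos_congr _ fun T hT => hw T (by omega)
  rw [map_sub, kos_kos, sub_zero, map_smul, Pi.smul_apply] at e2
  rw [e1, e2]

lemma KLim.succ_of_quotSMulTop {n : ℕ} {ρ : AddSubmonoid ℕ} {x : Fin n → R} {k : ℕ} {a : R}
    (ha : IsSMulRegular N a) (harad : a ∈ (Ideal.span (Set.range x)).radical)
    (h : KLim ρ x k (QuotSMulTop a N)) : KLim ρ x (k + 1) N := by
  intro s f hf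
  obtain ⟨m, hm⟩ := exists_pow_mem_span_range_pow harad s
  have hb := hf.kBdy_smul_of_mem hm
  clear hf hm
  induction m generalizing s f with
  | zero => exact ⟨0, ρ.zero_mem, by simpa [ktr_zero] using hb⟩
  | succ m ih =>
    rw [pow_succ', mul_smul] at hb
    obtain ⟨r, hr, h1⟩ := kBdy_ktr_of_smul ha h s _ hb
    rw [map_smul] at h1
    obtain ⟨r', hr', h2⟩ := ih _ _ h1
    refine ⟨r + r', ρ.add_mem hr hr', ?_⟩
    rwa [ktr_ktr, add_assoc] at h2

lemma KLim.zero_of_isSMulRegular {n : ℕ} {ρ : AddSubmonoid ℕ} {x : Fin n → R} {a : R}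
    (ha : IsSMulRegular N a) (harad : a ∈ (Ideal.span (Set.range x)).radical) :
    KLim ρ x 0 N := by
  intro s f hf
  obtain ⟨m, hm⟩ := exists_pow_mem_span_range_pow harad s
  refine ⟨0, ρ.zero_mem, 0, fun S hS => ?_⟩
  obtain ⟨g, hg⟩ := hf.kBdy_smul_of_mem hm
  obtain rfl := Finset.card_eq_zero.1 hS
  have h0 : a ^ m • f ∅ = 0 := by simpa [kos_apply] using hg ∅ rfl
  have : f ∅ = 0 := (ha.pow m) (by simpa using h0)
  simp [ktr_zero, this]

lemma KLim.of_isWeaklyRegular {n : ℕ} {x : Fin n → R} (ρ : AddSubmonoid ℕ) (rs : List R) (k : ℕ)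
    (hrs : RingTheory.Sequence.IsWeaklyRegular N rs)
    (hrad : ∀ a ∈ rs, a ∈ (Ideal.span (Set.range x)).radical) (hk : k < rs.length) :
    KLim ρ x k N := by
  induction rs generalizing k N with
  | nil => simp at hk
  | cons a rs ih =>
    rw [RingTheory.Sequence.isWeaklyRegular_cons_iff] at hrs
    have ha : a ∈ (Ideal.span (Set.range x)).radical := hrad a (by simp)
    cases k with
    | zero => exact .zero_of_isSMulRegular hrs.1 ha
    | succ k =>
      exact .succ_of_quotSMulTop hrs.1 ha
        (ih k hrs.2 (fun b hb => hrad b (by simp [hb])) (by simpa using hk))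

lemma KLim.of_depthGE {n : ℕ} {x : Fin n → R} (ρ : AddSubmonoid ℕ) {I : Ideal R} {N : Type}
    [AddCommGroup N] [Module R N] {m k : ℕ} (h : depthGE I N m)
    (hI : I ≤ (Ideal.span (Set.range x)).radical) (hk : k < m) : KLim ρ x k N := by
  rcases h with h | ⟨rs, rfl, h1, h2⟩
  · exact .of_subsingleton ρ x k
  · exact .of_isWeaklyRegular ρ rs k h2.toIsWeaklyRegular (fun a ha => hI (h1 a ha)) hk

lemma KLim.succ_of_quotient {n : ℕ} {x : Fin n → R} {k : ℕ} (T : Submodule R N)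
    (hT : ∀ u ∈ T, ∀ j, ∃ m : ℕ, x j ^ m • u = 0) (h : KLim ⊤ x (k + 1) (N ⧸ T)) :
    KLim ⊤ x (k + 1) N := by
  intro s f hf
  obtain ⟨r, -, u, hu⟩ := h s (fun S => T.mkQ (f S)) (fun S hS => by
    rw [kos_comp]
    change T.mkQ (kos (x ^ s) f S) = 0
    rw [hf S hS, map_zero])
  choose v hv using fun S => T.mkQ_surjective (u S)
  obtain rfl : (fun S => T.mkQ (v S)) = u := funext hv
  rw [ktr_comp, kos_comp] at hu
  have hmem : ∀ S : Finset (Fin n), S.card = k + 1 →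
      ktr x r f S - kos (x ^ (s + r)) v S ∈ T := by
    intro S hS
    rw [← T.ker_mkQ, LinearMap.mem_ker, map_sub, sub_eq_zero]
    exact hu S hS
  have : ∀ p : Finset (Fin n) × Fin n, ∃ m : ℕ, p.1.card = k + 1 →
      x p.2 ^ m • (ktr x r f p.1 - kos (x ^ (s + r)) v p.1) = 0 := by
    intro p
    by_cases hS : p.1.card = k + 1
    · obtain ⟨m, hm⟩ := hT _ (hmem p.1 hS) p.2
      exact ⟨m, fun _ => hm⟩
    · exact ⟨0, fun h => absurd h hS⟩
  choose m hm using this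
  obtain ⟨B, hB⟩ := Finite.bddAbove_range m
  refine ⟨r + B, trivial, ktr x B v, fun S hS => ?_⟩
  rw [← ktr_ktr, ← add_assoc, kos_ktr, ← sub_eq_zero, ktr_apply x B, ktr_apply x B, ← smul_sub]
  obtain ⟨j, hj⟩ : S.Nonempty := by
    rw [← Finset.card_pos]; omega
  have hle : m (S, j) ≤ B := hB ⟨_, rfl⟩
  obtain ⟨c, hc⟩ : x j ^ m (S, j) ∣ (∏ j ∈ S, x j) ^ B :=
    (pow_dvd_pow _ hle).trans (pow_dvd_pow_of_dvd (Finset.dvd_prod_of_mem x hj) B)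
  rw [hc, mul_comm, mul_smul, hm (S, j) hS, smul_zero]

lemma not_le_of_mem_associatedPrimes [IsNoetherianRing R] {I p : Ideal R}
    (h : ∀ u : N, (∀ a ∈ I, a • u = 0) → u = 0) (hp : p ∈ associatedPrimes R N) : ¬ I ≤ p := by
  intro hIp
  obtain ⟨hp1, u, hu⟩ := isAssociatedPrime_iff.1 hp
  have hmem : ∀ a, a ∈ p ↔ a • u = 0 := fun a => by
    rw [hu]; simp [Submodule.mem_colon]
  have h0 : u = 0 := h u fun a ha => (hmem a).1 (hIp ha)
  exact hp1.one_notMem ((hmem 1).2 (by simp [h0]))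

lemma exists_isSMulRegular_of_forall_ne_zero [IsNoetherianRing R] [Module.Finite R N] {I : Ideal R}
    (h : ∀ u : N, (∀ a ∈ I, a • u = 0) → u = 0) : ∃ a ∈ I, IsSMulRegular N a := by
  by_contra! hcon
  have hsub : (I : Set R) ⊆ ⋃ p ∈ associatedPrimes R N, (p : Set R) := by
    rw [biUnion_associatedPrimes_eq_compl_regular]
    exact fun a ha => hcon a ha
  obtain ⟨p, hp, hIp⟩ := (Ideal.subset_union_prime_finite (associatedPrimes.finite R N)
    (f := id) 0 0 fun _ h _ _ => h.isPrime).1 hsub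
  exact not_le_of_mem_associatedPrimes h hp hIp

lemma eq_zero_of_forall_smul_quotient_torsionSubmodule {I : Ideal R} (hI : I.FG) {N : Type}
    [AddCommGroup N] [Module R N] (u : N ⧸ torsionSubmodule I N) (h : ∀ a ∈ I, a • u = 0) :
    u = 0 := by
  obtain ⟨u, rfl⟩ := Submodule.mkQ_surjective _ u
  obtain ⟨G, rfl⟩ := hI
  rw [← LinearMap.mem_ker, Submodule.ker_mkQ]
  have h1 : ∀ a : G, ∃ t : ℕ, ∀ r ∈ Ideal.span (G : Set R) ^ t, r • a.1 • u = 0 := fun a => by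
    have := h a.1 (Ideal.subset_span a.2)
    rwa [← map_smul, ← LinearMap.mem_ker, Submodule.ker_mkQ] at this
  choose t ht using h1
  obtain ⟨B, hB⟩ := Finite.bddAbove_range t
  refine ⟨B + 1, fun r hr => ?_⟩
  rw [pow_succ] at hr
  refine Submodule.mul_induction_on hr (fun r hr a ha => ?_) fun a b ha hb => by
    rw [add_smul, ha, hb, add_zero]
  rw [mul_smul]
  induction ha using Submodule.span_induction with
  | mem a ha => exact ht ⟨a, ha⟩ r (Ideal.pow_le_pow_right (hB ⟨_, rfl⟩) hr)
  | zero => simp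
  | add a b _ _ iha ihb => rw [add_smul, smul_add, iha, ihb, add_zero]
  | smul c a _ ih => rw [smul_eq_mul, mul_smul, smul_comm, ih, smul_zero]

lemma pow_smul_eq_zero_of_mem_torsionSubmodule {I : Ideal R} {N : Type}
    [AddCommGroup N] [Module R N] {u : N} (hu : u ∈ torsionSubmodule I N) {a : R} (ha : a ∈ I) :
    ∃ m : ℕ, a ^ m • u = 0 := by
  obtain ⟨m, hm⟩ := hu
  exact ⟨m, hm _ (Ideal.pow_mem_pow ha m)⟩

lemma KLim.of_supportDim_lt [IsNoetherianRing R] {n : ℕ} {x : Fin n → R} (q : ℕ) (N : Type)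
    [AddCommGroup N] [Module R N] [Module.Finite R N]
    (hN : Module.supportDim R N < (q : WithBot ℕ∞)) (p : ℕ) (hp : q ≤ p) : KLim ⊤ x p N := by
  induction q generalizing N p with
  | zero =>
    have : Subsingleton N := by
      rw [← Module.supportDim_eq_bot_iff_subsingleton R]
      by_contra hne
      obtain ⟨m, hm⟩ := WithBot.ne_bot_iff_exists.1 hne
      rw [← hm] at hN
      exact absurd hN (by simp [-WithBot.coe_zero])
    exact .of_subsingleton _ _ _
  | succ q ih =>
    obtain ⟨p, rfl⟩ := Nat.exists_eq_add_of_le' (Nat.lt_of_lt_of_le (Nat.succ_pos q) hp)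
    set I := Ideal.span (Set.range x)
    refine .succ_of_quotient (torsionSubmodule I N) (fun u hu j =>
      pow_smul_eq_zero_of_mem_torsionSubmodule hu (Ideal.subset_span ⟨j, rfl⟩)) ?_
    obtain ⟨a, haI, ha⟩ := exists_isSMulRegular_of_forall_ne_zero
      (eq_zero_of_forall_smul_quotient_torsionSubmodule (N := N) (IsNoetherian.noetherian I))
    refine .succ_of_quotSMulTop ha (Ideal.le_radical haI) (ih _ ?_ p (by omega))
    have h1 := Module.supportDim_quotSMulTop_succ_le_of_notMem_minimalPrimes
      (fun p hp => ha.notMem_of_mem_minimalPrimes hp)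
    have h2 := Module.supportDim_le_of_surjective (torsionSubmodule I N).mkQ
      (Submodule.mkQ_surjective _)
    have h3 := (h1.trans h2).trans_lt hN
    by_contra hcon
    rw [not_lt] at hcon
    refine absurd h3 (not_lt.2 ?_)
    push_cast
    exact add_le_add_left hcon 1

lemma KLim.of_modDimLE [IsNoetherianRing R] {n : ℕ} {x : Fin n → R} {q p : ℕ} {N : Type}
    [AddCommGroup N] [Module R N] [Module.Finite R N] (hN : modDimLE (R := R) N q) (hp : q < p) :
    KLim ⊤ x p N := by
  refine .of_supportDim_lt (q + 1) N ?_ p hp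
  rw [Module.supportDim_eq_ringKrullDim_quotient_annihilator]
  refine lt_of_le_of_lt hN ?_
  change ((q : ℕ) : WithBot ℕ∞) < ((q + 1 : ℕ) : WithBot ℕ∞)
  exact Nat.cast_lt.2 (Nat.lt_succ_self q)

end KoszulVanishing

section Bridge

variable {N : Type} [AddCommGroup N] [Module R N]

/-- Restriction of a function of finsets to finsets of cardinality `i`. -/
def kres {N : Type} {n : ℕ} (i : ℕ) (F : Finset (Fin n) → N) : KCochain n N i := fun S => F S.1

lemma exists_kres_eq {n i : ℕ} (f : KCochain n N i) : ∃ F, kres i F = f := by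
  classical
  refine ⟨fun S => if h : S.card = i then f ⟨S, h⟩ else 0, funext fun S => ?_⟩
  simp [kres, S.2]

lemma kd_kres {n : ℕ} (x : Fin n → R) (t i : ℕ) (F : Finset (Fin n) → N) :
    kd x t i (kres i F) = kres (i + 1) (kos (x ^ t) F) := by
  funext T
  unfold kd kres
  rw [kos_apply, ← Finset.sum_attach T.1]
  rfl

lemma kTrans_kres {n : ℕ} (x : Fin n → R) (s i : ℕ) (F : Finset (Fin n) → N) :
    kTrans x s i (kres i F) = kres i (ktr x s F) := rfl

lemma kres_eq_iff {N : Type} {n i : ℕ} {F G : Finset (Fin n) → N} :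
    kres i F = kres i G ↔ ∀ S : Finset (Fin n), S.card = i → F S = G S := by
  constructor
  · intro h S hS
    exact congrFun h ⟨S, hS⟩
  · intro h
    funext S
    exact h S.1 S.2

lemma kd_kres_eq_zero_iff {n : ℕ} {x : Fin n → R} {t i : ℕ} {F : Finset (Fin n) → N} :
    kd x t i (kres i F) = 0 ↔ KCyc (x ^ t) i F := by
  rw [kd_kres]
  exact kres_eq_iff (G := 0)

lemma isKBoundary_kres_iff {n : ℕ} {x : Fin n → R} {t i : ℕ} {F : Finset (Fin n) → N} :
    IsKBoundary x t i (kres i F) ↔ KBdy (x ^ t) i F := by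
  cases i with
  | zero =>
    rw [show IsKBoundary x t 0 (kres 0 F) ↔ kres 0 F = kres 0 (0 : Finset (Fin n) → N) from
      Iff.rfl, kres_eq_iff]
    constructor
    · intro h
      exact ⟨0, fun S hS => by rw [map_zero]; exact h S hS⟩
    · rintro ⟨g, hg⟩ S hS
      rw [hg S hS, Finset.card_eq_zero.1 hS]
      simp [kos_apply]
  | succ i =>
    constructor
    · rintro ⟨g, hg⟩
      obtain ⟨G, rfl⟩ := exists_kres_eq g
      rw [kd_kres, kres_eq_iff] at hg
      exact ⟨G, fun S hS => (hg S hS).symm⟩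
    · rintro ⟨G, hG⟩
      exact ⟨kres i G, by rw [kd_kres, kres_eq_iff]; exact fun S hS => (hG S hS).symm⟩

lemma kGenLE_of_kLim {n : ℕ} {x : Fin n → R} {k : ℕ} (h : KLim ⊤ x k N)
    (ℳ : ℤ → AddSubgroup N) (e : Fin n → ℤ) (B : ℤ) : KGenLE x ℳ e k B := by
  intro t ℓ f hf _
  obtain ⟨F, rfl⟩ := exists_kres_eq f
  obtain ⟨r, -, hr⟩ := h t F (kd_kres_eq_zero_iff.1 hf)
  refine ⟨r, kTrans x r k (kres k F), 0, ?_, Submodule.zero_mem _, by rw [add_zero]⟩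
  rwa [kTrans_kres, isKBoundary_kres_iff]

lemma kCyc_zero_iff {n : ℕ} {x : Fin n → R} {F : Finset (Fin n) → N} :
    KCyc x 0 F ↔ ∀ j, x j • F ∅ = 0 := by
  constructor
  · intro h j
    simpa [kos_apply, ksgn, Finset.filter_singleton] using h {j} (by simp)
  · intro h S hS
    obtain ⟨j, rfl⟩ := Finset.card_eq_one.1 hS
    simp [kos_apply, h]


lemma mem_torsionSubmodule_of_le_radical [IsNoetherianRing R] {I J : Ideal R} {u : N}
    (hIJ : I ≤ J.radical) (h : ∀ a ∈ J, a • u = 0) : u ∈ torsionSubmodule I N := by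
  obtain ⟨m, hm⟩ := Ideal.exists_pow_le_of_le_radical_of_fg hIJ (IsNoetherian.noetherian I)
  exact ⟨m, fun r hr => h r (hm hr)⟩

lemma mem_torsionSubmodule_of_pow_smul [IsNoetherianRing R] {I : Ideal R} {n : ℕ} {x : Fin n → R}
    {u : N} {t : ℕ} (hI : I ≤ (Ideal.span (Set.range x)).radical) (h : ∀ j, x j ^ t • u = 0) :
    u ∈ torsionSubmodule I N := by
  refine mem_torsionSubmodule_of_le_radical (J := Ideal.span (Set.range (x ^ t)))
    (fun a ha => ?_) fun a ha => ?_
  · obtain ⟨m, hm⟩ := hI ha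
    obtain ⟨m', hm'⟩ := exists_pow_mem_span_range_pow (Ideal.le_radical hm) t
    exact ⟨m * m', by rwa [pow_mul]⟩
  · induction ha using Submodule.span_induction with
    | mem a ha => obtain ⟨j, rfl⟩ := ha; exact h j
    | zero => simp
    | add a b _ _ iha ihb => rw [add_smul, iha, ihb, add_zero]
    | smul c a _ ih => rw [smul_eq_mul, mul_smul, ih, smul_zero]

lemma exists_pow_smul_torsionSubmodule_eq_zero [IsNoetherian R N] (I : Ideal R) :
    ∃ m : ℕ, ∀ r ∈ I ^ m, ∀ u ∈ torsionSubmodule I N, r • u = 0 := by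
  obtain ⟨G, hG⟩ := IsNoetherian.noetherian (torsionSubmodule I N)
  have h1 : ∀ u : G, ∃ t : ℕ, ∀ r ∈ I ^ t, r • u.1 = 0 := fun u => by
    have : u.1 ∈ torsionSubmodule I N := by rw [← hG]; exact Submodule.subset_span u.2
    exact this
  choose t ht using h1
  obtain ⟨B, hB⟩ := Finite.bddAbove_range t
  refine ⟨B, fun r hr u hu => ?_⟩
  rw [← hG] at hu
  induction hu using Submodule.span_induction with
  | mem u hu => exact ht ⟨u, hu⟩ r (Ideal.pow_le_pow_right (hB ⟨_, rfl⟩) hr)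
  | zero => simp
  | add a b _ _ iha ihb => rw [smul_add, iha, ihb, add_zero]
  | smul c a _ ih => rw [smul_comm, ih, smul_zero]

lemma kGenLE_zero_of_torsion [IsNoetherianRing R] [Module.Finite R N] {n : ℕ} {x : Fin n → R}
    {I : Ideal R} (hI : Ideal.span (Set.range x) = I) (ℳ : ℤ → AddSubgroup N) (e : Fin n → ℤ)
    (B : ℤ) (h : ∀ ℓ, ∀ u ∈ torsionSubmodule I N, u ∈ ℳ ℓ →
      u ∈ Submodule.span R {v | v ∈ torsionSubmodule I N ∧ ∃ ℓ' ≤ B, v ∈ ℳ ℓ'}) :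
    KGenLE x ℳ e 0 B := by
  intro t ℓ f hf hhom
  obtain ⟨F, rfl⟩ := exists_kres_eq f
  rw [kd_kres_eq_zero_iff, kCyc_zero_iff] at hf
  obtain ⟨m, hm⟩ := exists_pow_smul_torsionSubmodule_eq_zero (N := N) I
  have hu := h ℓ (F ∅) (mem_torsionSubmodule_of_pow_smul (hI ▸ Ideal.le_radical) hf)
    (by simpa [kres] using hhom ⟨∅, rfl⟩)
  let κ : N →ₗ[R] KCochain n N 0 := LinearMap.pi fun _ => LinearMap.id
  have hκ : ∀ v, κ v = kres 0 fun _ => v := fun v => rfl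
  refine ⟨m, 0, κ (F ∅), rfl, ?_, ?_⟩
  · have := Submodule.mem_map_of_mem (f := κ) hu
    rw [Submodule.map_span] at this
    refine Submodule.span_mono ?_ this
    rintro _ ⟨v, ⟨hv, ℓ', hℓ', hvℓ⟩, rfl⟩
    refine ⟨?_, ℓ', hℓ', fun S => ?_⟩
    · rw [hκ, kd_kres_eq_zero_iff, kCyc_zero_iff]
      intro j
      refine hm _ ?_ v hv
      rw [Pi.pow_apply, pow_add]
      exact Ideal.mul_mem_left _ _ (Ideal.pow_mem_pow (hI ▸ Ideal.subset_span ⟨j, rfl⟩) m)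
    · rw [Finset.card_eq_zero.1 S.2]
      simpa [κ] using hvℓ
  · rw [zero_add, kTrans_kres, hκ, kres_eq_iff]
    intro S hS
    rw [Finset.card_eq_zero.1 hS]
    simp [ktr_apply]

end Bridge

section HomogeneousAvoidance

/-- Elements that are homogeneous of positive degree. -/
def PosHomog (𝒜 : ℤ → AddSubgroup R) (a : R) : Prop := ∃ ε : ℤ, 0 < ε ∧ a ∈ 𝒜 ε

lemma PosHomog.isHomogeneousElem {𝒜 : ℤ → AddSubgroup R} {a : R} (ha : PosHomog 𝒜 a) :
    SetLike.IsHomogeneousElem 𝒜 a :=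
  let ⟨ε, _, h⟩ := ha
  ⟨ε, h⟩

variable {𝒜 : ℤ → AddSubgroup R} [GradedRing 𝒜]

lemma PosHomog.pow {a : R} (ha : PosHomog 𝒜 a) {m : ℕ} (hm : m ≠ 0) : PosHomog 𝒜 (a ^ m) := by
  obtain ⟨ε, hε, h⟩ := ha
  exact ⟨m • ε, by positivity, SetLike.pow_mem_graded m h⟩

lemma PosHomog.mem_maxHomIdeal {a : R} (ha : PosHomog 𝒜 a) : a ∈ maxHomIdeal 𝒜 := by
  obtain ⟨ε, hε, h⟩ := ha
  exact Ideal.subset_span (Or.inr (Set.mem_iUnion₂.2 ⟨ε, hε.ne', h⟩))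

lemma exists_posHomog_notMem_of_forall_mem (hnonneg : ∀ i : ℤ, i < 0 → 𝒜 i = ⊥) {p : Ideal R}
    (hp : p.IsPrime) (Q : Finset (Ideal R)) (hQ : ∀ q ∈ Q, q.IsHomogeneous 𝒜 ∧ ¬ q ≤ p)
    {c : R} (hc : PosHomog 𝒜 c) (hcp : c ∉ p) : ∃ b, PosHomog 𝒜 b ∧ b ∉ p ∧ ∀ q ∈ Q, b ∈ q := by
  classical
  induction Q using Finset.induction_on with
  | empty => exact ⟨c, hc, hcp, by simp⟩
  | insert q Q _ ih =>
    obtain ⟨b, ⟨ε, hε, hb⟩, hbp, hbQ⟩ := ih fun q hq => hQ q (Finset.mem_insert_of_mem hq)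
    obtain ⟨hqh, hqp⟩ := hQ q (Finset.mem_insert_self _ _)
    obtain ⟨a, haq, hap⟩ := SetLike.not_le_iff_exists.1 hqp
    have : ∃ i, ((DirectSum.decompose 𝒜 a i : 𝒜 i) : R) ∉ p := by
      by_contra! hcon
      refine hap ?_
      rw [← DirectSum.sum_support_decompose 𝒜 a]
      exact p.sum_mem fun i _ => hcon i
    obtain ⟨i, hi⟩ := this
    have hi0 : 0 ≤ i := by
      by_contra! hlt
      have h0 : ((DirectSum.decompose 𝒜 a i : 𝒜 i) : R) ∈ (⊥ : AddSubgroup R) :=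
        (hnonneg i hlt).le (DirectSum.decompose 𝒜 a i).2
      exact hi (by rw [AddSubgroup.mem_bot.1 h0]; exact p.zero_mem)
    refine ⟨_ * b, ⟨i + ε, by positivity, SetLike.mul_mem_graded (DirectSum.decompose 𝒜 a i).2 hb⟩,
      fun h => (hp.mem_or_mem h).elim hi hbp, fun q' hq' => ?_⟩
    rcases Finset.mem_insert.1 hq' with rfl | hq'
    · exact q'.mul_mem_right _ (hqh i haq)
    · exact q'.mul_mem_left _ (hbQ q' hq')

lemma exists_posHomog_forall_notMem_of_isHomogeneous (hnonneg : ∀ i : ℤ, i < 0 → 𝒜 i = ⊥)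
    (Q : Finset (Ideal R)) (hQ : ∀ q ∈ Q, q.IsPrime ∧ q.IsHomogeneous 𝒜)
    (hpos : ∀ q ∈ Q, ∃ a, PosHomog 𝒜 a ∧ a ∉ q) (hex : ∃ a, PosHomog 𝒜 a) :
    ∃ a, PosHomog 𝒜 a ∧ ∀ q ∈ Q, a ∉ q := by
  classical
  induction hn : Q.card generalizing Q with
  | zero =>
    obtain rfl := Finset.card_eq_zero.1 hn
    obtain ⟨a, ha⟩ := hex
    exact ⟨a, ha, by simp⟩
  | succ m ih =>
    obtain ⟨p, hpQ, hpmin⟩ := Finset.exists_minimal (s := Q) (Finset.card_pos.1 (by omega))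
    obtain ⟨a, ha, haQ⟩ := ih (Q.erase p) (fun q hq => hQ q (Finset.mem_of_mem_erase hq))
      (fun q hq => hpos q (Finset.mem_of_mem_erase hq)) (by rw [Finset.card_erase_of_mem hpQ, hn]; rfl)
    by_cases hap : a ∈ p
    · obtain ⟨c, hc, hcp⟩ := hpos p hpQ
      obtain ⟨b, ⟨β, hβ, hb⟩, hbp, hbQ⟩ := exists_posHomog_notMem_of_forall_mem hnonneg (hQ p hpQ).1
        (Q.erase p) (fun q hq => ⟨(hQ q (Finset.mem_of_mem_erase hq)).2, fun hle =>
          Finset.ne_of_mem_erase hq (le_antisymm hle (hpmin (Finset.mem_of_mem_erase hq) hle))⟩)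
        hc hcp
      obtain ⟨α, hα, ha⟩ := ha
      have hα0 : α.toNat ≠ 0 := by omega
      have hβ0 : β.toNat ≠ 0 := by omega
      refine ⟨a ^ β.toNat + b ^ α.toNat, ⟨β * α, by positivity, add_mem ?_ ?_⟩, fun q hq h => ?_⟩
      · have := SetLike.pow_mem_graded β.toNat ha
        rwa [nsmul_eq_mul, Int.toNat_of_nonneg hβ.le] at this
      · have := SetLike.pow_mem_graded α.toNat hb
        rwa [nsmul_eq_mul, Int.toNat_of_nonneg hα.le, mul_comm] at this
      · by_cases hqp : q = p
        · subst hqp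
          exact hbp ((hQ q hq).1.mem_of_pow_mem _
            ((q.add_mem_iff_right (q.pow_mem_of_mem hap _ (Nat.pos_of_ne_zero hβ0))).1 h))
        · have hq' := Finset.mem_erase.2 ⟨hqp, hq⟩
          exact haQ q hq' ((hQ q hq).1.mem_of_pow_mem _
            ((q.add_mem_iff_left (q.pow_mem_of_mem (hbQ q hq') _ (Nat.pos_of_ne_zero hα0))).1 h))
    · refine ⟨a, ha, fun q hq => ?_⟩
      by_cases hqp : q = p
      · exact hqp ▸ hap
      · exact haQ q (Finset.mem_erase.2 ⟨hqp, hq⟩)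

lemma exists_posHomog_forall_notMem (hnonneg : ∀ i : ℤ, i < 0 → 𝒜 i = ⊥)
    (Q : Finset (Ideal R)) (hQ : ∀ q ∈ Q, q.IsPrime)
    (hpos : ∀ q ∈ Q, ∃ a, PosHomog 𝒜 a ∧ a ∉ q) (hex : ∃ a, PosHomog 𝒜 a) :
    ∃ a, PosHomog 𝒜 a ∧ ∀ q ∈ Q, a ∉ q := by
  classical
  obtain ⟨a, ha, h⟩ := exists_posHomog_forall_notMem_of_isHomogeneous hnonneg
    (Q.image fun q => (q.homogeneousCore 𝒜).toIdeal) (by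
      intro q hq'
      obtain ⟨q, hq, rfl⟩ := Finset.mem_image.1 hq'
      exact ⟨(hQ q hq).homogeneousCore, (q.homogeneousCore 𝒜).isHomogeneous⟩) (by
      intro q hq'
      obtain ⟨q, hq, rfl⟩ := Finset.mem_image.1 hq'
      obtain ⟨a, ha, haq⟩ := hpos q hq
      exact ⟨a, ha, fun h => haq (Ideal.toIdeal_homogeneousCore_le 𝒜 q h)⟩) hex
  exact ⟨a, ha, fun q hq haq => h _ (Finset.mem_image_of_mem _ hq)
    (Ideal.mem_homogeneousCore_of_homogeneous_of_mem ha.isHomogeneousElem haq)⟩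

lemma notMem_of_mem_maxHomIdeal_zero (hne : maxHomIdeal 𝒜 ≠ ⊤) {a : R} (h : a ∈ 𝒜 0)
    (ha : a ∈ maxHomIdeal 𝒜) : ¬ IsUnit (⟨a, h⟩ : 𝒜 0) := by
  intro hu
  obtain ⟨b, hb⟩ := hu.exists_right_inv
  apply hne
  rw [Ideal.eq_top_iff_one]
  have : a * b.1 = 1 := congrArg Subtype.val hb
  rw [← this]
  exact Ideal.mul_mem_right _ _ ha

lemma isMaximal_maxHomIdeal (hne : maxHomIdeal 𝒜 ≠ ⊤) : (maxHomIdeal 𝒜).IsMaximal := by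
  rw [Ideal.isMaximal_iff]
  refine ⟨fun h => hne ((Ideal.eq_top_iff_one _).2 h), fun J a hJ ha haJ => ?_⟩
  classical
  have hrest : a - (DirectSum.decompose 𝒜 a 0 : 𝒜 0) ∈ maxHomIdeal 𝒜 := by
    by_cases h0 : (0 : ℤ) ∈ (DirectSum.decompose 𝒜 a).support
    · nth_rw 1 [← DirectSum.sum_support_decompose 𝒜 a]
      rw [← Finset.add_sum_erase _ _ h0, add_sub_cancel_left]
      refine Ideal.sum_mem _ fun i hi => Ideal.subset_span (Or.inr (Set.mem_iUnion₂.2 ⟨i, ?_, ?_⟩))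
      · exact (Finset.mem_erase.1 hi).1
      · exact (DirectSum.decompose 𝒜 a i).2
    · rw [DFinsupp.notMem_support_iff.1 h0]
      nth_rw 1 [← DirectSum.sum_support_decompose 𝒜 a]
      rw [ZeroMemClass.coe_zero, sub_zero]
      refine Ideal.sum_mem _ fun i hi => Ideal.subset_span (Or.inr (Set.mem_iUnion₂.2 ⟨i, ?_, ?_⟩))
      · exact fun h => h0 (h ▸ hi)
      · exact (DirectSum.decompose 𝒜 a i).2
  have h0 : ((DirectSum.decompose 𝒜 a 0 : 𝒜 0) : R) ∈ J := by
    have := J.sub_mem haJ (hJ hrest)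
    rwa [sub_sub_cancel] at this
  have hu : IsUnit (DirectSum.decompose 𝒜 a 0 : 𝒜 0) := by
    by_contra hu
    refine ha ?_
    have := (maxHomIdeal 𝒜).add_mem hrest
      (Ideal.subset_span (Or.inl ⟨(DirectSum.decompose 𝒜 a 0).2, hu⟩))
    rwa [sub_add_cancel] at this
  obtain ⟨b, hb⟩ := hu.exists_right_inv
  have : ((DirectSum.decompose 𝒜 a 0 : 𝒜 0) : R) * b.1 = 1 := congrArg Subtype.val hb
  rw [← this]
  exact J.mul_mem_right _ h0

lemma le_maxHomIdeal_of_isHomogeneous {P : Ideal R} (hP : P ≠ ⊤) (hPh : P.IsHomogeneous 𝒜) :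
    P ≤ maxHomIdeal 𝒜 := by
  classical
  intro a ha
  rw [← DirectSum.sum_support_decompose 𝒜 a]
  refine Ideal.sum_mem _ fun i _ => Ideal.subset_span ?_
  by_cases hi : i = 0
  · subst hi
    refine Or.inl ⟨(DirectSum.decompose 𝒜 a 0).2, fun hu => hP ?_⟩
    obtain ⟨b, hb⟩ := hu.exists_right_inv
    rw [Ideal.eq_top_iff_one]
    have : ((DirectSum.decompose 𝒜 a 0 : 𝒜 0) : R) * b.1 = 1 := congrArg Subtype.val hb
    rw [← this]
    exact P.mul_mem_right _ (hPh 0 ha)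
  · exact Or.inr (Set.mem_iUnion₂.2 ⟨i, hi, (DirectSum.decompose 𝒜 a i).2⟩)

lemma exists_posHomog_notMem (hnonneg : ∀ i : ℤ, i < 0 → 𝒜 i = ⊥) (hloc : IsLocalRing ↥(𝒜 0))
    (hart : IsArtinianRing ↥(𝒜 0)) (hne : maxHomIdeal 𝒜 ≠ ⊤) {n : ℕ} {y : Fin n → R}
    {e : Fin n → ℤ} (hyhomog : ∀ j, y j ∈ 𝒜 (e j)) (hygen : Ideal.span (Set.range y) = maxHomIdeal 𝒜)
    {p : Ideal R} (hp : p.IsPrime) (hmp : ¬ maxHomIdeal 𝒜 ≤ p) : ∃ a, PosHomog 𝒜 a ∧ a ∉ p := by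
  rw [← hygen, Ideal.span_le, Set.not_subset] at hmp
  obtain ⟨_, ⟨j, rfl⟩, hj⟩ := hmp
  refine ⟨y j, ⟨e j, ?_, hyhomog j⟩, hj⟩
  by_contra! hle
  rcases hle.lt_or_eq with hlt | h0
  · have := hyhomog j
    rw [hnonneg _ hlt, AddSubgroup.mem_bot] at this
    exact hj (by rw [this]; exact p.zero_mem)
  · have hy0 : y j ∈ 𝒜 0 := h0 ▸ hyhomog j
    have hnil := Ring.KrullDimLE.isNilpotent_iff_mem_nonunits.mpr
      (notMem_of_mem_maxHomIdeal_zero hne hy0 (hygen ▸ Ideal.subset_span ⟨j, rfl⟩))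
    obtain ⟨m, hm⟩ := hnil
    have : y j ^ m = 0 := congrArg Subtype.val hm
    exact hj (hp.mem_of_pow_mem m (by rw [this]; exact p.zero_mem))

end HomogeneousAvoidance

section RegularSequences

open scoped Pointwise
open RingTheory.Sequence

variable {N : Type} [AddCommGroup N] [Module R N]

lemma KLim.quotSMulTop {n : ℕ} {x : Fin n → R} {k : ℕ} {a : R} (ha : IsSMulRegular N a)
    (h0 : KLim ⊥ x k N) (h1 : KLim ⊥ x (k + 1) N) : KLim ⊥ x k (QuotSMulTop a N) := by
  intro s f hf
  let q : N →ₗ[R] QuotSMulTop a N := Submodule.mkQ _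
  have hqa : ∀ u : N, q u = 0 → ∃ v, a • v = u := by
    intro u hu
    obtain ⟨v, -, hv⟩ := (Submodule.mem_smul_pointwise_iff_exists u a ⊤).1
      ((Submodule.Quotient.mk_eq_zero _).1 hu)
    exact ⟨v, hv⟩
  have hqz : ∀ u : N, q (a • u) = 0 := fun u =>
    (Submodule.Quotient.mk_eq_zero _).2 (Submodule.smul_mem_pointwise_smul u a ⊤ trivial)
  choose F hF using fun S => Submodule.mkQ_surjective (a • (⊤ : Submodule R N)) (f S)
  obtain rfl : (fun S => q (F S)) = f := funext hF
  have : ∀ S : Finset (Fin n), ∃ w : N, S.card = k + 1 → a • w = kos (x ^ s) F S := by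
    intro S
    by_cases hS : S.card = k + 1
    · have h2 := hf S hS
      rw [kos_comp] at h2
      obtain ⟨w, hw⟩ := hqa _ h2
      exact ⟨w, fun _ => hw⟩
    · exact ⟨0, fun h => absurd h hS⟩
  choose g hg using this
  have hgc : KCyc (x ^ s) (k + 1) g := by
    intro S hS
    apply ha
    change a • _ = a • _
    rw [smul_zero, ← Pi.smul_apply, ← map_smul]
    exact (kos_congr _ fun T hT => hg T (by omega)).trans (congrFun (kos_kos (x ^ s) F) S)
  obtain ⟨v, hv⟩ := h1.kBdy hgc
  have hc : KCyc (x ^ s) k (F - a • v) := by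
    intro S hS
    rw [map_sub, map_smul, Pi.sub_apply, Pi.smul_apply, ← hv S hS, hg S hS, sub_self]
  obtain ⟨w, hw⟩ := h0.kBdy hc
  refine ⟨0, rfl, fun S => q (w S), fun S hS => ?_⟩
  rw [add_zero, ktr_zero, kos_comp]
  change q (F S) = q (kos (x ^ s) w S)
  rw [← hw S hS, Pi.sub_apply, map_sub, Pi.smul_apply, hqz, sub_zero]

lemma KLim.eq_zero {n : ℕ} {x : Fin n → R} (h : KLim ⊥ x 0 N) (u : N)
    (hu : ∀ a ∈ Ideal.span (Set.range x), a • u = 0) : u = 0 := by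
  obtain ⟨g, hg⟩ := h.kBdy (s := 1) (f := fun _ => u) (fun S hS => by
    rw [pow_one]
    exact kCyc_zero_iff.2 (fun j => hu _ (Ideal.subset_span ⟨j, rfl⟩)) S hS)
  simpa [kos_apply] using hg ∅ rfl

lemma exists_isWeaklyRegular_posHomog [IsNoetherianRing R] {𝒜 : ℤ → AddSubgroup R} [GradedRing 𝒜]
    (hnonneg : ∀ i : ℤ, i < 0 → 𝒜 i = ⊥) {n : ℕ} {y : Fin n → R}
    (hpos : ∀ p : Ideal R, p.IsPrime → ¬ Ideal.span (Set.range y) ≤ p →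
      ∃ a, PosHomog 𝒜 a ∧ a ∉ p) (m : ℕ) (A B : Type)
    [AddCommGroup A] [Module R A] [Module.Finite R A] [AddCommGroup B] [Module R B]
    [Module.Finite R B] (hA : ∀ k < m, KLim ⊥ y k A) (hB : ∀ k < m, KLim ⊥ y k B) :
    ∃ rs : List R, rs.length = m ∧ (∀ a ∈ rs, PosHomog 𝒜 a) ∧ IsWeaklyRegular A rs ∧
      IsWeaklyRegular B rs := by
  classical
  induction m generalizing A B with
  | zero => exact ⟨[], rfl, by simp, by simp, by simp⟩
  | succ m ih =>
    have hass : ∀ (N : Type) [AddCommGroup N] [Module R N] [Module.Finite R N], KLim ⊥ y 0 N →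
        ∀ p ∈ associatedPrimes R N, p.IsPrime ∧ ∃ a, PosHomog 𝒜 a ∧ a ∉ p := fun N _ _ _ h p hp =>
      ⟨hp.isPrime, hpos p hp.isPrime (not_le_of_mem_associatedPrimes h.eq_zero hp)⟩
    have hQ : ∀ q ∈ (associatedPrimes.finite R A).toFinset ∪ (associatedPrimes.finite R B).toFinset,
        q.IsPrime ∧ ∃ a, PosHomog 𝒜 a ∧ a ∉ q := by
      intro q hq
      rcases Finset.mem_union.1 hq with hq | hq
      · exact hass A (hA 0 (Nat.succ_pos m)) q ((Set.Finite.mem_toFinset _).1 hq)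
      · exact hass B (hB 0 (Nat.succ_pos m)) q ((Set.Finite.mem_toFinset _).1 hq)
    obtain ⟨a, ha, hareg⟩ := exists_posHomog_forall_notMem hnonneg _ (fun q hq => (hQ q hq).1)
      (fun q hq => (hQ q hq).2) ⟨0, 1, one_pos, zero_mem _⟩
    have hreg : ∀ (N : Type) [AddCommGroup N] [Module R N],
        (∀ p ∈ associatedPrimes R N, a ∉ p) → IsSMulRegular N a := by
      intro N _ _ h
      by_contra hcon
      have : a ∈ ⋃ p ∈ associatedPrimes R N, (p : Set R) := by
        rw [biUnion_associatedPrimes_eq_compl_regular]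
        exact hcon
      obtain ⟨p, hp, hap⟩ := Set.mem_iUnion₂.1 this
      exact h p hp hap
    have haA := hreg A fun p hp =>
      hareg p (Finset.mem_union_left _ ((Set.Finite.mem_toFinset _).2 hp))
    have haB := hreg B fun p hp =>
      hareg p (Finset.mem_union_right _ ((Set.Finite.mem_toFinset _).2 hp))
    obtain ⟨rs, hlen, hrs, hrA, hrB⟩ := ih (QuotSMulTop a A) (QuotSMulTop a B)
      (fun k hk => .quotSMulTop haA (hA k (by omega)) (hA (k + 1) (by omega)))
      (fun k hk => .quotSMulTop haB (hB k (by omega)) (hB (k + 1) (by omega)))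
    exact ⟨a :: rs, by simp [hlen], by simpa using ⟨ha, hrs⟩,
      (isWeaklyRegular_cons_iff ..).2 ⟨haA, hrA⟩, (isWeaklyRegular_cons_iff ..).2 ⟨haB, hrB⟩⟩

lemma supportDim_add_length_le (rs : List R) (N : Type) [AddCommGroup N] [Module R N]
    [Module.Finite R N] (h : IsWeaklyRegular N rs) :
    Module.supportDim R (N ⧸ (Ideal.ofList rs • ⊤ : Submodule R N)) + rs.length ≤
      Module.supportDim R N := by
  induction rs generalizing N with
  | nil =>
    simpa using Module.supportDim_le_of_surjective (Submodule.mkQ _) (Submodule.mkQ_surjective _)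
  | cons a rs ih =>
    rw [isWeaklyRegular_cons_iff] at h
    have h1 := Module.supportDim_quotSMulTop_succ_le_of_notMem_minimalPrimes
      (fun p hp => h.1.notMem_of_mem_minimalPrimes hp)
    have h2 := ih _ h.2
    rw [← Module.supportDim_eq_of_equiv (Submodule.quotOfListConsSMulTopEquivQuotSMulTopInner N a rs)]
      at h2
    refine le_trans ?_ h1
    rw [List.length_cons, Nat.cast_add, ← add_assoc, Nat.cast_one]
    exact add_le_add_left h2 1

lemma le_radical_ofList_of_isWeaklyRegular {𝒜 : ℤ → AddSubgroup R} [GradedRing 𝒜] {rs : List R}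
    (hrs : ∀ a ∈ rs, PosHomog 𝒜 a) (hreg : IsWeaklyRegular R rs)
    (hdim : ringKrullDim R = (rs.length : WithBot ℕ∞)) (hne : maxHomIdeal 𝒜 ≠ ⊤) :
    maxHomIdeal 𝒜 ≤ (Ideal.ofList rs).radical := by
  have hdim0 : Module.supportDim R (R ⧸ (Ideal.ofList rs • ⊤ : Submodule R R)) ≤ 0 := by
    have h := supportDim_add_length_le rs R hreg
    rw [Module.supportDim_self_eq_ringKrullDim, hdim] at h
    generalize Module.supportDim R (R ⧸ (Ideal.ofList rs • ⊤ : Submodule R R)) = D at h ⊢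
    induction D with
    | bot => exact bot_le
    | coe D =>
      norm_cast at h ⊢
      induction D with
      | top => simp at h
      | coe D => norm_cast at h ⊢; omega
  have hsupp : ∀ p : PrimeSpectrum R, Ideal.ofList rs ≤ p.asIdeal →
      p ∈ Module.support R (R ⧸ (Ideal.ofList rs • ⊤ : Submodule R R)) := by
    intro p hp
    rw [Module.support_quotient]
    exact ⟨Module.mem_support_iff_of_finite.2 (by
      rw [Module.annihilator_eq_bot.2 inferInstance]; exact bot_le), hp⟩
  have hmax := isMaximal_maxHomIdeal hne
  rw [Ideal.radical_eq_sInf]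
  refine le_sInf ?_
  rintro p ⟨hp, hpp⟩
  set q := (p.homogeneousCore 𝒜).toIdeal
  have hqp : q ≤ p := Ideal.toIdeal_homogeneousCore_le 𝒜 p
  have hq : q.IsPrime := hpp.homogeneousCore
  have hxq : Ideal.ofList rs ≤ q := Ideal.span_le.2 fun a ha =>
    Ideal.mem_homogeneousCore_of_homogeneous_of_mem (hrs a ha).isHomogeneousElem
      (hp (Ideal.subset_span ha))
  have hqm : q ≤ maxHomIdeal 𝒜 :=
    le_maxHomIdeal_of_isHomogeneous hq.ne_top (p.homogeneousCore 𝒜).isHomogeneous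
  have := (Order.krullDim_nonpos_iff_forall_isMax.1 hdim0) ⟨⟨q, hq⟩, hsupp ⟨q, hq⟩ hxq⟩
  have hmq : maxHomIdeal 𝒜 ≤ q :=
    this (b := ⟨⟨maxHomIdeal 𝒜, hmax.isPrime⟩, hsupp ⟨_, hmax.isPrime⟩ (hxq.trans hqm)⟩) hqm
  exact hmq.trans hqp

lemma isWeaklyRegular_of_subsingleton (rs : List R) (N : Type) [AddCommGroup N] [Module R N]
    [Subsingleton N] : IsWeaklyRegular N rs := by
  induction rs generalizing N with
  | nil => simp
  | cons a rs ih =>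
    exact (isWeaklyRegular_cons_iff ..).2 ⟨Function.injective_of_subsingleton _, ih _⟩

lemma isWeaklyRegular_of_exact (rs : List R) {A B C : Type} [AddCommGroup A] [Module R A]
    [AddCommGroup B] [Module R B] [AddCommGroup C] [Module R C] (f : A →ₗ[R] B) (g : B →ₗ[R] C)
    (hf : Function.Injective f) (hfg : Function.Exact f g) (hg : Function.Surjective g)
    (hA : IsWeaklyRegular A rs) (hC : IsWeaklyRegular C rs) : IsWeaklyRegular B rs := by
  induction rs generalizing A B C with
  | nil => simp
  | cons a rs ih =>
    rw [isWeaklyRegular_cons_iff] at hA hC ⊢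
    have hBa : IsSMulRegular B a := by
      rw [isSMulRegular_iff_right_eq_zero_of_smul]
      intro b hb
      have h1 : g b = 0 := by
        apply hC.1
        simp [← map_smul, hb]
      obtain ⟨u, rfl⟩ := (hfg b).1 h1
      have h2 : u = 0 := by
        apply hA.1
        apply hf
        simp [hb]
      simp [h2]
    refine ⟨hBa, ih (QuotSMulTop.map a f) (QuotSMulTop.map a g) ?_
      (QuotSMulTop.map_exact a hfg hg) (QuotSMulTop.map_surjective a hg) hA.2 hC.2⟩
    rw [injective_iff_map_eq_zero]
    intro u hu
    obtain ⟨u, rfl⟩ := Submodule.mkQ_surjective _ u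
    obtain ⟨b, -, hb⟩ := (Submodule.mem_smul_pointwise_iff_exists _ a ⊤).1
      ((Submodule.Quotient.mk_eq_zero _).1 hu)
    have h1 : g b = 0 := by
      apply hC.1
      simp only [smul_zero]
      rw [← map_smul, hb]
      exact (hfg _).2 ⟨u, rfl⟩
    obtain ⟨v, rfl⟩ := (hfg b).1 h1
    rw [← map_smul] at hb
    rw [← hf hb]
    exact (Submodule.Quotient.mk_eq_zero _).2 (Submodule.smul_mem_pointwise_smul v a ⊤ trivial)

lemma isWeaklyRegular_quotSMulTop_pow {rs : List R} {a : R} (ha : IsSMulRegular N a)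
    (h : IsWeaklyRegular (QuotSMulTop a N) rs) (s : ℕ) :
    IsWeaklyRegular (QuotSMulTop (a ^ s) N) rs := by
  induction s with
  | zero =>
    have : Subsingleton (QuotSMulTop (a ^ 0) N) := by
      rw [pow_zero]
      exact Submodule.Quotient.subsingleton_iff.2 (by simp)
    exact isWeaklyRegular_of_subsingleton _ _
  | succ s ih =>
    have hmem : ∀ (b : R) (u : N), u ∈ b • (⊤ : Submodule R N) ↔ ∃ v, b • v = u := fun b u => by
      simp [Submodule.mem_smul_pointwise_iff_exists]
    refine isWeaklyRegular_of_exact rs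
      (Submodule.mapQ (a • (⊤ : Submodule R N)) (a ^ (s + 1) • ⊤) (LinearMap.lsmul R N (a ^ s)) ?_)
      (Submodule.factor (p := a ^ (s + 1) • (⊤ : Submodule R N)) (p' := a ^ s • ⊤) ?_) ?_ ?_ ?_ h ih
    · intro u hu
      obtain ⟨v, rfl⟩ := (hmem _ _).1 hu
      exact (hmem _ _).2 ⟨v, by simp [smul_smul, pow_succ, mul_comm]⟩
    · intro u hu
      obtain ⟨v, rfl⟩ := (hmem _ _).1 hu
      exact (hmem _ _).2 ⟨a • v, by simp [smul_smul, pow_succ]⟩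
    · rw [injective_iff_map_eq_zero]
      intro u hu
      obtain ⟨u, rfl⟩ := Submodule.mkQ_surjective _ u
      obtain ⟨v, hv⟩ := (hmem _ _).1 ((Submodule.Quotient.mk_eq_zero _).1 hu)
      refine (Submodule.Quotient.mk_eq_zero _).2 ((hmem _ _).2 ⟨v, ha.pow s ?_⟩)
      simpa [smul_smul, pow_succ] using hv
    · intro u
      obtain ⟨u, rfl⟩ := Submodule.mkQ_surjective _ u
      constructor
      · intro hu
        obtain ⟨v, hv⟩ := (hmem _ _).1 ((Submodule.Quotient.mk_eq_zero _).1 hu)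
        exact ⟨Submodule.mkQ _ v, congrArg (Submodule.mkQ _) hv⟩
      · rintro ⟨v, hv⟩
        obtain ⟨v, rfl⟩ := Submodule.mkQ_surjective _ v
        rw [← hv]
        exact (Submodule.Quotient.mk_eq_zero _).2 ((hmem _ _).2 ⟨v, rfl⟩)
    · exact Submodule.factor_surjective _

lemma isWeaklyRegular_map_pow (rs : List R) (N : Type) [AddCommGroup N] [Module R N]
    (h : IsWeaklyRegular N rs) (s : ℕ) : IsWeaklyRegular N (rs.map (· ^ s)) := by
  induction rs generalizing N with
  | nil => simp
  | cons a rs ih =>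
    rw [isWeaklyRegular_cons_iff] at h
    exact (isWeaklyRegular_cons_iff ..).2 ⟨h.1.pow s,
      ih _ (isWeaklyRegular_quotSMulTop_pow h.1 h.2 s)⟩

end RegularSequences

section ExtVanishing

open scoped Pointwise ZeroObject
open RingTheory.Sequence CategoryTheory.Limits

/-- The vanishing of `Ext^j(A, W)`. -/
def ExtZero (R : Type) [CommRing R] (A W : Type) [AddCommGroup A] [Module R A] [AddCommGroup W]
    [Module R W] (j : ℕ) : Prop :=
  ∀ α : Abelian.Ext.{0} (ModuleCat.of R A) (ModuleCat.of R W) j, α = 0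

variable {A B V Q W : Type} [AddCommGroup A] [Module R A] [AddCommGroup B] [Module R B]
  [AddCommGroup V] [Module R V] [AddCommGroup Q] [Module R Q] [AddCommGroup W] [Module R W]

lemma subsingleton_extModule_iff (j : ℕ) :
    Subsingleton (extModule R A W (j + 1)) ↔ ExtZero R A W (j + 1) := by
  let P := projectiveResolution (ModuleCat.of R A)
  let K := P.complex.linearYonedaObj R (ModuleCat.of R W)
  have h1 : Subsingleton (extModule R A W (j + 1)) ↔ Subsingleton (K.homology (j + 1)) :=
    (P.isoExt (j + 1) (ModuleCat.of R W)).toLinearEquiv.toEquiv.subsingleton_congr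
  have h2 : Subsingleton (K.homology (j + 1)) ↔ (K.sc' j (j + 1) (j + 2)).Exact := by
    rw [← K.exactAt_iff' j (j + 1) (j + 2) (by simp) (by simp), K.exactAt_iff_isZero_homology]
    exact ⟨fun _ => ModuleCat.isZero_of_subsingleton _, ModuleCat.subsingleton_of_isZero⟩
  rw [h1, h2, ShortComplex.moduleCat_exact_iff]
  constructor
  · intro h α
    obtain ⟨f, hf, rfl⟩ := P.extMk_surjective α (j + 2) rfl
    rw [P.extMk_eq_zero_iff f _ rfl hf j rfl]
    exact h f hf
  · intro h f hf
    exact (P.extMk_eq_zero_iff f _ rfl hf j rfl).1 (h _)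

/-- A short exact sequence of modules as a short complex. -/
abbrev sesOf (f : A →ₗ[R] V) (g : V →ₗ[R] Q) (hfg : Function.Exact f g) :
    ShortComplex (ModuleCat R) :=
  ShortComplex.mk (ModuleCat.ofHom f) (ModuleCat.ofHom g) (by
    ext u; exact hfg.apply_apply_eq_zero u)

lemma sesOf_shortExact {f : A →ₗ[R] V} {g : V →ₗ[R] Q} (hf : Function.Injective f)
    (hfg : Function.Exact f g) (hg : Function.Surjective g) : (sesOf f g hfg).ShortExact where
  exact := ModuleCat.shortComplex_exact _ hfg
  mono_f := (ModuleCat.mono_iff_injective _).2 hf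
  epi_g := (ModuleCat.epi_iff_surjective _).2 hg

lemma ExtZero.of_exact_middle {f : A →ₗ[R] V} {g : V →ₗ[R] Q} (hf : Function.Injective f)
    (hfg : Function.Exact f g) (hg : Function.Surjective g) {j : ℕ} (hA : ExtZero R A W j)
    (hQ : ExtZero R Q W j) : ExtZero R V W j := by
  intro α
  obtain ⟨β, rfl⟩ := Abelian.Ext.contravariant_sequence_exact₂ (sesOf_shortExact hf hfg hg)
    (ModuleCat.of R W) α (hA _)
  rw [hQ β, Abelian.Ext.comp_zero]

lemma exists_precomp_eq {f : A →ₗ[R] V} {g : V →ₗ[R] Q} (hf : Function.Injective f)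
    (hfg : Function.Exact f g) (hg : Function.Surjective g) {j : ℕ} (hQ : ExtZero R Q W (j + 1))
    (α : Abelian.Ext.{0} (ModuleCat.of R A) (ModuleCat.of R W) j) :
    ∃ β : Abelian.Ext.{0} (ModuleCat.of R V) (ModuleCat.of R W) j,
      (Abelian.Ext.mk₀ (ModuleCat.ofHom f)).comp β (zero_add j) = α := by
  have h : 1 + j = j + 1 := add_comm 1 j
  exact Abelian.Ext.contravariant_sequence_exact₁ (sesOf_shortExact hf hfg hg)
    (ModuleCat.of R W) α h (hQ _)

lemma ExtZero.of_exact_left {f : A →ₗ[R] V} {g : V →ₗ[R] Q} (hf : Function.Injective f)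
    (hfg : Function.Exact f g) (hg : Function.Surjective g) {j : ℕ} (hV : ExtZero R V W j)
    (hQ : ExtZero R Q W (j + 1)) : ExtZero R A W j := by
  intro α
  obtain ⟨β, rfl⟩ := exists_precomp_eq hf hfg hg hQ α
  rw [hV β, Abelian.Ext.comp_zero]

lemma ExtZero.of_exact_right {f : A →ₗ[R] V} {g : V →ₗ[R] Q} (hf : Function.Injective f)
    (hfg : Function.Exact f g) (hg : Function.Surjective g) {j : ℕ} (hA : ExtZero R A W j)
    (hV : ExtZero R V W (j + 1)) : ExtZero R Q W (j + 1) := by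
  intro α
  obtain ⟨β, rfl⟩ := Abelian.Ext.contravariant_sequence_exact₃ (sesOf_shortExact hf hfg hg)
    (ModuleCat.of R W) α (hV _) (n₀ := j) (add_comm 1 j)
  rw [hA β, Abelian.Ext.comp_zero]

lemma ExtZero.of_subsingleton [Subsingleton A] (j : ℕ) : ExtZero R A W j := by
  intro α
  have h : 𝟙 (ModuleCat.of R A) = 0 := by
    ext u
    exact Subsingleton.elim (α := A) _ _
  rw [← Abelian.Ext.mk₀_id_comp α, h, Abelian.Ext.mk₀_zero, Abelian.Ext.zero_comp]

lemma ExtZero.of_linearEquiv (φ : A ≃ₗ[R] B) {j : ℕ} (h : ExtZero R B W j) : ExtZero R A W j := by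
  intro α
  rw [← Abelian.Ext.mk₀_id_comp α, show 𝟙 (ModuleCat.of R A) =
    ModuleCat.ofHom φ.toLinearMap ≫ ModuleCat.ofHom φ.symm.toLinearMap by ext; simp,
    ← Abelian.Ext.mk₀_comp_mk₀_assoc, h (Abelian.Ext.comp _ _ _), Abelian.Ext.comp_zero]

lemma ExtZero.self_succ (j : ℕ) : ExtZero R R W (j + 1) := by
  have : Projective (ModuleCat.of R R) := (IsProjective.iff_projective R).1 inferInstance
  exact Abelian.Ext.eq_zero_of_projective

lemma ext_smul_eq_zero_left {a : R} (ha : ∀ u : A, a • u = 0) {j : ℕ}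
    (α : Abelian.Ext.{0} (ModuleCat.of R A) (ModuleCat.of R W) j) : a • α = 0 := by
  have h : a • 𝟙 (ModuleCat.of R A) = 0 := by
    ext u
    exact ha u
  rw [← Abelian.Ext.mk₀_id_comp α, ← Abelian.Ext.smul_comp, ← Abelian.Ext.mk₀_smul, h,
    Abelian.Ext.mk₀_zero, Abelian.Ext.zero_comp]

lemma ext_smul_eq_zero_right {a : R} (ha : ∀ u : W, a • u = 0) {j : ℕ}
    (α : Abelian.Ext.{0} (ModuleCat.of R A) (ModuleCat.of R W) j) : a • α = 0 := by
  have h : a • 𝟙 (ModuleCat.of R W) = 0 := by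
    ext u
    exact ha u
  rw [Abelian.Ext.smul_eq_comp_mk₀, h, Abelian.Ext.mk₀_zero, Abelian.Ext.comp_zero]

lemma shortExact_smul {a : R} (ha : IsSMulRegular W a) :
    (sesOf (LinearMap.lsmul R W a) (a • (⊤ : Submodule R W)).mkQ
      (LinearMap.exact_lsmul_mkQ_smul_top W a)).ShortExact :=
  sesOf_shortExact (f := LinearMap.lsmul R W a) ha (LinearMap.exact_lsmul_mkQ_smul_top W a) (Submodule.mkQ_surjective _)

lemma ext_comp_smul_eq_zero {a : R} (ha : ∀ u : A, a • u = 0) {j : ℕ}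
    (α : Abelian.Ext.{0} (ModuleCat.of R A) (ModuleCat.of R W) j) :
    α.comp (Abelian.Ext.mk₀ (ModuleCat.ofHom (LinearMap.lsmul R W a))) (add_zero j) = 0 :=
  (Abelian.Ext.smul_eq_comp_mk₀ α a).symm.trans (ext_smul_eq_zero_left ha α)

lemma ExtZero.of_isWeaklyRegular (rs : List R) (W : Type) [AddCommGroup W] [Module R W]
    (hW : IsWeaklyRegular W rs) (hA : ∀ a ∈ rs, ∀ u : A, a • u = 0) {j : ℕ}
    (hj : j < rs.length) : ExtZero R A W j := by
  induction rs generalizing W j with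
  | nil => simp at hj
  | cons a rs ih =>
    rw [isWeaklyRegular_cons_iff] at hW
    intro α
    have h0 := ext_comp_smul_eq_zero (hA a List.mem_cons_self) α
    cases j with
    | zero =>
      have : Mono (ModuleCat.ofHom (LinearMap.lsmul R W a)) :=
        (ModuleCat.mono_iff_injective _).2 hW.1
      exact Abelian.Ext.postcomp_mk₀_injective_of_mono _ _ (h0.trans (map_zero _).symm)
    | succ j =>
      obtain ⟨β, rfl⟩ := Abelian.Ext.covariant_sequence_exact₁ _ (shortExact_smul hW.1) α h0 rfl
      rw [ih _ hW.2 (fun b hb => hA b (List.mem_cons_of_mem _ hb)) (by simpa using hj) β,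
        Abelian.Ext.zero_comp]

/-- Every class in `Ext^j(A, W)` extends along `f : A → V`. -/
def ExtExtends (f : A →ₗ[R] V) (W : Type) [AddCommGroup W] [Module R W] (j : ℕ) : Prop :=
  ∀ α : Abelian.Ext.{0} (ModuleCat.of R A) (ModuleCat.of R W) j,
    ∃ β : Abelian.Ext.{0} (ModuleCat.of R V) (ModuleCat.of R W) j,
      (Abelian.Ext.mk₀ (ModuleCat.ofHom f)).comp β (zero_add _) = α

lemma ExtExtends.of_linearEquiv {f : A →ₗ[R] V} {W W' : Type} [AddCommGroup W] [Module R W]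
    [AddCommGroup W'] [Module R W'] (φ : W' ≃ₗ[R] W) {j : ℕ} (h : ExtExtends f W j) :
    ExtExtends f W' j := by
  intro α
  obtain ⟨β, hβ⟩ := h (α.comp (Abelian.Ext.mk₀ (ModuleCat.ofHom φ.toLinearMap)) (add_zero j))
  refine ⟨β.comp (Abelian.Ext.mk₀ (ModuleCat.ofHom φ.symm.toLinearMap)) (add_zero j), ?_⟩
  rw [← Abelian.Ext.comp_assoc_of_third_deg_zero, hβ, Abelian.Ext.comp_assoc_of_third_deg_zero,
    Abelian.Ext.mk₀_comp_mk₀, show ModuleCat.ofHom φ.toLinearMap ≫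
      ModuleCat.ofHom φ.symm.toLinearMap = 𝟙 (ModuleCat.of R W') by ext; simp,
    Abelian.Ext.comp_mk₀_id]

lemma ExtExtends.quotSMulTop {f : A →ₗ[R] V} {a : R} (ha : IsSMulRegular W a)
    (hV : ∀ u : V, a • u = 0) {j : ℕ} (hA : ExtZero R A W j) (h : ExtExtends f W (j + 1)) :
    ExtExtends f (QuotSMulTop a W) j := by
  intro α
  obtain ⟨β, hβ⟩ := h (α.comp (shortExact_smul ha).extClass rfl)
  obtain ⟨α', hα'⟩ := Abelian.Ext.covariant_sequence_exact₁ _ (shortExact_smul ha) β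
    (ext_comp_smul_eq_zero hV β) rfl
  have h0 : ((Abelian.Ext.mk₀ (ModuleCat.ofHom f)).comp α' (zero_add _) - α).comp
      (shortExact_smul ha).extClass rfl = 0 := by
    rw [sub_eq_add_neg, Abelian.Ext.add_comp, Abelian.Ext.neg_comp, ← hβ, ← hα',
      Abelian.Ext.comp_assoc _ _ _ _ _ (by omega), add_neg_cancel]
    rfl
  obtain ⟨γ, hγ⟩ := Abelian.Ext.covariant_sequence_exact₃ _ (shortExact_smul ha) _ rfl h0
  refine ⟨α', sub_eq_zero.1 ?_⟩
  rw [← hγ, hA γ, Abelian.Ext.zero_comp]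

lemma ExtExtends.of_isWeaklyRegular (rs : List R) (W : Type) [AddCommGroup W] [Module R W]
    (hW : IsWeaklyRegular W rs) {f : A →ₗ[R] V} (hf : Function.Injective f)
    (hV : ∀ a ∈ rs, ∀ u : V, a • u = 0) (h : ExtExtends f W rs.length) :
    ExtExtends f (W ⧸ (Ideal.ofList rs • ⊤ : Submodule R W)) 0 := by
  induction rs generalizing W with
  | nil =>
    refine .of_linearEquiv (Submodule.quotEquivOfEqBot _ ?_) h
    simp
  | cons a rs ih =>
    have hA : ∀ b ∈ a :: rs, ∀ u : A, b • u = 0 := fun b hb u =>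
      hf (by rw [map_smul, hV b hb, map_zero])
    have hZ := ExtZero.of_isWeaklyRegular (A := A) _ W hW hA (Nat.lt_succ_self rs.length)
    rw [isWeaklyRegular_cons_iff] at hW
    exact .of_linearEquiv (Submodule.quotOfListConsSMulTopEquivQuotSMulTopInner W a rs)
      (ih _ hW.2 (fun b hb => hV b (List.mem_cons_of_mem _ hb))
        (h.quotSMulTop hW.1 (hV a List.mem_cons_self) hZ))

lemma ExtExtends.exists_linearMap {f : A →ₗ[R] V} (h : ExtExtends f W 0) (l : A →ₗ[R] W) :
    ∃ l' : V →ₗ[R] W, l' ∘ₗ f = l := by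
  obtain ⟨β, hβ⟩ := h (Abelian.Ext.mk₀ (ModuleCat.ofHom l))
  obtain ⟨g, rfl⟩ := Abelian.Ext.addEquiv₀.symm.surjective β
  refine ⟨g.hom, ?_⟩
  rw [Abelian.Ext.addEquiv₀_symm_apply, Abelian.Ext.mk₀_comp_mk₀] at hβ
  have := (Abelian.Ext.mk₀_bijective _ _).1 hβ
  exact congrArg ModuleCat.Hom.hom this

end ExtVanishing

section Cogenerator

open scoped Pointwise
open RingTheory.Sequence

/-- Every element of `N` is killed by powers of the elements of `I`. -/
def PowTorsion (I : Ideal R) (N : Type) [AddCommGroup N] [Module R N] : Prop :=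
  ∀ a ∈ I, ∀ u : N, ∃ m : ℕ, a ^ m • u = 0

lemma PowTorsion.of_injective {I : Ideal R} {A B : Type} [AddCommGroup A] [Module R A]
    [AddCommGroup B] [Module R B] (f : A →ₗ[R] B) (hf : Function.Injective f)
    (h : PowTorsion I B) : PowTorsion I A := fun a ha u => by
  obtain ⟨m, hm⟩ := h a ha (f u)
  exact ⟨m, hf (by rw [map_smul, hm, map_zero])⟩

lemma PowTorsion.of_surjective {I : Ideal R} {A B : Type} [AddCommGroup A] [Module R A]
    [AddCommGroup B] [Module R B] (f : A →ₗ[R] B) (hf : Function.Surjective f)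
    (h : PowTorsion I A) : PowTorsion I B := fun a ha u => by
  obtain ⟨u, rfl⟩ := hf u
  obtain ⟨m, hm⟩ := h a ha u
  exact ⟨m, by rw [← map_smul, hm, map_zero]⟩

lemma PowTorsion.of_le_radical {I J : Ideal R} {N : Type} [AddCommGroup N] [Module R N]
    (hIJ : I ≤ J.radical) (h : ∀ a ∈ J, ∀ u : N, a • u = 0) : PowTorsion I N := fun a ha u => by
  obtain ⟨m, hm⟩ := hIJ ha
  exact ⟨m, h _ hm u⟩

lemma PowTorsion.quotient_smul_top {I J : Ideal R} (hIJ : I ≤ J.radical) (N : Type)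
    [AddCommGroup N] [Module R N] : PowTorsion I (N ⧸ (J • ⊤ : Submodule R N)) :=
  .of_le_radical hIJ fun a ha u => by
    obtain ⟨u, rfl⟩ := Submodule.mkQ_surjective _ u
    exact (Submodule.Quotient.mk_eq_zero _).2 (Submodule.smul_mem_smul ha trivial)

lemma PowTorsion.le_of_quotient {I p : Ideal R} [hp : p.IsPrime] (h : PowTorsion I (R ⧸ p)) :
    I ≤ p := fun a ha => by
  obtain ⟨m, hm⟩ := h a ha (Ideal.Quotient.mk p 1)
  refine hp.mem_of_pow_mem m (Ideal.Quotient.eq_zero_iff_mem.1 ?_)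
  rw [← hm, Algebra.smul_def, map_one, mul_one]
  rfl

lemma PowTorsion.exists_injective [IsNoetherianRing R] {I : Ideal R} [hI : I.IsMaximal] {N : Type}
    [AddCommGroup N] [Module R N] [Nontrivial N] (h : PowTorsion I N) :
    ∃ f : (R ⧸ I) →ₗ[R] N, Function.Injective f := by
  obtain ⟨u, hu⟩ := exists_ne (0 : N)
  obtain ⟨p, hp, -⟩ := exists_le_isAssociatedPrime_of_isNoetherianRing R u hu
  obtain ⟨hpp, w, rfl⟩ := (isAssociatedPrime_iff).1 hp
  have hker : (Submodule.colon (⊥ : Submodule R N) {w}) = LinearMap.ker (LinearMap.toSpanSingleton R N w) := by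
    ext a
    simp [Submodule.mem_colon_singleton]
  have hle : I ≤ Submodule.colon (⊥ : Submodule R N) {w} := fun a ha => by
    obtain ⟨m, hm⟩ := h a ha w
    exact hpp.mem_of_pow_mem m (by simpa [Submodule.mem_colon_singleton] using hm)
  have heq := hI.eq_of_le hpp.ne_top hle
  rw [hker] at heq
  refine ⟨Submodule.liftQ I (LinearMap.toSpanSingleton R N w) heq.le, ?_⟩
  rw [← LinearMap.ker_eq_bot]
  exact Submodule.ker_liftQ_eq_bot _ _ _ heq.ge

lemma ExtZero.quotient_ofList {W : Type} [AddCommGroup W] [Module R W] (rs : List R) (N : Type)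
    [AddCommGroup N] [Module R N] (hN : IsWeaklyRegular N rs) {m : ℕ}
    (h : ∀ j, m < j → ExtZero R N W j) {j : ℕ} (hj : m + rs.length < j) :
    ExtZero R (N ⧸ (Ideal.ofList rs • ⊤ : Submodule R N)) W j := by
  induction rs generalizing N m with
  | nil => exact .of_linearEquiv (Submodule.quotEquivOfEqBot _ (by simp)) (h j hj)
  | cons a rs ih =>
    rw [isWeaklyRegular_cons_iff] at hN
    refine .of_linearEquiv (Submodule.quotOfListConsSMulTopEquivQuotSMulTopInner N a rs)
      (ih _ hN.2 (m := m + 1) ?_ (by simp at hj; omega))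
    intro j hj
    obtain ⟨j, rfl⟩ := Nat.exists_eq_succ_of_ne_zero (by omega : j ≠ 0)
    exact .of_exact_right (f := LinearMap.lsmul R N a) hN.1
      (LinearMap.exact_lsmul_mkQ_smul_top N a) (Submodule.mkQ_surjective _) (h j (by omega))
      (h (j + 1) (by omega))

lemma ExtZero.of_powTorsion [IsNoetherianRing R] {I : Ideal R} [hI : I.IsMaximal] {W : Type}
    [AddCommGroup W] [Module R W] (hW : injDimFinite R W) {rs : List R} (hrs : IsWeaklyRegular R rs)
    (hle : Ideal.ofList rs ≤ I) (hrad : I ≤ (Ideal.ofList rs).radical) (N : Type)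
    [AddCommGroup N] [Module R N] [hN : Module.Finite R N] (hNt : PowTorsion I N) {j : ℕ}
    (hj : rs.length < j) : ExtZero R N W j := by
  obtain ⟨nb, hnb⟩ := hW
  suffices H : ∀ (k j : ℕ), rs.length < j → nb < j + k → ∀ (N : Type) [AddCommGroup N] [Module R N]
      [Module.Finite R N], PowTorsion I N → ExtZero R N W j from
    H (nb + 1) j hj (by omega) N hNt
  intro k
  induction k with
  | zero =>
    intro j hj hjn N _ _ _ _
    obtain ⟨j, rfl⟩ := Nat.exists_eq_succ_of_ne_zero (by omega : j ≠ 0)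
    exact (subsingleton_extModule_iff j).1 (hnb N _ hjn)
  | succ k ih =>
    intro j hj hjn N _ _ hN hNt
    have hfield : ExtZero R (R ⧸ I) W j := by
      have htor := PowTorsion.quotient_smul_top hrad R
      have hnt : Nontrivial (R ⧸ (Ideal.ofList rs • ⊤ : Submodule R R)) := by
        refine Submodule.Quotient.nontrivial_iff.2 fun h => hI.ne_top (top_le_iff.1 ?_)
        rw [← h, smul_eq_mul, Ideal.mul_top]
        exact hle
      obtain ⟨f, hf⟩ := htor.exists_injective
      refine .of_exact_left hf (LinearMap.exact_map_mkQ_range f) (Submodule.mkQ_surjective _)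
        (.quotient_ofList rs R hrs (m := 0) ?_ (by omega)) (ih (j + 1) (by omega) (by omega) _
          (.of_surjective _ (Submodule.mkQ_surjective _) htor))
      intro j hj
      obtain ⟨j, rfl⟩ := Nat.exists_eq_succ_of_ne_zero (by omega : j ≠ 0)
      exact .self_succ j
    induction hN using IsNoetherianRing.induction_on_isQuotientEquivQuotientPrime R with
    | subsingleton N => exact .of_subsingleton j
    | quotient N p φ =>
      have := hI.eq_of_le p.2.ne_top
        (PowTorsion.of_injective φ.symm.toLinearMap φ.symm.injective hNt).le_of_quotient
      rw [← this] at φ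
      exact .of_linearEquiv φ hfield
    | exact A V Q f g hf hg hfg hA hQ =>
      exact .of_exact_middle hf hfg hg (hA (.of_injective f hf hNt)) (hQ (.of_surjective g hg hNt))

lemma nontrivial_quotient_ofList {I : Ideal R} (hI : I ≠ ⊤) {W : Type} [AddCommGroup W]
    [Module R W] [Module.Finite R W] {m : ℕ}
    (hW : Nonempty ((extModule R (R ⧸ I) W (m + 1)) ≃ₗ[R] (R ⧸ I))) {J : Ideal R} (hJ : J ≤ I) :
    Nontrivial (W ⧸ (J • ⊤ : Submodule R W)) := by
  refine Submodule.Quotient.nontrivial_iff.2 fun h => ?_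
  obtain ⟨b, hb, hbW⟩ := Submodule.exists_sub_one_mem_and_smul_eq_zero_of_fg_of_le_smul J
    (⊤ : Submodule R W) Module.Finite.fg_top h.ge
  have hz : ExtZero R (R ⧸ I) W (m + 1) := by
    intro α
    have h1 : b • α = 0 := ext_smul_eq_zero_right (fun u => hbW u trivial) α
    have h2 : (b - 1) • α = 0 := ext_smul_eq_zero_left (fun u => by
      obtain ⟨u, rfl⟩ := Submodule.mkQ_surjective _ u
      exact (Submodule.Quotient.mk_eq_zero _).2 (I.mul_mem_right u (hJ hb))) α
    rwa [sub_smul, h1, one_smul, zero_sub, neg_eq_zero] at h2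
  have := (subsingleton_extModule_iff m).2 hz
  obtain ⟨φ⟩ := hW
  have := φ.symm.toEquiv.subsingleton
  exact hI (Ideal.Quotient.subsingleton_iff.1 this)

lemma exists_linearMap_apply_ne_zero [IsNoetherianRing R] {I : Ideal R} [hI : I.IsMaximal]
    {W : Type} [AddCommGroup W] [Module R W] [Module.Finite R W] {m : ℕ}
    (hW : Nonempty ((extModule R (R ⧸ I) W (m + 1)) ≃ₗ[R] (R ⧸ I))) (hWi : injDimFinite R W)
    {rs : List R} (hrs : IsWeaklyRegular R rs)
    (hrsW : IsWeaklyRegular W rs)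
    (hle : Ideal.ofList rs ≤ I) (hrad : I ≤ (Ideal.ofList rs).radical) {V : Type}
    [AddCommGroup V] [Module R V] [Module.Finite R V] (hV : ∀ a ∈ Ideal.ofList rs, ∀ u : V, a • u = 0)
    {v : V} (hv : v ≠ 0) :
    ∃ l : V →ₗ[R] W ⧸ (Ideal.ofList rs • ⊤ : Submodule R W), l v ≠ 0 := by
  have hVt : PowTorsion I V := .of_le_radical hrad hV
  let K := LinearMap.ker (LinearMap.toSpanSingleton R V v)
  let f : (R ⧸ K) →ₗ[R] V := Submodule.liftQ K (LinearMap.toSpanSingleton R V v) le_rfl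
  have hf : Function.Injective f := by
    rw [← LinearMap.ker_eq_bot]
    exact Submodule.ker_liftQ_eq_bot _ _ _ le_rfl
  have hext : ExtExtends f W rs.length := exists_precomp_eq hf (LinearMap.exact_map_mkQ_range f)
    (Submodule.mkQ_surjective _) (.of_powTorsion hWi hrs hle hrad _
      (.of_surjective _ (Submodule.mkQ_surjective _) hVt) (Nat.lt_succ_self _))
  have hext0 := ExtExtends.of_isWeaklyRegular rs W hrsW hf
    (fun a ha => hV a (Ideal.subset_span ha)) hext
  have hnt := nontrivial_quotient_ofList hI.ne_top hW hle
  obtain ⟨g, hg⟩ := (PowTorsion.quotient_smul_top hrad W).exists_injective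
  have hKI : K ≤ I := by
    obtain ⟨p, hp, hKp⟩ := Ideal.exists_le_maximal K (by
      intro h
      apply hv
      have : (1 : R) ∈ K := h ▸ trivial
      simpa [K] using this)
    have : I ≤ p := fun a ha => by
      obtain ⟨k, hk⟩ := hVt a ha v
      exact hp.isPrime.mem_of_pow_mem k (hKp (by simpa [K] using hk))
    rw [hI.eq_of_le hp.ne_top this]
    exact hKp
  obtain ⟨l, hl⟩ := hext0.exists_linearMap (g ∘ₗ Submodule.mapQ K I LinearMap.id hKI)
  refine ⟨l, fun h => hI.ne_top ((Ideal.eq_top_iff_one I).2 ?_)⟩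
  have h1 : f (Submodule.Quotient.mk 1) = v :=
    (Submodule.liftQ_apply _ _ _).trans (one_smul R v)
  rw [← h1, ← LinearMap.comp_apply, hl] at h
  have h2 := hg (h.trans (map_zero g).symm)
  exact (Submodule.Quotient.mk_eq_zero I).1 h2

end Cogenerator

section Separation

lemma mem_smul_top_map {N N' : Type*} [AddCommGroup N] [Module R N] [AddCommGroup N'] [Module R N']
    {I : Ideal R} (φ : N →ₗ[R] N') {u : N} (hu : u ∈ I • (⊤ : Submodule R N)) :
    φ u ∈ I • (⊤ : Submodule R N') := by
  have h : φ u ∈ (I • (⊤ : Submodule R N)).map φ := Submodule.mem_map_of_mem hu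
  rw [Submodule.map_smul''] at h
  exact Submodule.smul_mono le_rfl le_top h

lemma mem_smul_top_pi_iff {ι : Type*} [Fintype ι] [DecidableEq ι] {N : Type*} [AddCommGroup N]
    [Module R N] {I : Ideal R} {u : ι → N} :
    u ∈ I • (⊤ : Submodule R (ι → N)) ↔ ∀ k, u k ∈ I • (⊤ : Submodule R N) := by
  refine ⟨fun h k => mem_smul_top_map (LinearMap.proj k) h, fun h => ?_⟩
  rw [show u = ∑ k, LinearMap.single R (fun _ => N) k (u k) from
    (LinearMap.sum_single_apply _ u).symm]
  exact Submodule.sum_mem _ fun k _ => mem_smul_top_map _ (h k)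

/-- Artin–Rees lifting: homomorphisms to `W / J' W` lift modulo `J` when `J'` is deep enough. -/
lemma exists_linearMap_sub_mem_smul_top [IsNoetherianRing R] {V W : Type} [AddCommGroup V]
    [Module R V] [Module.Finite R V] [AddCommGroup W] [Module R W] [Module.Finite R W]
    (J : Ideal R) :
    ∃ N : ℕ, ∀ J' ≤ J ^ N, ∀ l' : V →ₗ[R] W ⧸ (J' • (⊤ : Submodule R W)),
      ∃ l : V →ₗ[R] W, ∀ v w, Submodule.Quotient.mk w = l' v →
        w - l v ∈ J • (⊤ : Submodule R W) := by
  obtain ⟨m, f, hf⟩ := Module.Finite.exists_fin' R V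
  obtain ⟨q, g', hg'⟩ := Module.Finite.exists_fin' R (LinearMap.ker f)
  let g : (Fin q → R) →ₗ[R] (Fin m → R) := (LinearMap.ker f).subtype.comp g'
  have hg : LinearMap.range g = LinearMap.ker f := by
    rw [LinearMap.range_comp, LinearMap.range_eq_top.2 hg', Submodule.map_top,
      Submodule.range_subtype]
  let Φ : (Fin m → W) →ₗ[R] (Fin q → W) :=
    LinearMap.pi fun k => ∑ l, g (Pi.single k 1) l • LinearMap.proj l
  have hΦ : ∀ w k, Φ w k = ∑ l, g (Pi.single k 1) l • w l := fun w k => by simp [Φ]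
  obtain ⟨n₀, hn₀⟩ := Ideal.exists_pow_inf_eq_pow_smul J (LinearMap.range Φ)
  refine ⟨n₀ + 1, fun J' hJ' l' => ?_⟩
  choose w hw using fun l => Submodule.Quotient.mk_surjective _ (l' (f (Pi.single l 1)))
  have hsum : ∀ c : Fin m → R,
      (Submodule.Quotient.mk (∑ l, c l • w l) : W ⧸ (J' • (⊤ : Submodule R W))) = l' (f c) := by
    intro c
    conv_rhs => rw [pi_eq_sum_univ' c]
    rw [← Submodule.mkQ_apply, map_sum, map_sum, map_sum]
    refine Finset.sum_congr rfl fun l _ => ?_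
    rw [map_smul, map_smul, map_smul, Submodule.mkQ_apply, hw]
  have hmem : Φ w ∈ J • LinearMap.range Φ := by
    have h1 : Φ w ∈ J ^ (n₀ + 1) • (⊤ : Submodule R (Fin q → W)) ⊓ LinearMap.range Φ := by
      refine ⟨?_, LinearMap.mem_range_self _ _⟩
      rw [SetLike.mem_coe, mem_smul_top_pi_iff]
      intro k
      refine Submodule.smul_mono_left hJ' ?_
      rw [hΦ, ← Submodule.Quotient.mk_eq_zero, hsum]
      have : g (Pi.single k 1) ∈ LinearMap.ker f := hg ▸ LinearMap.mem_range_self _ _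
      rw [LinearMap.mem_ker.1 this, map_zero]
    rw [hn₀ (n₀ + 1) (Nat.le_succ _), Nat.add_sub_cancel_left, pow_one] at h1
    exact Submodule.smul_mono le_rfl inf_le_right h1
  rw [← Submodule.map_top Φ, ← Submodule.map_smul''] at hmem
  obtain ⟨w', hw', hww'⟩ := hmem
  let lf : (Fin m → R) →ₗ[R] W := Fintype.linearCombination R (w - w')
  have hlf : ∀ c, lf c = ∑ l, c l • w l - ∑ l, c l • w' l := fun c => by
    simp [lf, Fintype.linearCombination_apply, smul_sub, Finset.sum_sub_distrib]
  have hker : LinearMap.ker f ≤ LinearMap.ker lf := by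
    rw [← hg, LinearMap.range_le_ker_iff]
    refine LinearMap.pi_ext' fun k => LinearMap.ext_ring ?_
    have := congr_fun hww' k
    rw [hΦ, hΦ] at this
    simp [hlf, this]
  let l : V →ₗ[R] W := ((LinearMap.ker f).liftQ lf hker).comp
    (f.quotKerEquivOfSurjective hf).symm.toLinearMap
  have hl : ∀ c, l (f c) = lf c := fun c => by
    have : (f.quotKerEquivOfSurjective hf).symm (f c) = Submodule.Quotient.mk c := by
      rw [LinearEquiv.symm_apply_eq]; rfl
    simp only [l, LinearMap.comp_apply, LinearEquiv.coe_coe, this]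
    rfl
  refine ⟨l, fun v u hu => ?_⟩
  obtain ⟨c, rfl⟩ := hf v
  rw [hl, hlf]
  rw [← hsum, Submodule.Quotient.eq] at hu
  have h1 : ∑ l, c l • w' l ∈ J • (⊤ : Submodule R W) :=
    Submodule.sum_mem _ fun l _ => Submodule.smul_mem _ _ (mem_smul_top_pi_iff.1 hw' l)
  have h2 := Submodule.smul_mono_left (N := (⊤ : Submodule R W)) (hJ'.trans (Ideal.pow_le_self n₀.succ_ne_zero)) hu
  rw [← sub_add]
  exact Submodule.add_mem _ h2 h1

/-- The ideal generated by the `s`-th powers of `x`. -/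
def pspan {d : ℕ} (x : Fin d → R) (s : ℕ) : Ideal R := Ideal.span (Set.range (x ^ s))

lemma pow_mem_pspan {d : ℕ} (x : Fin d → R) (s : ℕ) (j : Fin d) : x j ^ s ∈ pspan x s :=
  Ideal.subset_span ⟨j, rfl⟩

lemma pspan_mul_le {d : ℕ} (x : Fin d → R) (s N : ℕ) : pspan x (s * N) ≤ pspan x s ^ N := by
  rw [pspan, Ideal.span_le]
  rintro _ ⟨j, rfl⟩
  rw [Pi.pow_apply, pow_mul]
  exact Ideal.pow_mem_pow (pow_mem_pspan x s j) N

lemma prod_pow_mul_mem_pspan {d : ℕ} (x : Fin d → R) (s r : ℕ) {a : R} (ha : a ∈ pspan x s) :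
    (∏ j, x j) ^ r * a ∈ pspan x (s + r) := by
  have : pspan x s ≤ Submodule.comap (LinearMap.mulLeft R ((∏ j, x j) ^ r)) (pspan x (s + r)) := by
    rw [pspan, Ideal.span_le]
    rintro _ ⟨j, rfl⟩
    rw [SetLike.mem_coe, Submodule.mem_comap, LinearMap.mulLeft_apply, Pi.pow_apply,
      ← Finset.prod_erase_mul _ _ (Finset.mem_univ j), mul_pow, mul_assoc, ← pow_add, add_comm r]
    exact Ideal.mul_mem_left _ _ (pow_mem_pspan x _ j)
  exact this ha

lemma prod_pow_smul_mem_pspan_smul {d : ℕ} (x : Fin d → R) (s r : ℕ) {N : Type*} [AddCommGroup N]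
    [Module R N] {u : N} (hu : u ∈ pspan x s • (⊤ : Submodule R N)) :
    (∏ j, x j) ^ r • u ∈ pspan x (s + r) • (⊤ : Submodule R N) := by
  induction hu using Submodule.smul_induction_on' with
  | smul a ha v hv =>
    rw [smul_smul]
    exact Submodule.smul_mem_smul (prod_pow_mul_mem_pspan x s r ha) trivial
  | add u hu v hv h1 h2 => rw [smul_add]; exact Submodule.add_mem _ h1 h2

/-- `W / (x ^ s) W` cogenerates the finite modules killed by `(x ^ s)`, for all `s`. -/
def PowCogen {d : ℕ} (x : Fin d → R) (W : Type) [AddCommGroup W] [Module R W] : Prop :=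
  ∀ (s : ℕ) (V : Type) [AddCommGroup V] [Module R V], Module.Finite R V →
    (∀ a ∈ pspan x s, ∀ u : V, a • u = 0) → ∀ v : V, v ≠ 0 →
      ∃ l : V →ₗ[R] W ⧸ (pspan x s • (⊤ : Submodule R W)), l v ≠ 0

lemma PowCogen.exists_smul_mem [IsNoetherianRing R] {d : ℕ} {x : Fin d → R} {V W : Type}
    [AddCommGroup W] [Module R W] [Module.Finite R W] (hW : PowCogen x W)
    [AddCommGroup V] [Module R V] [Module.Finite R V] (s : ℕ) {v : V}
    (hv : ∀ l : V →ₗ[R] W, l v ∈ pspan x s • (⊤ : Submodule R W)) :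
    ∃ r : ℕ, (∏ j, x j) ^ r • v ∈ pspan x (s + r) • (⊤ : Submodule R V) := by
  obtain ⟨N, hN⟩ := exists_linearMap_sub_mem_smul_top (V := V) (W := W) (pspan x s)
  refine ⟨s * N, ?_⟩
  set r := s * N with hr
  by_contra hcon
  rw [← Submodule.Quotient.mk_eq_zero] at hcon
  obtain ⟨l, hl⟩ := hW (s + r) (V ⧸ (pspan x (s + r) • (⊤ : Submodule R V))) inferInstance
    (fun a ha u => by
      induction u using Submodule.Quotient.induction_on with
      | H u =>
        rw [← Submodule.Quotient.mk_smul, Submodule.Quotient.mk_eq_zero]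
        exact Submodule.smul_mem_smul ha trivial) _ hcon
  have hle : pspan x (s + r) ≤ pspan x s ^ N := by
    refine le_trans ?_ (pspan_mul_le x s N)
    rw [pspan, Ideal.span_le]
    rintro _ ⟨j, rfl⟩
    rw [Pi.pow_apply, pow_add]
    exact Ideal.mul_mem_left _ _ (pow_mem_pspan x _ j)
  obtain ⟨l₀, hl₀⟩ := hN _ hle (l.comp (Submodule.mkQ _))
  obtain ⟨w, hw⟩ := Submodule.Quotient.mk_surjective _ (l (Submodule.Quotient.mk v))
  apply hl
  rw [Submodule.Quotient.mk_smul, map_smul, ← hw, ← Submodule.Quotient.mk_smul,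
    Submodule.Quotient.mk_eq_zero]
  apply prod_pow_smul_mem_pspan_smul
  have := Submodule.add_mem _ (hl₀ v w hw) (hv l₀)
  rwa [sub_add_cancel] at this

end Separation

section DualLifting

lemma sum_kos_apply {n : ℕ} (x : Fin n → R) {A B : Type*} [AddCommGroup A] [Module R A]
    [AddCommGroup B] [Module R B] (μ : Finset (Fin n) → A →ₗ[R] B) (z : Finset (Fin n) → A) :
    ∑ S, kos x μ S (z S) = ∑ T, μ T (kosb x z T) := by
  simp only [kos_apply, kosb_apply, LinearMap.sum_apply, map_sum, LinearMap.smul_apply,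
    map_zsmul, map_smul]
  rw [Finset.sum_sigma', Finset.sum_sigma']
  refine Finset.sum_bij' (fun p _ => ⟨p.1.erase p.2, p.2⟩) (fun p _ => ⟨insert p.2 p.1, p.2⟩)
    ?_ ?_ ?_ ?_ ?_
  · rintro ⟨S, j⟩ h; simp
  · rintro ⟨S, j⟩ h; simp
  · rintro ⟨S, j⟩ h
    simp only [Finset.mem_sigma, Finset.mem_univ, true_and] at h
    simp [Finset.insert_erase h]
  · rintro ⟨S, j⟩ h
    simp only [Finset.mem_sigma, Finset.mem_univ, true_and, Finset.mem_compl] at h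
    simp [Finset.erase_insert h]
  · rintro ⟨S, j⟩ h
    simp only [Finset.mem_sigma, Finset.mem_univ, true_and] at h
    simp only [Finset.insert_erase h, ksgn_erase_self]

/-- Restriction of a Koszul chain to its component of homological degree `k`. -/
def krestr {n : ℕ} (k : ℕ) {A : Type*} [AddCommGroup A] [Module R A] :
    (Finset (Fin n) → A) →ₗ[R] (Finset (Fin n) → A) where
  toFun f S := if S.card = k then f S else 0
  map_add' f g := by ext S; by_cases h : S.card = k <;> simp [h]
  map_smul' r f := by ext S; by_cases h : S.card = k <;> simp [h]

lemma krestr_apply {n : ℕ} (k : ℕ) {A : Type*} [AddCommGroup A] [Module R A]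
    (f : Finset (Fin n) → A) (S : Finset (Fin n)) :
    krestr (R := R) k f S = if S.card = k then f S else 0 := rfl

/-- A Koszul chain whose differential vanishes modulo `(x ^ s)` is, in the limit, a boundary
modulo `(x ^ s)`, provided the Koszul cohomology of the dual vanishes. -/
lemma PowCogen.exists_kosb [IsNoetherianRing R] {d n : ℕ} {x : Fin d → R} {A W : Type}
    [AddCommGroup W] [Module R W] [Module.Finite R W] (hW : PowCogen x W)
    [AddCommGroup A] [Module R A] [Module.Finite R A] {y : Fin n → R} {k : ℕ}
    (hlim : KLim ⊥ y k (A →ₗ[R] W)) (s : ℕ) (z : Finset (Fin n) → A)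
    (hz : ∀ T, T.card + 1 = k → kosb y z T ∈ pspan x s • (⊤ : Submodule R A)) :
    ∃ (r : ℕ) (w : Finset (Fin n) → A), ∀ S, S.card = k →
      (∏ j, x j) ^ r • z S - kosb y w S ∈ pspan x (s + r) • (⊤ : Submodule R A) := by
  let D : (Finset (Fin n) → A) →ₗ[R] (Finset (Fin n) → A) := (krestr k).comp (kosb y)
  have key : ∀ l : ((Finset (Fin n) → A) ⧸ LinearMap.range D) →ₗ[R] W,
      l (Submodule.Quotient.mk (krestr (R := R) k z)) ∈ pspan x s • (⊤ : Submodule R W) := by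
    intro l
    let φ : Finset (Fin n) → A →ₗ[R] W := fun S =>
      (l.comp (Submodule.mkQ _)).comp (LinearMap.single R (fun _ => A) S)
    have hφ : ∀ f, l (Submodule.Quotient.mk f) = ∑ S, φ S (f S) := fun f => by
      conv_lhs => rw [← LinearMap.sum_single_apply (fun _ => A) f]
      rw [← Submodule.mkQ_apply, map_sum, map_sum]
      rfl
    have hpair : ∀ f : Finset (Fin n) → A, l (Submodule.Quotient.mk (krestr (R := R) k f)) =
        ∑ S, (krestr (R := R) k φ) S (f S) := fun f => by
      rw [hφ]
      refine Finset.sum_congr rfl fun S _ => ?_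
      simp only [krestr_apply]
      split_ifs <;> simp
    have hcyc : KCyc (y ^ 1) k φ := by
      intro S hS
      ext a
      have h1 : kos y φ S = kos y (krestr (R := R) k φ) S :=
        kos_congr _ fun T hT => by rw [krestr_apply, if_pos (by omega)]
      rw [pow_one, h1]
      have h2 := hpair (kosb y (LinearMap.single R (fun _ => A) S a))
      rw [← sum_kos_apply, Finset.sum_eq_single S] at h2
      · rw [LinearMap.single_apply, Pi.single_eq_same] at h2
        rw [← h2, LinearMap.zero_apply, show (Submodule.Quotient.mk (krestr (R := R) k
          (kosb y (Pi.single S a))) : (Finset (Fin n) → A) ⧸ LinearMap.range D) = 0 from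
            (Submodule.Quotient.mk_eq_zero _).2 ⟨_, rfl⟩, map_zero]
      · intro T _ hT
        rw [LinearMap.single_apply, Pi.single_eq_of_ne hT, map_zero]
      · simp
    obtain ⟨μ, hμ⟩ := hlim.kBdy hcyc
    rw [pow_one] at hμ
    have h3 : ∑ S, (krestr (R := R) k φ) S (z S) =
        ∑ T, (if T.card + 1 = k then μ T else 0) (kosb y z T) := by
      rw [← sum_kos_apply]
      refine Finset.sum_congr rfl fun S _ => ?_
      congr 1
      rw [krestr_apply]
      split_ifs with h
      · rw [hμ S h]
        exact kos_congr _ fun T hT => by rw [if_pos (by omega)]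
      · rw [kos_apply]
        refine (Finset.sum_eq_zero fun j hj => ?_).symm
        have := Finset.card_erase_add_one hj
        rw [if_neg (by omega), smul_zero, smul_zero]
    rw [hpair, h3]
    refine Submodule.sum_mem _ fun T _ => ?_
    split_ifs with h
    · exact mem_smul_top_map _ (hz T h)
    · simp
  obtain ⟨r, hr⟩ := hW.exists_smul_mem s key
  have h4 : (pspan x (s + r) • (⊤ : Submodule R ((Finset (Fin n) → A) ⧸ LinearMap.range D))) =
      (pspan x (s + r) • (⊤ : Submodule R (Finset (Fin n) → A))).map (Submodule.mkQ _) := by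
    rw [Submodule.map_smul'', Submodule.map_top, Submodule.range_mkQ]
  rw [h4] at hr
  obtain ⟨u, hu, huz⟩ := hr
  rw [Submodule.mkQ_apply, ← Submodule.Quotient.mk_smul, eq_comm, Submodule.Quotient.eq] at huz
  obtain ⟨w, hw⟩ := huz
  refine ⟨r, w, fun S hS => ?_⟩
  have h5 := congr_fun hw S
  simp only [D, LinearMap.comp_apply, krestr_apply, if_pos hS, Pi.sub_apply, Pi.smul_apply] at h5
  rw [h5, sub_sub_cancel]
  exact mem_smul_top_pi_iff.1 hu S

end DualLifting

section GradedComponents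

variable {N : Type*} [AddCommGroup N] [Module R N] {N' : Type*} [AddCommGroup N'] [Module R N']

/-- The homogeneous component of degree `j`. -/
def gcomp {N : Type*} [AddCommGroup N] (𝒩 : ℤ → AddSubgroup N) [DirectSum.Decomposition 𝒩] (j : ℤ) :
    N →+ N where
  toFun u := (DirectSum.decompose 𝒩 u j : N)
  map_zero' := by simp
  map_add' u v := by simp [DirectSum.decompose_add]

lemma gcomp_mem (𝒩 : ℤ → AddSubgroup N) [DirectSum.Decomposition 𝒩] (j : ℤ) (u : N) :
    gcomp 𝒩 j u ∈ 𝒩 j := (DirectSum.decompose 𝒩 u j).2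

lemma gcomp_of_mem {𝒩 : ℤ → AddSubgroup N} [DirectSum.Decomposition 𝒩] {j : ℤ} {u : N}
    (hu : u ∈ 𝒩 j) : gcomp 𝒩 j u = u := DirectSum.decompose_of_mem_same 𝒩 hu

lemma gcomp_of_mem_ne {𝒩 : ℤ → AddSubgroup N} [DirectSum.Decomposition 𝒩] {i j : ℤ} {u : N}
    (hu : u ∈ 𝒩 i) (hij : i ≠ j) : gcomp 𝒩 j u = 0 := DirectSum.decompose_of_mem_ne 𝒩 hu hij

lemma graded_induction {𝒩 : ℤ → AddSubgroup N} [DirectSum.Decomposition 𝒩] {P : N → Prop}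
    (h0 : P 0) (hadd : ∀ u v, P u → P v → P (u + v)) (hmem : ∀ i, ∀ u ∈ 𝒩 i, P u) (u : N) : P u :=
  DirectSum.Decomposition.inductionOn 𝒩 h0 (fun {i} v => hmem i v v.2) hadd u

lemma gcomp_map {𝒩 : ℤ → AddSubgroup N} [DirectSum.Decomposition 𝒩] {𝒩' : ℤ → AddSubgroup N'}
    [DirectSum.Decomposition 𝒩'] (φ : N →+ N') (c : ℤ) (hφ : ∀ j, ∀ u ∈ 𝒩 j, φ u ∈ 𝒩' (c + j))
    (j : ℤ) (u : N) : gcomp 𝒩' (c + j) (φ u) = φ (gcomp 𝒩 j u) := by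
  induction u using graded_induction (𝒩 := 𝒩) with
  | h0 => simp
  | hadd u v hu hv => simp [hu, hv]
  | hmem i u hu =>
    by_cases h : i = j
    · subst h
      rw [gcomp_of_mem hu, gcomp_of_mem (hφ _ _ hu)]
    · rw [gcomp_of_mem_ne hu h, gcomp_of_mem_ne (hφ _ _ hu) (by omega), map_zero]

lemma gradedSMul_mem {𝒜 : ℤ → AddSubgroup R} {𝒩 : ℤ → AddSubgroup N} [SetLike.GradedSMul 𝒜 𝒩] {i j : ℤ} {a : R} {u : N}
    (ha : a ∈ 𝒜 i) (hu : u ∈ 𝒩 j) : a • u ∈ 𝒩 (i + j) := SetLike.GradedSMul.smul_mem ha hu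

lemma gcomp_smul {𝒜 : ℤ → AddSubgroup R} {𝒩 : ℤ → AddSubgroup N} [DirectSum.Decomposition 𝒩] [SetLike.GradedSMul 𝒜 𝒩]
    {i : ℤ} {a : R} (ha : a ∈ 𝒜 i) (j : ℤ) (u : N) :
    gcomp 𝒩 (i + j) (a • u) = a • gcomp 𝒩 j u :=
  gcomp_map (DistribSMul.toAddMonoidHom N a) i (fun _ _ hu => gradedSMul_mem ha hu) j u

variable {𝒜 : ℤ → AddSubgroup R} [GradedRing 𝒜]

/-- The ideal is closed under homogeneous components. -/
def HomogIdeal (𝒜 : ℤ → AddSubgroup R) [GradedRing 𝒜] (K : Ideal R) : Prop :=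
  ∀ j, ∀ a ∈ K, gcomp 𝒜 j a ∈ K

lemma HomogIdeal.gcomp_mem_smul_top {𝒩 : ℤ → AddSubgroup N} [DirectSum.Decomposition 𝒩]
    [SetLike.GradedSMul 𝒜 𝒩] {K : Ideal R} (hK : HomogIdeal 𝒜 K) (j : ℤ) {u : N}
    (hu : u ∈ K • (⊤ : Submodule R N)) : gcomp 𝒩 j u ∈ K • (⊤ : Submodule R N) := by
  classical
  induction hu using Submodule.smul_induction_on' with
  | smul a ha v _ =>
    rw [← DirectSum.sum_support_decompose 𝒜 a, Finset.sum_smul, map_sum]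
    refine Submodule.sum_mem _ fun i _ => ?_
    have h := gcomp_smul (𝒩 := 𝒩) (DirectSum.decompose 𝒜 a i).2 (j - i) v
    rw [add_sub_cancel] at h
    rw [h]
    exact Submodule.smul_mem_smul (hK i a ha) trivial
  | add u _ v _ hu hv => rw [map_add]; exact Submodule.add_mem _ hu hv

lemma homogIdeal_bot : HomogIdeal 𝒜 (⊥ : Ideal R) := by
  rintro j a rfl
  simp

lemma HomogIdeal.sup {K L : Ideal R} (hK : HomogIdeal 𝒜 K) (hL : HomogIdeal 𝒜 L) :
    HomogIdeal 𝒜 (K ⊔ L) := by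
  intro j a ha
  obtain ⟨b, hb, c, hc, rfl⟩ := Submodule.mem_sup.1 ha
  rw [map_add]
  exact Submodule.add_mem_sup (hK j b hb) (hL j c hc)

lemma homogIdeal_span_singleton {a : R} {i : ℤ} (ha : a ∈ 𝒜 i) :
    HomogIdeal 𝒜 (Ideal.span {a}) := by
  intro j b hb
  obtain ⟨c, rfl⟩ := Ideal.mem_span_singleton'.1 hb
  have h := gcomp_smul (𝒩 := 𝒜) ha (j - i) c
  rw [add_sub_cancel, smul_eq_mul, smul_eq_mul, mul_comm a] at h
  rw [h]
  exact Ideal.mul_mem_right _ _ (Ideal.mem_span_singleton_self a)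

end GradedComponents

section TopDegree

/-- The Koszul limit cohomology of `R / K` vanishes in cohomological degree `k` and
internal degrees `> L`. -/
def KTop {n : ℕ} (𝒜 : ℤ → AddSubgroup R) (x : Fin n → R) (e : Fin n → ℤ) (K : Ideal R) (k : ℕ)
    (L : ℤ) : Prop :=
  ∀ (t : ℕ) (ℓ : ℤ), L < ℓ → ∀ f : Finset (Fin n) → R,
    (∀ S, S.card = k → f S ∈ 𝒜 (ℓ + (t : ℤ) * ∑ j ∈ S, e j)) →
    (∀ S, S.card = k + 1 → kos (x ^ t) f S ∈ K) →
    ∃ (s : ℕ) (g : Finset (Fin n) → R), ∀ S, S.card = k →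
      ktr x s f S - kos (x ^ (t + s)) g S ∈ K

lemma KTop.mem_of_lt {𝒜 : ℤ → AddSubgroup R} {n : ℕ} {x : Fin n → R} {e : Fin n → ℤ} {K : Ideal R} {L : ℤ}
    (h : KTop 𝒜 x e K 0 L) (hK : ∀ j, x j ∈ K.radical) {r : R} {ℓ : ℤ} (hr : r ∈ 𝒜 ℓ)
    (hℓ : L < ℓ) : r ∈ K := by
  choose m hm using hK
  obtain ⟨s, g, hg⟩ := h (∑ j, m j) ℓ hℓ (fun _ => r)
    (fun S hS => by rw [Finset.card_eq_zero.1 hS]; simpa using hr)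
    (fun S _ => by
      rw [kos_apply]
      refine Submodule.sum_mem _ fun j _ => zsmul_mem (Ideal.mul_mem_right _ _ ?_) _
      exact Ideal.mem_of_dvd _ (pow_dvd_pow _ (Finset.single_le_sum (f := m)
        (fun _ _ => Nat.zero_le _) (Finset.mem_univ j))) (hm j))
  simpa [ktr_apply, kos_apply] using hg ∅ rfl

lemma KTop.of_kVanish {n : ℕ} {x : Fin n → R} {e : Fin n → ℤ} {k : ℕ} {L : ℤ}
    (h : ∀ ℓ, L < ℓ → KVanish x (fun j => 𝒜 j) e k ℓ) : KTop 𝒜 x e ⊥ k L := by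
  intro t ℓ hℓ f hf hcyc
  obtain ⟨s, hs⟩ := h ℓ hℓ t (kres k f) (kd_kres_eq_zero_iff.2 fun S hS => hcyc S hS)
    (fun S => hf S.1 S.2)
  rw [kTrans_kres, isKBoundary_kres_iff] at hs
  obtain ⟨g, hg⟩ := hs
  exact ⟨s, g, fun S hS => by rw [hg S hS, sub_self]; exact Submodule.zero_mem _⟩

variable {𝒜 : ℤ → AddSubgroup R} [GradedRing 𝒜]

lemma kos_mem_graded {n : ℕ} {N : Type*} [AddCommGroup N] [Module R N] {𝒩 : ℤ → AddSubgroup N}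
    [SetLike.GradedSMul 𝒜 𝒩] {x : Fin n → R} {e : Fin n → ℤ} (hx : ∀ j, x j ∈ 𝒜 (e j)) {t : ℕ}
    {ℓ : ℤ} {f : Finset (Fin n) → N} {S : Finset (Fin n)}
    (hf : ∀ T : Finset (Fin n), T.card + 1 = S.card → f T ∈ 𝒩 (ℓ + (t : ℤ) * ∑ j ∈ T, e j)) :
    kos (x ^ t) f S ∈ 𝒩 (ℓ + (t : ℤ) * ∑ j ∈ S, e j) := by
  rw [kos_apply]
  refine sum_mem fun j hj => zsmul_mem ?_ _
  have h := gradedSMul_mem (SetLike.pow_mem_graded t (hx j)) (hf _ (Finset.card_erase_add_one hj))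
  rw [← Finset.add_sum_erase _ _ hj, Pi.pow_apply]
  convert h using 1
  simp only [nsmul_eq_mul]
  ring_nf

lemma KLim.exists_ktr_sub_kos_mem {n : ℕ} {ρ : AddSubmonoid ℕ} {x : Fin n → R} {k : ℕ}
    {N : Type*} [AddCommGroup N] [Module R N] {K : Submodule R N} (h : KLim ρ x k (N ⧸ K)) {t : ℕ}
    {f : Finset (Fin n) → N} (hf : ∀ S, S.card = k + 1 → kos (x ^ t) f S ∈ K) :
    ∃ r ∈ ρ, ∃ g : Finset (Fin n) → N, ∀ S, S.card = k →
      ktr x r f S - kos (x ^ (t + r)) g S ∈ K := by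
  have hcyc : KCyc (x ^ t) k (fun S => K.mkQ (f S)) := fun S hS => by
    rw [kos_comp]
    exact (Submodule.Quotient.mk_eq_zero _).2 (hf S hS)
  obtain ⟨r, hr, g', hg'⟩ := h t _ hcyc
  choose g hg using fun S => Submodule.Quotient.mk_surjective K (g' S)
  refine ⟨r, hr, g, fun S hS => ?_⟩
  rw [← Submodule.Quotient.mk_eq_zero, Submodule.Quotient.mk_sub, sub_eq_zero]
  have h1 := hg' S hS
  rw [ktr_comp, show g' = fun S => K.mkQ (g S) from funext fun S => (hg S).symm, kos_comp] at h1
  exact h1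

lemma KLim.exists_sub_kos_mem {n : ℕ} {x : Fin n → R} {k : ℕ} {N : Type*} [AddCommGroup N]
    [Module R N] {K : Submodule R N} (h : KLim ⊥ x k (N ⧸ K)) {t : ℕ} {f : Finset (Fin n) → N}
    (hf : ∀ S, S.card = k + 1 → kos (x ^ t) f S ∈ K) :
    ∃ g : Finset (Fin n) → N, ∀ S, S.card = k → f S - kos (x ^ t) g S ∈ K := by
  obtain ⟨r, hr, g, hg⟩ := h.exists_ktr_sub_kos_mem hf
  rw [AddSubmonoid.mem_bot] at hr
  subst hr
  exact ⟨g, fun S hS => by simpa [ktr_zero] using hg S hS⟩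

lemma KTop.sup_span_singleton {n : ℕ} {x : Fin n → R} {e : Fin n → ℤ}
    (hx : ∀ j, x j ∈ 𝒜 (e j)) {K : Ideal R}
    (hK : HomogIdeal 𝒜 K) {a : R} {ε : ℤ} (ha : a ∈ 𝒜 ε) (hreg : ∀ r, a * r ∈ K → r ∈ K) {k : ℕ}
    (hlim : KLim ⊥ x k (R ⧸ K)) {L : ℤ} (h : KTop 𝒜 x e K (k + 1) L) :
    KTop 𝒜 x e (K ⊔ Ideal.span {a}) k (L + ε) := by
  classical
  intro t ℓ hℓ f hf hcyc
  have h1 : ∀ S, S.card = k + 1 → ∃ g ∈ 𝒜 (ℓ - ε + (t : ℤ) * ∑ j ∈ S, e j),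
      kos (x ^ t) f S - a * g ∈ K := by
    intro S hS
    obtain ⟨κ, hκ, b, hb, hκb⟩ := Submodule.mem_sup.1 (hcyc S hS)
    obtain ⟨g, rfl⟩ := Ideal.mem_span_singleton'.1 hb
    refine ⟨_, gcomp_mem 𝒜 (ℓ - ε + (t : ℤ) * ∑ j ∈ S, e j) g, ?_⟩
    have h2 := gcomp_smul (𝒩 := 𝒜) ha (ℓ - ε + (t : ℤ) * ∑ j ∈ S, e j) g
    rw [smul_eq_mul, smul_eq_mul, mul_comm a g, show ε + (ℓ - ε + (t : ℤ) * ∑ j ∈ S, e j) =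
      ℓ + (t : ℤ) * ∑ j ∈ S, e j by ring] at h2
    have h3 : kos (x ^ t) f S ∈ 𝒜 (ℓ + (t : ℤ) * ∑ j ∈ S, e j) :=
      kos_mem_graded hx fun T hT => hf T (by omega)
    rw [← h2, ← gcomp_of_mem h3, ← hκb, map_add, add_sub_cancel_right]
    exact hK _ _ hκ
  choose! g hg hgK using h1
  obtain ⟨s, w, hw⟩ := h t (ℓ - ε) (by omega) g hg (fun S hS => by
    apply hreg
    have h4 : a * kos (x ^ t) g S =
        -∑ j ∈ S, ksgn j S • (x ^ t) j • (kos (x ^ t) f (S.erase j) - a * g (S.erase j)) := by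
      have h5 : ∑ j ∈ S, ksgn j S • (x ^ t) j • kos (x ^ t) f (S.erase j) = 0 :=
        congr_fun (kos_kos (x ^ t) f) S
      simp only [smul_sub, Finset.sum_sub_distrib, h5, zero_sub, neg_neg]
      rw [kos_apply, Finset.mul_sum]
      refine Finset.sum_congr rfl fun j _ => ?_
      simp [mul_left_comm]
    rw [h4]
    refine K.neg_mem (Submodule.sum_mem _ fun j hj => zsmul_mem (Ideal.mul_mem_left _ _ (hgK _ ?_)) _)
    rw [Finset.card_erase_of_mem hj, hS, Nat.add_sub_cancel])
  obtain ⟨v, hv⟩ := hlim.exists_sub_kos_mem (K := K) (t := t + s) (f := ktr x s f - a • w)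
    (fun S hS => by
      rw [map_sub, map_smul, kos_ktr, Pi.sub_apply, Pi.smul_apply, ktr_apply, smul_eq_mul,
        smul_eq_mul]
      have h6 := K.add_mem (Ideal.mul_mem_left K ((∏ j ∈ S, x j) ^ s) (hgK S hS))
        (Ideal.mul_mem_left K a (hw S hS))
      rw [ktr_apply, smul_eq_mul] at h6
      convert h6 using 1
      ring)
  refine ⟨s, v, fun S hS => ?_⟩
  have h7 := Submodule.add_mem_sup (hv S hS)
    (Ideal.mul_mem_right (w S) _ (Ideal.mem_span_singleton_self a))
  convert h7 using 1
  simp only [Pi.sub_apply, Pi.smul_apply, smul_eq_mul]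
  ring

lemma KTop.sup_ofList {n : ℕ} {x : Fin n → R} {e : Fin n → ℤ} (hx : ∀ j, x j ∈ 𝒜 (e j)) {m : ℕ}
    (a : Fin m → R) (δ : Fin m → ℤ) (hδ : ∀ i, a i ∈ 𝒜 (δ i))
    (hrad : ∀ i, a i ∈ (Ideal.span (Set.range x)).radical) {K : Ideal R}
    (hK : HomogIdeal 𝒜 K)
    (hreg : RingTheory.Sequence.IsWeaklyRegular (R ⧸ K) (List.ofFn a))
    {L : ℤ} (h : KTop 𝒜 x e K m L) :
    KTop 𝒜 x e (K ⊔ Ideal.ofList (List.ofFn a)) 0 (L + ∑ i, δ i) := by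
  induction m generalizing K L with
  | zero => simpa using h
  | succ m ih =>
    have hlim : KLim ⊥ x m (R ⧸ K) :=
      KLim.of_isWeaklyRegular _ _ _ hreg (fun b hb => by
        obtain ⟨i, rfl⟩ := List.mem_ofFn.1 hb
        exact hrad i) (by simp)
    rw [List.ofFn_succ, RingTheory.Sequence.isWeaklyRegular_cons_iff] at hreg
    have h1 := KTop.sup_span_singleton hx hK (hδ 0) (fun r hr => by
      rw [← Ideal.Quotient.eq_zero_iff_mem]
      refine hreg.1 ?_
      change a 0 • (Ideal.Quotient.mk K r) = a 0 • 0
      rw [smul_zero, ← Ideal.Quotient.mk_eq_mk, ← Submodule.Quotient.mk_smul,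
        Submodule.Quotient.mk_eq_zero]
      exact hr) hlim h
    have h2 := ih (fun i => a i.succ) (fun i => δ i.succ) (fun i => hδ _) (fun i => hrad _)
      (hK.sup (homogIdeal_span_singleton (hδ 0))) (by
        refine (LinearEquiv.isWeaklyRegular_congr (?_ : _ ≃ₗ[R] _) _).1 hreg.2
        refine (Submodule.quotEquivOfEq _ _ ?_).trans
          (Submodule.quotientQuotientEquivQuotientSup K (Ideal.span {a 0}))
        rw [← Submodule.range_mkQ K, ← Submodule.map_top, ← Submodule.map_pointwise_smul]
        congr 1
        ext b
        simp [Submodule.mem_smul_pointwise_iff_exists, Ideal.mem_span_singleton', mul_comm (a 0)])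
      h1
    rw [List.ofFn_succ, Ideal.ofList_cons, ← sup_assoc, Fin.sum_univ_succ, ← add_assoc]
    exact h2

end TopDegree

section TotalComplex

variable {C : ℕ → Type} [∀ j, AddCommGroup (C j)] [∀ j, Module R (C j)]

/-- Cocycles of the total complex of `K^•(x ^ s; C_•)`: the component `c q` is a Koszul cochain
of cohomological degree `q + k`. -/
def TotCyc {d : ℕ} (x : Fin d → R) (dl : ∀ j, C (j + 1) →ₗ[R] C j) (k s : ℕ)
    (c : ∀ q, Finset (Fin d) → C q) : Prop :=
  ∀ q (S : Finset (Fin d)), S.card = q + k + 1 → dl q (c (q + 1) S) = kos (x ^ s) (c q) S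

variable {d : ℕ} {x : Fin d → R} {dl : ∀ j, C (j + 1) →ₗ[R] C j}

lemma exists_kos_eq_of_mem_pspan_smul {N : Type*} [AddCommGroup N] [Module R N] {s : ℕ} {v : N}
    (hv : v ∈ pspan x s • (⊤ : Submodule R N)) :
    ∃ f : Finset (Fin d) → N, ∀ S : Finset (Fin d), S.card = d → kos (x ^ s) f S = v := by
  have hS : ∀ S : Finset (Fin d), S.card = d → S = Finset.univ := fun S hS =>
    (Finset.card_eq_iff_eq_univ S).1 (by simpa using hS)
  induction hv using Submodule.smul_induction_on' with
  | smul a ha u _ =>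
    have h := KCyc.kBdy_smul_of_mem (x := x ^ s) (k := d) (f := fun _ => u)
      (fun S hS => by
        have := Finset.card_le_univ S
        simp only [Fintype.card_fin] at this
        omega) ha
    obtain ⟨g, hg⟩ := h
    exact ⟨g, fun S hS => (hg S hS).symm⟩
  | add u _ v _ hu hv =>
    obtain ⟨f, hf⟩ := hu
    obtain ⟨g, hg⟩ := hv
    exact ⟨f + g, fun S hS => by rw [map_add, Pi.add_apply, hf S hS, hg S hS]⟩

lemma kos_mem_pspan_smul {N : Type*} [AddCommGroup N] [Module R N] (s : ℕ)
    (f : Finset (Fin d) → N) (S : Finset (Fin d)) :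
    kos (x ^ s) f S ∈ pspan x s • (⊤ : Submodule R N) := by
  rw [kos_apply]
  exact Submodule.sum_mem _ fun j _ => zsmul_mem
    (Submodule.smul_mem_smul (pow_mem_pspan x s j) Submodule.mem_top) _

protected lemma TotCyc.ktr {k s : ℕ} {c : ∀ q, Finset (Fin d) → C q} (h : TotCyc x dl k s c) (r : ℕ) :
    TotCyc x dl k (s + r) (fun q => ktr x r (c q)) := by
  intro q S hS
  rw [kos_ktr, ktr_apply, ← h q S hS, ← map_smul]
  rfl

/-- An element of `C (p + 1)` whose differential vanishes modulo `(x ^ s)` extends to a cocycle of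
the total complex. -/
lemma exists_totCyc (hcomplex : ∀ j, (dl j).comp (dl (j + 1)) = 0) {k p s : ℕ} (hkp : p + 1 + k = d)
    (hC : ∀ q, q + k + 1 < d → KLim ⊥ x (q + k + 1) (C q)) {u : C (p + 1)}
    (hu : dl p u ∈ pspan x s • (⊤ : Submodule R (C p))) :
    ∃ c, TotCyc x dl k s c ∧ c (p + 1) Finset.univ = u := by
  have hcard : ∀ S : Finset (Fin d), S.card ≤ d := fun S => by
    simpa using Finset.card_le_univ S
  have huniv : ∀ S : Finset (Fin d), S.card = d → S = Finset.univ := fun S hS =>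
    (Finset.card_eq_iff_eq_univ S).1 (by simpa using hS)
  suffices h : ∀ a b, a + b = p + 1 → ∃ c : ∀ q, Finset (Fin d) → C q,
      (∀ q, b ≤ q → ∀ S : Finset (Fin d), S.card = q + k + 1 →
        dl q (c (q + 1) S) = kos (x ^ s) (c q) S) ∧ c (p + 1) Finset.univ = u by
    obtain ⟨c, hc, hcu⟩ := h (p + 1) 0 rfl
    exact ⟨c, fun q => hc q (Nat.zero_le q), hcu⟩
  intro a
  induction a with
  | zero =>
    rintro b hb
    refine ⟨Function.update 0 (p + 1) fun _ => u, fun q hq S hS => ?_, by simp⟩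
    have := hcard S
    omega
  | succ a ih =>
    intro b hb
    obtain ⟨c, hc, hcu⟩ := ih (b + 1) (by omega)
    obtain ⟨g, hg⟩ : ∃ g : Finset (Fin d) → C b, ∀ S : Finset (Fin d), S.card = b + k + 1 →
        dl b (c (b + 1) S) = kos (x ^ s) g S := by
      by_cases hlt : b + k + 1 < d
      · have hcyc : KCyc (x ^ s) (b + k + 1) (fun S => dl b (c (b + 1) S)) := fun S hS => by
          rw [kos_comp]
          beta_reduce
          rw [← hc (b + 1) le_rfl S (by omega)]
          exact LinearMap.congr_fun (hcomplex b) _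
        exact (hC b hlt).kBdy hcyc
      · obtain rfl : b = p := by omega
        obtain ⟨g, hg⟩ := exists_kos_eq_of_mem_pspan_smul hu
        refine ⟨g, fun S hS => ?_⟩
        rw [huniv S (by omega), hcu, hg _ (by simp)]
    refine ⟨Function.update c b g, fun q hq S hS => ?_, ?_⟩
    · rw [Function.update_of_ne (by omega)]
      rcases hq.eq_or_lt with rfl | hq
      · rw [Function.update_self, hg S hS]
      · rw [Function.update_of_ne (by omega), hc q hq S hS]
    · rw [Function.update_of_ne (by omega), hcu]

/-- A cocycle of the total complex of positive degree whose image in `M` is a coboundary is,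
in the limit, a coboundary. -/
lemma TotCyc.exists_ktr_eq {M : Type} [AddCommGroup M] [Module R M]
    {π : C 0 →ₗ[R] M}
    (hπsurj : Function.Surjective π) (hπker : LinearMap.ker π = LinearMap.range (dl 0)) {k s : ℕ}
    (hH : ∀ q, q + 1 < d → KLim ⊤ x (q + 1 + (k + 1)) (Hmod C dl q))
    {c : ∀ q, Finset (Fin d) → C q} (hc : TotCyc x dl (k + 1) s c) {m : Finset (Fin d) → M}
    (hm : ∀ S : Finset (Fin d), S.card = k + 1 → π (c 0 S) = kos (x ^ s) m S) :
    ∃ (r : ℕ) (b : ∀ q, Finset (Fin d) → C q),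
      (∀ S : Finset (Fin d), S.card = k → π (b 0 S) = ktr x r m S) ∧
      ∀ q (S : Finset (Fin d)), S.card = q + k + 1 →
        ktr x r (c q) S = kos (x ^ (s + r)) (b q) S + dl q (b (q + 1) S) := by
  have hcard : ∀ S : Finset (Fin d), S.card ≤ d := fun S => by
    simpa using Finset.card_le_univ S
  suffices h : ∀ a < d, ∃ (r : ℕ) (b : ∀ q, Finset (Fin d) → C q),
      (∀ S : Finset (Fin d), S.card = k → π (b 0 S) = ktr x r m S) ∧
      ∀ q ≤ a, ∀ (S : Finset (Fin d)), S.card = q + k + 1 →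
        ktr x r (c q) S = kos (x ^ (s + r)) (b q) S + dl q (b (q + 1) S) by
    rcases Nat.eq_zero_or_pos d with hd | hd
    · choose b hb using fun S => hπsurj (m S)
      refine ⟨0, Function.update 0 0 b, fun S _ => ?_, fun q S hS => ?_⟩
      · rw [Function.update_self, hb, ktr_zero]
      · have := hcard S
        omega
    · obtain ⟨r, b, hb0, hb⟩ := h (d - 1) (by omega)
      refine ⟨r, b, hb0, fun q S hS => hb q ?_ S hS⟩
      have := hcard S
      omega
  intro a ha
  induction a with
  | zero =>
    choose b hb using fun S => hπsurj (m S)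
    have h1 : ∀ S : Finset (Fin d), S.card = k + 1 → ∃ v, dl 0 v = c 0 S - kos (x ^ s) b S := by
      intro S hS
      rw [← LinearMap.mem_range, ← hπker, LinearMap.mem_ker, map_sub, hm S hS, sub_eq_zero]
      rw [show m = fun S => π (b S) from funext fun S => (hb S).symm, kos_comp]
    choose! b' hb' using h1
    refine ⟨0, Function.update (Function.update 0 1 b') 0 b, fun S _ => ?_, fun q hq S hS => ?_⟩
    · rw [Function.update_self, hb, ktr_zero]
    · obtain rfl : q = 0 := by omega
      rw [Function.update_self, Function.update_of_ne (by omega), Function.update_self,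
        hb' S (by omega), ktr_zero, add_zero, add_sub_cancel]
  | succ a ih =>
    obtain ⟨r, b, hb0, hb⟩ := ih (by omega)
    let z : Finset (Fin d) → C (a + 1) := ktr x r (c (a + 1)) - kos (x ^ (s + r)) (b (a + 1))
    have hz : ∀ S : Finset (Fin d), S.card = a + 1 + (k + 1) → dl a (z S) = 0 := by
      intro S hS
      have h1 : dl a (ktr x r (c (a + 1)) S) = kos (x ^ (s + r)) (ktr x r (c a)) S :=
        hc.ktr r a S (by omega)
      have h2 : dl a (kos (x ^ (s + r)) (b (a + 1)) S) =
          kos (x ^ (s + r)) (ktr x r (c a) - kos (x ^ (s + r)) (b a)) S := by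
        rw [← congr_fun (kos_comp (x ^ (s + r)) (dl a) (b (a + 1))) S]
        refine kos_congr _ fun T hT => ?_
        rw [Pi.sub_apply, hb a le_rfl T (by omega), add_sub_cancel_left]
      simp only [z]
      rw [Pi.sub_apply, map_sub, h1, h2, map_sub, kos_kos, sub_zero, sub_self]
    classical
    let z' : Finset (Fin d) → LinearMap.ker (dl a) := fun S =>
      if h : dl a (z S) = 0 then ⟨z S, h⟩ else 0
    have hz' : ∀ S : Finset (Fin d), S.card = a + 1 + (k + 1) →
        (LinearMap.ker (dl a)).subtype (z' S) = z S := fun S hS => by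
      simp only [z', dif_pos (hz S hS), Submodule.subtype_apply]
    obtain ⟨r', -, h, hh⟩ := (hH a (by omega)).exists_ktr_sub_kos_mem (t := s + r) (f := z')
      (fun S hS => by
        rw [Submodule.mem_comap, ← congr_fun (kos_comp _ _ _) S,
          kos_congr _ (g := z) fun T hT => hz' T (by omega)]
        refine ⟨ktr x r (c (a + 1 + 1)) S, ?_⟩
        rw [map_sub, kos_kos, sub_zero]
        exact hc.ktr r (a + 1) S (by omega))
    have h1 : ∀ S : Finset (Fin d), S.card = a + 1 + (k + 1) → ∃ v, dl (a + 1) v =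
        ktr x r' z S - kos (x ^ (s + r + r')) (fun S => (h S : C (a + 1))) S := by
      intro S hS
      obtain ⟨v, hv⟩ := hh S hS
      refine ⟨v, hv.trans ?_⟩
      rw [map_sub, ktr_apply, map_smul, hz' S hS, ← congr_fun (kos_comp _ _ _) S]
      rfl
    choose! w hw using h1
    refine ⟨r + r', Function.update (Function.update (fun q => ktr x r' (b q)) (a + 1)
      (ktr x r' (b (a + 1)) + fun S => (h S : C (a + 1)))) (a + 1 + 1) w, fun S hS => ?_,
      fun q hq S hS => ?_⟩
    · rw [Function.update_of_ne (by omega), Function.update_of_ne (by omega), ktr_apply, map_smul,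
        hb0 S hS, ← ktr_apply, ktr_ktr]
    · rw [Function.update_of_ne (by omega), ← ktr_ktr, ← add_assoc]
      rcases hq.eq_or_lt with rfl | hq
      · rw [Function.update_self, Function.update_self, hw S (by omega), map_add, Pi.add_apply,
          kos_ktr, map_sub, Pi.sub_apply]
        abel
      · have hbq := hb q (by omega) S hS
        rw [Function.update_of_ne (by omega), kos_ktr, ktr_apply, hbq, smul_add, ktr_apply]
        congr 1
        rcases (Nat.le_of_lt_succ hq).eq_or_lt with rfl | hq
        · rw [Function.update_of_ne (by omega), Function.update_self, Pi.add_apply, map_add,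
            LinearMap.mem_ker.1 (h S).2, add_zero, ktr_apply, map_smul]
        · rw [Function.update_of_ne (by omega), Function.update_of_ne (by omega), ktr_apply,
            map_smul]

end TotalComplex

section TotalComplexApplications

variable {C : ℕ → Type} [∀ j, AddCommGroup (C j)] [∀ j, Module R (C j)]
  {d : ℕ} {x : Fin d → R} {dl : ∀ j, C (j + 1) →ₗ[R] C j}

/-- Up to the transition maps, elements of `C (p + 1)` that are cycles modulo `(x ^ s)` are
boundaries modulo `(x ^ s)`. -/
lemma exists_prod_pow_smul_sub_mem {N : Type} [AddCommGroup N] [Module R N]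
    (hcomplex : ∀ j, (dl j).comp (dl (j + 1)) = 0)
    {π : C 0 →ₗ[R] N} (hπsurj : Function.Surjective π)
    (hπker : LinearMap.ker π = LinearMap.range (dl 0)) {k p s : ℕ} (hkp : p + 1 + (k + 1) = d)
    (hC : ∀ q, q + (k + 1) + 1 < d → KLim ⊥ x (q + (k + 1) + 1) (C q))
    (hH : ∀ q, q + 1 < d → KLim ⊤ x (q + 1 + (k + 1)) (Hmod C dl q))
    (hN : KLim ⊤ x (k + 1) N) {u : C (p + 1)}
    (hu : dl p u ∈ pspan x s • (⊤ : Submodule R (C p))) :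
    ∃ (r : ℕ) (v : C (p + 1 + 1)),
      (∏ j, x j) ^ r • u - dl (p + 1) v ∈ pspan x (s + r) • (⊤ : Submodule R (C (p + 1))) := by
  obtain ⟨c, hc, hcu⟩ := exists_totCyc hcomplex hkp hC hu
  have hcyc : KCyc (x ^ s) (k + 1) (fun S => π (c 0 S)) := fun S hS => by
    rw [kos_comp]
    beta_reduce
    rw [← hc 0 S (by omega), ← LinearMap.mem_ker, hπker]
    exact LinearMap.mem_range_self _ _
  obtain ⟨r, -, m, hm⟩ := hN s _ hcyc
  obtain ⟨r', b, -, hb⟩ := (hc.ktr r).exists_ktr_eq hπsurj hπker hH (m := m) (fun S hS => by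
    rw [← hm S hS, ktr_comp])
  refine ⟨r + r', b (p + 1 + 1) Finset.univ, ?_⟩
  have h := hb (p + 1) Finset.univ (by simp; omega)
  rw [ktr_ktr, ktr_apply, hcu] at h
  rw [h, add_sub_cancel_right, ← add_assoc]
  exact kos_mem_pspan_smul _ _ _

/-- Torsion elements of `M` come from cocycles of the total complex of degree zero. -/
lemma exists_totCyc_of_pow_smul_eq_zero {N : Type} [AddCommGroup N] [Module R N]
    {π : C 0 →ₗ[R] N} (hπsurj : Function.Surjective π)
    (hπker : LinearMap.ker π = LinearMap.range (dl 0))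
    (hH : ∀ q, q + 1 < d → KLim ⊤ x (q + 1 + 1) (Hmod C dl q))
    {u : N} {s : ℕ} (hu : ∀ j, x j ^ s • u = 0) :
    ∃ (r : ℕ) (c : ∀ q, Finset (Fin d) → C q), TotCyc x dl 0 (s + r) c ∧ π (c 0 ∅) = u := by
  obtain ⟨v, rfl⟩ := hπsurj u
  let c₀ : Finset (Fin d) → C 0 := fun _ => v
  have hc : TotCyc x dl (0 + 1) s (Function.update 0 0 (kos (x ^ s) c₀)) := by
    intro q S _
    rw [Function.update_of_ne (by omega)]
    rcases q.eq_zero_or_pos with rfl | hq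
    · rw [Function.update_self, kos_kos]
      simp
    · rw [Function.update_of_ne (by omega)]
      simp
  obtain ⟨r, b, hb0, hb⟩ := hc.exists_ktr_eq hπsurj hπker hH (m := 0) (fun S _ => by
    rw [Function.update_self, ← congr_fun (kos_comp (x ^ s) π c₀) S, map_zero, kos_apply]
    exact Finset.sum_eq_zero fun j _ => by rw [Pi.pow_apply, hu, smul_zero])
  refine ⟨r, Function.update (fun q => (-1 : ℤ) ^ (q + 1) • b q) 0 (ktr x r c₀ - b 0),
    fun q S hS => ?_, ?_⟩
  · have h := hb q S (by omega)
    rw [Function.update_of_ne (by omega), Pi.smul_apply, map_zsmul]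
    rcases q.eq_zero_or_pos with rfl | hq
    · rw [Function.update_self, ← kos_ktr] at h
      rw [Function.update_self, map_sub, Pi.sub_apply, h]
      simp
    · rw [Function.update_of_ne (by omega), Pi.zero_apply, map_zero, Pi.zero_apply] at h
      rw [Function.update_of_ne (by omega), eq_neg_of_add_eq_zero_right h.symm, map_zsmul,
        Pi.smul_apply, pow_succ (-1 : ℤ) (q + 1)]
      simp
  · rw [Function.update_self, Pi.sub_apply, map_sub, hb0 ∅ rfl]
    simp [ktr_apply, c₀]

/-- A cocycle of the total complex of degree zero whose top component vanishes modulo `(x ^ s)`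
has trivial image in `M`. -/
lemma TotCyc.map_eq_zero {N : Type} [AddCommGroup N] [Module R N]
    (hcomplex : ∀ j, (dl j).comp (dl (j + 1)) = 0)
    {π : C 0 →ₗ[R] N} (hπker : LinearMap.ker π = LinearMap.range (dl 0)) {p s : ℕ}
    (hp : p + 1 = d) (hC : ∀ q, q < d → KLim ⊥ x q (C q))
    {c : ∀ q, Finset (Fin d) → C q} (hc : TotCyc x dl 0 s c)
    (hcd : c (p + 1) Finset.univ ∈ pspan x s • (⊤ : Submodule R (C (p + 1)))) :
    π (c 0 ∅) = 0 := by
  have huniv : ∀ S : Finset (Fin d), S.card = d → S = Finset.univ := fun S hS =>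
    (Finset.card_eq_iff_eq_univ S).1 (by simpa using hS)
  suffices h : ∀ a b, a + b = p → ∃ h : Finset (Fin d) → C (b + 1), ∀ S : Finset (Fin d),
      S.card = b + 1 → dl b (c (b + 1) S) = dl b (kos (x ^ s) h S) by
    obtain ⟨h, hh⟩ := h p 0 rfl
    obtain ⟨g, hg⟩ := (hC 0 (by omega)).kBdy (s := s) (f := fun S => c 0 S - dl 0 (h S))
      (fun S hS => by
        rw [show (fun S => c 0 S - dl 0 (h S)) = c 0 - fun S => dl 0 (h S) from rfl, map_sub,
          Pi.sub_apply, kos_comp, ← hc 0 S (by omega), hh S (by omega), sub_self])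
    have h0 := hg ∅ rfl
    rw [kos_apply, Finset.sum_empty, sub_eq_zero] at h0
    rw [h0, ← LinearMap.mem_ker, hπker]
    exact LinearMap.mem_range_self _ _
  intro a
  induction a with
  | zero =>
    rintro b hb
    obtain rfl : b = p := by omega
    obtain ⟨h, hh⟩ := exists_kos_eq_of_mem_pspan_smul hcd
    exact ⟨h, fun S hS => by rw [hh S (by omega), huniv S (by omega)]⟩
  | succ a ih =>
    intro b hb
    obtain ⟨h, hh⟩ := ih (b + 1) (by omega)
    obtain ⟨g, hg⟩ := (hC (b + 1) (by omega)).kBdy (s := s)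
      (f := fun S => c (b + 1) S - dl (b + 1) (h S))
      (fun S hS => by
        rw [show (fun S => c (b + 1) S - dl (b + 1) (h S)) =
            c (b + 1) - fun S => dl (b + 1) (h S) from rfl, map_sub,
          Pi.sub_apply, kos_comp, ← hc (b + 1) S (by omega), hh S (by omega), sub_self])
    refine ⟨g, fun S hS => ?_⟩
    rw [← hg S hS, map_sub, eq_comm, sub_eq_self]
    exact LinearMap.congr_fun (hcomplex b) _

end TotalComplexApplications

section GradedChase

lemma prod_smul_sub_add {d : ℕ} {x : Fin d → R} {s r r' : ℕ} {N : Type*} [AddCommGroup N]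
    [Module R N] {a b c : N}
    (h1 : (∏ j, x j) ^ r • a - b ∈ pspan x (s + r) • (⊤ : Submodule R N))
    (h2 : (∏ j, x j) ^ r' • b - c ∈ pspan x (s + r + r') • (⊤ : Submodule R N)) :
    (∏ j, x j) ^ (r + r') • a - c ∈ pspan x (s + (r + r')) • (⊤ : Submodule R N) := by
  have h := Submodule.add_mem _ (prod_pow_smul_mem_pspan_smul x (s + r) r' h1) h2
  rw [smul_sub, sub_add_sub_cancel, smul_smul, ← pow_add, add_comm r' r, add_assoc] at h
  exact h

lemma kosb_mem_smul_top {n : ℕ} (y : Fin n → R) {I : Ideal R} {N : Type*} [AddCommGroup N]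
    [Module R N] {f : Finset (Fin n) → N} {S : Finset (Fin n)}
    (hf : ∀ T : Finset (Fin n), T.card = S.card + 1 → f T ∈ I • (⊤ : Submodule R N)) :
    kosb y f S ∈ I • (⊤ : Submodule R N) := by
  rw [kosb_apply]
  exact Submodule.sum_mem _ fun j hj => zsmul_mem (Submodule.smul_mem _ _
    (hf _ (Finset.card_insert_of_notMem (Finset.mem_compl.1 hj)))) _

lemma gcomp_kosb {𝒜 : ℤ → AddSubgroup R} {n : ℕ} {N : Type*} [AddCommGroup N] [Module R N] {𝒩 : ℤ → AddSubgroup N}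
    [DirectSum.Decomposition 𝒩] [SetLike.GradedSMul 𝒜 𝒩] {y : Fin n → R} {e : Fin n → ℤ}
    (hy : ∀ j, y j ∈ 𝒜 (e j)) (δ : ℤ) (f : Finset (Fin n) → N) (S : Finset (Fin n)) :
    gcomp 𝒩 (δ - ∑ j ∈ S, e j) (kosb y f S) =
      kosb y (fun T => gcomp 𝒩 (δ - ∑ j ∈ T, e j) (f T)) S := by
  rw [kosb_apply, kosb_apply, map_sum]
  refine Finset.sum_congr rfl fun j hj => ?_
  rw [map_zsmul, Finset.sum_insert (Finset.mem_compl.1 hj), ← gcomp_smul (𝒩 := 𝒩) (hy j)]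
  congr 3
  ring

variable {𝒜 : ℤ → AddSubgroup R} [GradedRing 𝒜]

lemma gcomp_kos {n : ℕ} {N : Type*} [AddCommGroup N] [Module R N] {𝒩 : ℤ → AddSubgroup N}
    [DirectSum.Decomposition 𝒩] [SetLike.GradedSMul 𝒜 𝒩] {x : Fin n → R} {ε : Fin n → ℤ}
    (hx : ∀ j, x j ∈ 𝒜 (ε j)) (s : ℕ) (δ : ℤ) (f : Finset (Fin n) → N) (S : Finset (Fin n)) :
    gcomp 𝒩 (δ + s * ∑ j ∈ S, ε j) (kos (x ^ s) f S) =
      kos (x ^ s) (fun T => gcomp 𝒩 (δ + s * ∑ j ∈ T, ε j) (f T)) S := by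
  rw [kos_apply, kos_apply, map_sum]
  refine Finset.sum_congr rfl fun j hj => ?_
  rw [map_zsmul, Pi.pow_apply, ← gcomp_smul (𝒩 := 𝒩) (SetLike.pow_mem_graded s (hx j)),
    ← Finset.add_sum_erase _ _ hj]
  congr 3
  simp only [nsmul_eq_mul]
  ring

lemma homogIdeal_pspan {d : ℕ} {x : Fin d → R} {ε : Fin d → ℤ} (hx : ∀ j, x j ∈ 𝒜 (ε j)) (s : ℕ) :
    HomogIdeal 𝒜 (pspan x s) := by
  intro δ a ha
  have : ∀ S : Finset (Fin d), HomogIdeal 𝒜 (Ideal.span ((fun j => x j ^ s) '' S)) := by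
    classical
    intro S
    induction S using Finset.induction with
    | empty => simpa using homogIdeal_bot
    | insert j S hj ih =>
      rw [Finset.coe_insert, Set.image_insert_eq, Ideal.span_insert]
      exact (homogIdeal_span_singleton (SetLike.pow_mem_graded s (hx j))).sup ih
  have h := this Finset.univ
  rw [Finset.coe_univ, Set.image_univ] at h
  exact h δ a ha

lemma prod_mem_graded {d : ℕ} {x : Fin d → R} {ε : Fin d → ℤ} (hx : ∀ j, x j ∈ 𝒜 (ε j)) (r : ℕ) :
    (∏ j, x j) ^ r ∈ 𝒜 (r * ∑ j, ε j) := by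
  have h := SetLike.pow_mem_graded (A := 𝒜) r (SetLike.prod_mem_graded 𝒜 (F := Finset.univ) ε x fun j _ => hx j)
  simpa using h

variable {C : ℕ → Type} [∀ j, AddCommGroup (C j)] [∀ j, Module R (C j)]
  {dl : ∀ j, C (j + 1) →ₗ[R] C j} {𝒞 : ∀ j, ℤ → AddSubgroup (C j)}
  [∀ j, DirectSum.Decomposition (𝒞 j)] [∀ j, SetLike.GradedSMul 𝒜 (𝒞 j)]

/-- Graded version of `PowCogen.exists_kosb`. -/
lemma PowCogen.exists_kosb_graded [IsNoetherianRing R] {d n : ℕ} {x : Fin d → R} {ε : Fin d → ℤ}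
    (hx : ∀ j, x j ∈ 𝒜 (ε j)) {A W : Type} [AddCommGroup W] [Module R W] [Module.Finite R W]
    (hW : PowCogen x W) [AddCommGroup A] [Module R A] [Module.Finite R A]
    {𝒩 : ℤ → AddSubgroup A} [DirectSum.Decomposition 𝒩] [SetLike.GradedSMul 𝒜 𝒩]
    {y : Fin n → R} {e : Fin n → ℤ} (hy : ∀ j, y j ∈ 𝒜 (e j)) {k : ℕ}
    (hlim : KLim ⊥ y k (A →ₗ[R] W)) (s : ℕ) (ℓ : ℤ) (z : Finset (Fin n) → A)
    (hzdeg : ∀ S, S.card = k → z S ∈ 𝒩 (ℓ + s * ∑ j, ε j - ∑ j ∈ S, e j))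
    (hz : ∀ T, T.card + 1 = k → kosb y z T ∈ pspan x s • (⊤ : Submodule R A)) :
    ∃ (r : ℕ) (w : Finset (Fin n) → A),
      (∀ S, w S ∈ 𝒩 (ℓ + (s + r : ℕ) * ∑ j, ε j - ∑ j ∈ S, e j)) ∧ ∀ S, S.card = k →
      (∏ j, x j) ^ r • z S - kosb y w S ∈ pspan x (s + r) • (⊤ : Submodule R A) := by
  obtain ⟨r, w, hw⟩ := hW.exists_kosb hlim s z hz
  refine ⟨r, fun S => gcomp 𝒩 (ℓ + (s + r : ℕ) * ∑ j, ε j - ∑ j ∈ S, e j) (w S),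
    fun S => gcomp_mem _ _ _, fun S hS => ?_⟩
  have h := (homogIdeal_pspan hx (s + r)).gcomp_mem_smul_top (𝒩 := 𝒩)
    (ℓ + (s + r : ℕ) * ∑ j, ε j - ∑ j ∈ S, e j) (hw S hS)
  rw [map_sub, gcomp_kosb hy, gcomp_of_mem] at h
  · exact h
  · have h' := gradedSMul_mem (prod_mem_graded hx r) (hzdeg S hS)
    convert h' using 1
    push_cast
    ring_nf

lemma TotCyc.gcomp {d : ℕ} {x : Fin d → R} {ε : Fin d → ℤ} (hx : ∀ j, x j ∈ 𝒜 (ε j))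
    (hdl : ∀ (j : ℕ) (ℓ : ℤ), ∀ x ∈ 𝒞 (j + 1) ℓ, dl j x ∈ 𝒞 j ℓ) {k s : ℕ}
    {c : ∀ q, Finset (Fin d) → C q} (hc : TotCyc x dl k s c) (ℓ : ℤ) :
    TotCyc x dl k s (fun q S => gcomp (𝒞 q) (ℓ + s * ∑ j ∈ S, ε j) (c q S)) := by
  intro q S hS
  have h := gcomp_map (𝒩 := 𝒞 (q + 1)) (𝒩' := 𝒞 q) (dl q).toAddMonoidHom 0
    (fun j u hu => by rw [zero_add]; exact hdl q j u hu) (ℓ + s * ∑ j ∈ S, ε j) (c (q + 1) S)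
  rw [zero_add] at h
  rw [← gcomp_kos hx, ← hc q S hS]
  exact h.symm

/-- A Koszul chain can be corrected, without changing its differential, to consist of cycles
modulo `(x ^ s)`. -/
lemma exists_kosb_correction [IsNoetherianRing R] {N ω : Type} [AddCommGroup N] [Module R N]
    [AddCommGroup ω] [Module R ω] [Module.Finite R ω] (hCfin : ∀ j, Module.Finite R (C j))
    (hcomplex : ∀ j, (dl j).comp (dl (j + 1)) = 0)
    (hdl : ∀ (j : ℕ) (ℓ : ℤ), ∀ x ∈ 𝒞 (j + 1) ℓ, dl j x ∈ 𝒞 j ℓ)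
    {π : C 0 →ₗ[R] N} (hπsurj : Function.Surjective π)
    (hπker : LinearMap.ker π = LinearMap.range (dl 0)) {D t : ℕ} {x : Fin (D + t) → R}
    {ε : Fin (D + t) → ℤ} (hx : ∀ j, x j ∈ 𝒜 (ε j)) {n : ℕ} {y : Fin n → R} {e : Fin n → ℤ}
    (hy : ∀ j, y j ∈ 𝒜 (e j)) (hω : PowCogen x ω)
    (hC : ∀ q m, q < D + t → m < D + t → m ≤ t + q → KLim ⊥ x m (C q))
    (hH : ∀ q m, q + 1 < D + t → q + 1 < m → KLim ⊤ x m (Hmod C dl q))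
    (hN : ∀ m, 0 < m → m < t → KLim ⊤ x m N)
    (hHom : ∀ a k, 0 < a → a + k = t → KLim ⊥ y k (C (D + a) →ₗ[R] ω)) {ℓ : ℤ}
    (hℓ : ∀ (s : ℕ) (S : Finset (Fin n)), S.card = t →
      ∀ u ∈ 𝒞 D (ℓ + s * ∑ j, ε j - ∑ j ∈ S, e j), u ∈ pspan x s • (⊤ : Submodule R (C D)))
    (a : ℕ) : ∀ (k s : ℕ) (p : Finset (Fin n) → C (D + a + 1)), a + 1 + k = t →
      (∀ S, S.card = k + 1 → p S ∈ 𝒞 (D + a + 1) (ℓ + s * ∑ j, ε j - ∑ j ∈ S, e j)) →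
      (∀ S, S.card = k → dl (D + a) (kosb y p S) ∈ pspan x s • (⊤ : Submodule R (C (D + a)))) →
      ∃ (r : ℕ) (p' : Finset (Fin n) → C (D + a + 1)),
        (∀ S, S.card = k + 1 →
          dl (D + a) (p' S) ∈ pspan x (s + r) • (⊤ : Submodule R (C (D + a)))) ∧
        ∀ S, S.card = k → (∏ j, x j) ^ r • kosb y p S - kosb y p' S ∈
          pspan x (s + r) • (⊤ : Submodule R (C (D + a + 1))) := by
  induction a with
  | zero =>
    intro k s p hk hp _
    refine ⟨0, p, fun S hS => ?_, fun S _ => by simp⟩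
    exact hℓ s S (by omega) _ (hdl _ _ _ (hp S hS))
  | succ a ih =>
    intro k s p hk hp hpz
    obtain ⟨r, w, hwdeg, hw⟩ := hω.exists_kosb_graded hx (𝒩 := 𝒞 (D + a + 1)) hy
      (hHom (a + 1) (k + 1) (by omega) (by omega)) s ℓ (fun S => dl (D + (a + 1)) (p S))
      (fun S hS => hdl _ _ _ (hp S hS))
      (fun T hT => by
        rw [kosb_comp]
        exact hpz T (by omega))
    obtain ⟨r', w', hw', hww'⟩ := ih (k + 1) (s + r) w (by omega) (fun S _ => hwdeg S)
      (fun S hS => by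
        have h1 := mem_smul_top_map (dl (D + a)) (hw S hS)
        rw [map_sub, map_smul, show dl (D + a) (dl (D + (a + 1)) (p S)) = 0 from
          LinearMap.congr_fun (hcomplex (D + a)) _, smul_zero, zero_sub] at h1
        exact (Submodule.neg_mem_iff _).1 h1)
    have h2 : ∀ S : Finset (Fin n), S.card = k + 1 + 1 → ∃ (r'' : ℕ) (v : C (D + a + 1 + 1)),
        (∏ j, x j) ^ r'' • w' S - dl (D + a + 1) v ∈
          pspan x (s + r + r' + r'') • (⊤ : Submodule R (C (D + a + 1))) := fun S hS =>
      exists_prod_pow_smul_sub_mem (p := D + a) (k := k) hcomplex hπsurj hπker (by omega)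
        (fun q hq => hC q _ (by omega) hq (by omega)) (fun q hq => hH q _ hq (by omega))
        (hN _ (by omega) (by omega)) (hw' S hS)
    choose! r₀ v₀ hv₀ using h2
    let r'' := ∑ S, r₀ S
    let v : Finset (Fin n) → C (D + a + 1 + 1) := fun S => (∏ j, x j) ^ (r'' - r₀ S) • v₀ S
    have hv : ∀ S : Finset (Fin n), S.card = k + 1 + 1 →
        (∏ j, x j) ^ r'' • w' S - dl (D + a + 1) (v S) ∈
          pspan x (s + r + r' + r'') • (⊤ : Submodule R (C (D + a + 1))) := by
      intro S hS
      have hle : r₀ S ≤ r'' := Finset.single_le_sum (f := r₀) (fun _ _ => Nat.zero_le _)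
        (Finset.mem_univ S)
      have h3 := prod_pow_smul_mem_pspan_smul x _ (r'' - r₀ S) (hv₀ S hS)
      rw [smul_sub, smul_smul, ← pow_add, Nat.sub_add_cancel hle, ← map_smul, add_assoc _ (r₀ S),
        Nat.add_sub_cancel' hle] at h3
      exact h3
    refine ⟨r + r' + r'', (∏ j, x j) ^ (r + r' + r'') • p - kosb y v, fun S hS => ?_,
      fun S _ => ?_⟩
    · have h4 : (∏ j, x j) ^ r'' • kosb y w' S - kosb y (fun S => dl (D + a + 1) (v S)) S ∈
          pspan x (s + r + r' + r'') • (⊤ : Submodule R (C (D + a + 1))) := by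
        have := kosb_mem_smul_top y (S := S) (I := pspan x (s + r + r' + r''))
          (f := (∏ j, x j) ^ r'' • w' - fun S => dl (D + a + 1) (v S))
          (fun T hT => hv T (by omega))
        rwa [map_sub, map_smul] at this
      have h5 := prod_smul_sub_add (prod_smul_sub_add (hw S hS) (by exact hww' S hS))
        (by rw [← add_assoc s r r']; exact h4)
      rw [kosb_comp] at h5
      beta_reduce at h5
      rw [← map_smul] at h5
      rw [Pi.sub_apply, map_sub]
      exact h5
    · rw [map_sub, kosb_kosb, sub_zero, map_smul, Pi.smul_apply, sub_self]
      exact Submodule.zero_mem _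

end GradedChase

section TorsionDecomposition

variable {𝒜 : ℤ → AddSubgroup R} [GradedRing 𝒜]
  {C : ℕ → Type} [∀ j, AddCommGroup (C j)] [∀ j, Module R (C j)]
  {dl : ∀ j, C (j + 1) →ₗ[R] C j} {𝒞 : ∀ j, ℤ → AddSubgroup (C j)}
  [∀ j, DirectSum.Decomposition (𝒞 j)] [∀ j, SetLike.GradedSMul 𝒜 (𝒞 j)]

lemma TotCyc.pow_smul_map_eq_zero {d : ℕ} {x : Fin d → R} {s : ℕ}
    {c : ∀ q, Finset (Fin d) → C q} (hc : TotCyc x dl 0 s c) {N : Type} [AddCommGroup N]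
    [Module R N] {π : C 0 →ₗ[R] N} (hπker : LinearMap.ker π = LinearMap.range (dl 0))
    (j : Fin d) : x j ^ s • π (c 0 ∅) = 0 := by
  have h := hc 0 {j} (by simp)
  rw [kos_apply, Finset.sum_singleton, Finset.erase_singleton] at h
  have h' : π (ksgn j {j} • (x ^ s) j • c 0 ∅) = 0 := by
    rw [← h, ← LinearMap.mem_ker, hπker]
    exact LinearMap.mem_range_self _ _
  rw [← map_smul]
  simpa [ksgn, Finset.filter_singleton] using h'

lemma TotCyc.sub_sum {d : ℕ} {x : Fin d → R} {k s : ℕ} {ι : Type} (I : Finset ι) (a : ι → R)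
    {c : ∀ q, Finset (Fin d) → C q} (hc : TotCyc x dl k s c)
    {b : ι → ∀ q, Finset (Fin d) → C q} (hb : ∀ i, TotCyc x dl k s (b i)) :
    TotCyc x dl k s (fun q => c q - ∑ i ∈ I, a i • b i q) := by
  intro q S hS
  beta_reduce
  rw [Pi.sub_apply, Finset.sum_apply, map_sub, map_sum, map_sub, Pi.sub_apply, map_sum,
    Finset.sum_apply, hc q S hS]
  congr 1
  refine Finset.sum_congr rfl fun i _ => ?_
  rw [Pi.smul_apply, map_smul, map_smul, Pi.smul_apply, hb i q S hS]

/-- Homogeneous torsion elements of sufficiently large degree are combinations of torsion elements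
with coefficients `y`. -/
lemma exists_torsion_eq_sum [IsNoetherianRing R] {N ω : Type} [AddCommGroup N] [Module R N]
    [AddCommGroup ω] [Module R ω] [Module.Finite R ω] (hCfin : ∀ j, Module.Finite R (C j))
    (hcomplex : ∀ j, (dl j).comp (dl (j + 1)) = 0)
    (hdl : ∀ (j : ℕ) (ℓ : ℤ), ∀ x ∈ 𝒞 (j + 1) ℓ, dl j x ∈ 𝒞 j ℓ)
    {𝒩 : ℤ → AddSubgroup N} [DirectSum.Decomposition 𝒩]
    {π : C 0 →ₗ[R] N} (hπsurj : Function.Surjective π)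
    (hπker : LinearMap.ker π = LinearMap.range (dl 0))
    (hπhomog : ∀ (ℓ : ℤ), ∀ x ∈ 𝒞 0 ℓ, π x ∈ 𝒩 ℓ) {D t : ℕ} (ht : 0 < t) {x : Fin (D + t) → R}
    {ε : Fin (D + t) → ℤ} (hx : ∀ j, x j ∈ 𝒜 (ε j)) {n : ℕ} {y : Fin n → R} {e : Fin n → ℤ}
    (hy : ∀ j, y j ∈ 𝒜 (e j)) (hω : PowCogen x ω)
    (hC : ∀ q m, q < D + t → m < D + t → m ≤ t + q → KLim ⊥ x m (C q))
    (hH : ∀ q m, q + 1 < D + t → q + 1 < m → KLim ⊤ x m (Hmod C dl q))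
    (hN : ∀ m, 0 < m → m < t → KLim ⊤ x m N)
    (hHom : ∀ a k, 0 < a → a + k = t → KLim ⊥ y k (C (D + a) →ₗ[R] ω)) {ℓ : ℤ}
    (hℓ : ∀ (s : ℕ) (S : Finset (Fin n)), S.card = t →
      ∀ u ∈ 𝒞 D (ℓ + s * ∑ j, ε j - ∑ j ∈ S, e j), u ∈ pspan x s • (⊤ : Submodule R (C D)))
    {u : N} (hu : u ∈ 𝒩 ℓ) {s₀ : ℕ} (hu0 : ∀ j, x j ^ s₀ • u = 0) :
    ∃ v : Fin n → N, (∀ j, ∃ s : ℕ, ∀ i, x i ^ s • v j = 0) ∧ u = ∑ j, y j • v j := by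
  obtain ⟨t, rfl⟩ : ∃ t', t = t' + 1 := ⟨t - 1, by omega⟩
  obtain ⟨r₀, c₀, hc₀, hc₀u⟩ := exists_totCyc_of_pow_smul_eq_zero hπsurj hπker
    (fun q hq => hH q _ hq (by omega)) hu0
  set s := s₀ + r₀
  obtain ⟨c, hc, hcu, hcdeg⟩ : ∃ c, TotCyc x dl 0 s c ∧ π (c 0 ∅) = u ∧
      ∀ q S, c q S ∈ 𝒞 q (ℓ + s * ∑ j ∈ S, ε j) := by
    refine ⟨_, hc₀.gcomp hx hdl ℓ, ?_, fun q S => gcomp_mem _ _ _⟩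
    have h := gcomp_map (𝒩 := 𝒞 0) (𝒩' := 𝒩) π.toAddMonoidHom 0
      (fun j v hv => by rw [zero_add]; exact hπhomog j v hv) ℓ (c₀ 0 ∅)
    rw [zero_add] at h
    simp only [Finset.sum_empty, mul_zero, add_zero]
    exact h.symm.trans ((congrArg _ hc₀u).trans (gcomp_of_mem hu))
  obtain ⟨r, w, hwdeg, hw⟩ := hω.exists_kosb_graded hx (𝒩 := 𝒞 (D + t + 1)) hy
    (hHom (t + 1) 0 (by omega) rfl) s ℓ (fun _ => c (D + t + 1) Finset.univ)
    (fun S hS => by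
      rw [Finset.card_eq_zero.1 hS, Finset.sum_empty, sub_zero]
      exact hcdeg _ _)
    (fun T hT => by omega)
  obtain ⟨r', w', hw', hww'⟩ := exists_kosb_correction hCfin hcomplex hdl hπsurj hπker hx hy hω
    hC hH hN hHom hℓ t 0 (s + r) w rfl (fun S _ => hwdeg S) (fun S hS => by
      have h1 := mem_smul_top_map (dl (D + t)) (hw S hS)
      rw [map_sub, map_smul, hc (D + t) Finset.univ (by simp; omega)] at h1
      exact (Submodule.sub_mem_iff_right _ (prod_pow_smul_mem_pspan_smul x s r
        (kos_mem_pspan_smul s _ _))).1 h1)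
  choose b hb hbw using fun j : Fin n => exists_totCyc (k := 0) (p := D + t) hcomplex rfl
    (fun q hq => hC q _ (by omega) hq (by omega)) (hw' {j} (by simp))
  have hc' := hc.ktr (r + r')
  rw [← add_assoc s] at hc'
  have h0 := (hc'.sub_sum Finset.univ y hb).map_eq_zero (p := D + t) hcomplex hπker rfl
    (fun q hq => hC q q hq hq (by omega)) (by
      have h2 := prod_smul_sub_add (hw ∅ rfl) (hww' ∅ rfl)
      rw [← add_assoc s] at h2
      convert h2 using 1
      rw [Pi.sub_apply, ktr_apply, Finset.sum_apply, kosb_apply, Finset.compl_empty]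
      congr 1
      refine Finset.sum_congr rfl fun j _ => ?_
      rw [Pi.smul_apply, hbw]
      simp [ksgn])
  refine ⟨fun j => π (b j 0 ∅), fun j => ⟨_, (hb j).pow_smul_map_eq_zero hπker⟩, ?_⟩
  rw [Pi.sub_apply, map_sub, Finset.sum_apply, map_sum, sub_eq_zero, ktr_apply] at h0
  simpa [hcu] using h0

end TorsionDecomposition

section Assembly

open RingTheory.Sequence

lemma pspan_eq_ofList {d : ℕ} (x : Fin d → R) (s : ℕ) :
    pspan x s = Ideal.ofList (List.ofFn (x ^ s)) := by
  rw [pspan, Ideal.ofList]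
  congr 1
  ext a
  exact (List.mem_ofFn' _ _).symm

lemma isWeaklyRegular_ofFn_pow {d : ℕ} {x : Fin d → R} {N : Type} [AddCommGroup N] [Module R N]
    (h : IsWeaklyRegular N (List.ofFn x)) (s : ℕ) : IsWeaklyRegular N (List.ofFn (x ^ s)) := by
  have := isWeaklyRegular_map_pow _ N h s
  rwa [List.map_ofFn] at this

lemma le_radical_pspan {d : ℕ} {x : Fin d → R} {I : Ideal R}
    (h : I ≤ (Ideal.span (Set.range x)).radical) (s : ℕ) : I ≤ (pspan x s).radical :=
  fun _ ha => exists_pow_mem_span_range_pow (h ha) s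

lemma powCogen_of_isWeaklyRegular [IsNoetherianRing R] {I : Ideal R} [I.IsMaximal] {W : Type}
    [AddCommGroup W] [Module R W] [Module.Finite R W] {d : ℕ} (hd : 0 < d)
    (hW : Nonempty ((extModule R (R ⧸ I) W d) ≃ₗ[R] (R ⧸ I))) (hWi : injDimFinite R W)
    {x : Fin d → R} (hx : IsWeaklyRegular R (List.ofFn x))
    (hxW : IsWeaklyRegular W (List.ofFn x)) (hle : ∀ j, x j ∈ I)
    (hrad : I ≤ (Ideal.span (Set.range x)).radical) : PowCogen x W := by
  obtain ⟨m, rfl⟩ : ∃ m, d = m + 1 := ⟨d - 1, by omega⟩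
  intro s V _ _ _ hV v hv
  rcases s.eq_zero_or_pos with rfl | hs
  · refine absurd (hV 1 ?_ v) (by rwa [one_smul])
    simpa using pow_mem_pspan x 0 0
  rw [pspan_eq_ofList]
  refine exists_linearMap_apply_ne_zero hW hWi (isWeaklyRegular_ofFn_pow hx s)
    (isWeaklyRegular_ofFn_pow hxW s) ?_ ?_ (by rwa [← pspan_eq_ofList]) hv
  · rw [← pspan_eq_ofList, pspan, Ideal.span_le]
    rintro _ ⟨j, rfl⟩
    exact Ideal.pow_mem_of_mem _ (hle j) _ hs
  · rw [← pspan_eq_ofList]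
    exact le_radical_pspan hrad s

lemma sum_le_sum_filter_val_lt {n t : ℕ} {e : Fin n → ℤ} (he : ∀ j k : Fin n, j ≤ k → e k ≤ e j)
    {S : Finset (Fin n)} (hS : S.card = t) :
    ∑ j ∈ S, e j ≤ ∑ j ∈ Finset.univ.filter (fun j : Fin n => (j : ℕ) < t), e j := by
  rcases t.eq_zero_or_pos with rfl | ht
  · simp [Finset.card_eq_zero.1 hS]
  have htn : t ≤ n := by simpa [hS] using Finset.card_le_univ S
  let c : Fin n := ⟨t - 1, by omega⟩
  rw [← Finset.sum_sdiff_le_sum_sdiff]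
  refine (Finset.sum_le_card_nsmul _ _ (e c) fun j hj => he _ _ ?_).trans (le_trans (le_of_eq ?_)
    (Finset.card_nsmul_le_sum _ _ (e c) fun j hj => he _ _ ?_))
  · simp only [Finset.mem_sdiff, Finset.mem_filter, Finset.mem_univ, true_and, not_lt] at hj
    exact Fin.le_def.2 (by simp only [c]; omega)
  · rw [Finset.card_sdiff_comm]
    rw [hS, Fin.card_filter_val_lt, min_eq_right htn]
  · simp only [Finset.mem_sdiff, Finset.mem_filter, Finset.mem_univ, true_and] at hj
    exact Fin.le_def.2 (by simp only [c]; omega)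

lemma mem_torsionSubmodule_iff [IsNoetherianRing R] {N : Type} [AddCommGroup N] [Module R N]
    {n : ℕ} {x : Fin n → R} {I : Ideal R} (hx : ∀ j, x j ∈ I)
    (hI : I ≤ (Ideal.span (Set.range x)).radical) {u : N} :
    u ∈ torsionSubmodule I N ↔ ∃ s : ℕ, ∀ j, x j ^ s • u = 0 := by
  refine ⟨fun ⟨s, hs⟩ => ⟨s, fun j => hs _ (Ideal.pow_mem_pow (hx j) s)⟩, fun ⟨s, hs⟩ =>
    mem_torsionSubmodule_of_pow_smul hI hs⟩

variable {𝒜 : ℤ → AddSubgroup R} [GradedRing 𝒜]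

lemma mem_pspan_of_lt {n : ℕ} {y : Fin n → R} {e : Fin n → ℤ} (hy : ∀ j, y j ∈ 𝒜 (e j))
    {d : ℕ} {γ : ℤ} (hγ : ∀ ℓ : ℤ, γ < ℓ → KVanish y (fun j => 𝒜 j) e d ℓ) {x : Fin d → R}
    {ε : Fin d → ℤ} (hx : ∀ j, x j ∈ 𝒜 (ε j)) (hreg : IsWeaklyRegular R (List.ofFn x))
    (hxy : ∀ j, x j ∈ (Ideal.span (Set.range y)).radical)
    (hyx : Ideal.span (Set.range y) ≤ (Ideal.span (Set.range x)).radical) (s : ℕ) {ℓ : ℤ}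
    (hℓ : γ + s * ∑ j, ε j < ℓ) {r : R} (hr : r ∈ 𝒜 ℓ) : r ∈ pspan x s := by
  by_cases hs : s = 0 ∧ 0 < d
  · obtain ⟨rfl, hd⟩ := hs
    have : (1 : R) ∈ pspan x 0 := by simpa using pow_mem_pspan x 0 ⟨0, hd⟩
    rw [(Ideal.eq_top_iff_one _).2 this]
    trivial
  have h := (KTop.of_kVanish hγ).sup_ofList hy (x ^ s) (fun j => s * ε j)
    (fun j => by simpa using SetLike.pow_mem_graded s (hx j))
    (fun j => Ideal.pow_mem_of_mem _ (hxy j) _ (by have := j.2; omega)) homogIdeal_bot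
    ((LinearEquiv.isWeaklyRegular_congr (Submodule.quotEquivOfEqBot _ rfl) _).2
      (isWeaklyRegular_ofFn_pow hreg s))
  rw [bot_sup_eq, ← pspan_eq_ofList, ← Finset.mul_sum] at h
  exact h.mem_of_lt (fun j => le_radical_pspan hyx s (Ideal.subset_span ⟨j, rfl⟩)) hr hℓ

lemma mem_smul_top_of_genDegLE {N : Type} [AddCommGroup N] [Module R N] {𝒩 : ℤ → AddSubgroup N}
    [DirectSum.Decomposition 𝒩] [SetLike.GradedSMul 𝒜 𝒩] {β : ℤ} (hβ : GenDegLE (R := R) 𝒩 β)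
    {K : Ideal R} {γ : ℤ} (hK : ∀ ℓ, γ < ℓ → ∀ r ∈ 𝒜 ℓ, r ∈ K) {ℓ : ℤ} (hℓ : β + γ < ℓ) {u : N}
    (hu : u ∈ 𝒩 ℓ) : u ∈ K • (⊤ : Submodule R N) := by
  have key : ∀ v : N, gcomp 𝒩 ℓ v ∈ K • (⊤ : Submodule R N) := by
    intro v
    have hv : v ∈ Submodule.span R (⋃ (j : ℤ) (_ : j ≤ β), (𝒩 j : Set N)) := by
      rw [show Submodule.span R _ = ⊤ from hβ]
      trivial
    induction hv using Submodule.closure_induction with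
    | zero => simp
    | add v w _ _ hv hw => rw [map_add]; exact Submodule.add_mem _ hv hw
    | smul_mem a g hg =>
      obtain ⟨j, hj, hg⟩ := Set.mem_iUnion₂.1 hg
      induction a using graded_induction (𝒩 := 𝒜) with
      | h0 => simp
      | hadd a b ha hb => rw [add_smul, map_add]; exact Submodule.add_mem _ ha hb
      | hmem i a ha =>
        have hag := gradedSMul_mem (𝒩 := 𝒩) ha hg
        by_cases h : i + j = ℓ
        · subst h
          rw [gcomp_of_mem hag]
          exact Submodule.smul_mem_smul (hK i (by omega) a ha) trivial
        · rw [gcomp_of_mem_ne hag h]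
          exact Submodule.zero_mem _
  rw [← gcomp_of_mem hu]
  exact key u

lemma torsion_mem_span_of_forall_exists [IsNoetherianRing R] {N : Type} [AddCommGroup N]
    [Module R N] [Module.Finite R N] {𝒩 : ℤ → AddSubgroup N} [DirectSum.Decomposition 𝒩]
    [SetLike.GradedSMul 𝒜 𝒩] {n : ℕ} {y : Fin n → R} {e : Fin n → ℤ} (hy : ∀ j, y j ∈ 𝒜 (e j))
    {I : Ideal R} (hI : Ideal.span (Set.range y) = I) {B : ℤ}
    (h : ∀ ℓ, B < ℓ → ∀ u ∈ torsionSubmodule I N, u ∈ 𝒩 ℓ →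
      ∃ v : Fin n → N, (∀ j, v j ∈ torsionSubmodule I N) ∧ u = ∑ j, y j • v j) (ℓ : ℤ) :
    ∀ u ∈ torsionSubmodule I N, u ∈ 𝒩 ℓ →
      u ∈ Submodule.span R {v | v ∈ torsionSubmodule I N ∧ ∃ ℓ' ≤ B, v ∈ 𝒩 ℓ'} := by
  have hyI : ∀ j, y j ∈ I := fun j => hI ▸ Ideal.subset_span ⟨j, rfl⟩
  have hcomp : ∀ u ∈ torsionSubmodule I N, ∀ ℓ, gcomp 𝒩 ℓ u ∈ torsionSubmodule I N := by
    intro u hu ℓ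
    have hI' : I ≤ (Ideal.span (Set.range y)).radical := hI ▸ Ideal.le_radical
    rw [mem_torsionSubmodule_iff hyI hI'] at hu ⊢
    obtain ⟨s, hs⟩ := hu
    refine ⟨s, fun j => ?_⟩
    rw [← gcomp_smul (SetLike.pow_mem_graded s (hy j)), hs, map_zero]
  obtain ⟨m, hm⟩ := exists_pow_smul_torsionSubmodule_eq_zero (N := N) I
  have key : ∀ m ℓ, ∀ u ∈ torsionSubmodule I N, u ∈ 𝒩 ℓ → u ∈
      Submodule.span R {v | v ∈ torsionSubmodule I N ∧ ∃ ℓ' ≤ B, v ∈ 𝒩 ℓ'} ⊔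
        I ^ m • torsionSubmodule I N := by
    intro m
    induction m with
    | zero =>
      intro ℓ u hu _
      rw [pow_zero, Ideal.one_eq_top, Submodule.top_smul]
      exact Submodule.mem_sup_right hu
    | succ m ih =>
      intro ℓ u hu huℓ
      by_cases hℓ : ℓ ≤ B
      · exact Submodule.mem_sup_left (Submodule.subset_span ⟨hu, ℓ, hℓ, huℓ⟩)
      obtain ⟨v, hv, rfl⟩ := h ℓ (not_le.1 hℓ) u hu huℓ
      rw [← gcomp_of_mem huℓ, map_sum]
      refine Submodule.sum_mem _ fun j _ => ?_
      have h1 := gcomp_smul (𝒩 := 𝒩) (hy j) (ℓ - e j) (v j)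
      rw [add_sub_cancel] at h1
      rw [h1]
      obtain ⟨a, ha, b, hb, hab⟩ := Submodule.mem_sup.1
        (ih (ℓ - e j) _ (hcomp _ (hv j) _) (gcomp_mem _ _ _))
      rw [← hab, smul_add, pow_succ', mul_smul]
      exact Submodule.add_mem_sup (Submodule.smul_mem _ _ ha) (Submodule.smul_mem_smul (hyI j) hb)
  intro u hu huℓ
  have h0 : I ^ m • torsionSubmodule I N = ⊥ := by
    rw [eq_bot_iff, Submodule.smul_le]
    exact fun r hr v hv => hm r hr v hv
  have := key m ℓ u hu huℓ
  rwa [h0, sup_bot_eq] at this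

lemma exists_homogeneous_parameters [IsNoetherianRing R] {d : ℕ}
    (hnonneg : ∀ i : ℤ, i < 0 → 𝒜 i = ⊥)
    (hloc : IsLocalRing ↥(𝒜 0)) (hart : IsArtinianRing ↥(𝒜 0))
    (hdim : ringKrullDim R = (d : WithBot (WithTop ℕ)))
    (hCM : depthGE (maxHomIdeal 𝒜) R d) {ω : Type} [AddCommGroup ω] [Module R ω]
    [Module.Finite R ω] (hω : depthGE (maxHomIdeal 𝒜) ω d) (hne : maxHomIdeal 𝒜 ≠ ⊤) {n : ℕ}
    {y : Fin n → R} {e : Fin n → ℤ} (hy : ∀ j, y j ∈ 𝒜 (e j))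
    (hygen : Ideal.span (Set.range y) = maxHomIdeal 𝒜) :
    ∃ (x : Fin d → R) (ε : Fin d → ℤ), (∀ j, x j ∈ 𝒜 (ε j)) ∧ (∀ j, x j ∈ maxHomIdeal 𝒜) ∧
      maxHomIdeal 𝒜 ≤ (Ideal.span (Set.range x)).radical ∧
      IsWeaklyRegular R (List.ofFn x) ∧ IsWeaklyRegular ω (List.ofFn x) := by
  have hI : maxHomIdeal 𝒜 ≤ (Ideal.span (Set.range y)).radical := hygen ▸ Ideal.le_radical
  obtain ⟨rs, rfl, hrs, hR, hW⟩ := exists_isWeaklyRegular_posHomog hnonneg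
    (fun p hp h => exists_posHomog_notMem hnonneg hloc hart hne hy hygen hp (by rwa [← hygen])) d R ω
    (fun k hk => .of_depthGE ⊥ hCM hI hk) (fun k hk => .of_depthGE ⊥ hω hI hk)
  choose ε _ hε using fun j => hrs _ (List.get_mem rs j)
  have hof := List.ofFn_get rs
  refine ⟨rs.get, ε, hε, fun j => (hrs _ (List.get_mem rs j)).mem_maxHomIdeal, ?_,
    by rwa [hof], by rwa [hof]⟩
  have h := le_radical_ofList_of_isWeaklyRegular hrs hR hdim hne
  rwa [Set.range_list_get]

end Assembly

/-- The case `i = d` of the main result. -/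
lemma kGenLE_zero {𝒜 : ℤ → AddSubgroup R} [GradedRing 𝒜] [IsNoetherianRing R]
    (hnonneg : ∀ i : ℤ, i < 0 → 𝒜 i = ⊥)
    (hloc : IsLocalRing ↥(𝒜 0)) (hart : IsArtinianRing ↥(𝒜 0)) {D t : ℕ} (ht : 0 < t)
    (hdim : ringKrullDim R = ((D + t : ℕ) : WithBot (WithTop ℕ)))
    (hCM : depthGE (maxHomIdeal 𝒜) R (D + t)) {ω : Type} [AddCommGroup ω] [Module R ω]
    (hω : IsCanonicalModule (maxHomIdeal 𝒜) (D + t) ω) {n : ℕ} {y : Fin n → R} {e : Fin n → ℤ}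
    (hy : ∀ j, y j ∈ 𝒜 (e j)) (hygen : Ideal.span (Set.range y) = maxHomIdeal 𝒜)
    (hsorted : ∀ j k : Fin n, j ≤ k → e k ≤ e j)
    {N : Type} [AddCommGroup N] [Module R N]
    {𝒩 : ℤ → AddSubgroup N} [DirectSum.Decomposition 𝒩] [SetLike.GradedSMul 𝒜 𝒩]
    {C : ℕ → Type} [∀ j, AddCommGroup (C j)] [∀ j, Module R (C j)]
    [hCfin : ∀ j, Module.Finite R (C j)]
    {dl : ∀ j, C (j + 1) →ₗ[R] C j}
    (hcomplex : ∀ j, (dl j).comp (dl (j + 1)) = 0)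
    {𝒞 : ∀ j, ℤ → AddSubgroup (C j)}
    [∀ j, DirectSum.Decomposition (𝒞 j)] [∀ j, SetLike.GradedSMul 𝒜 (𝒞 j)]
    (hdl : ∀ (j : ℕ) (ℓ : ℤ), ∀ x ∈ 𝒞 (j + 1) ℓ, dl j x ∈ 𝒞 j ℓ)
    {π : C 0 →ₗ[R] N} (hπsurj : Function.Surjective π)
    (hπker : LinearMap.ker π = LinearMap.range (dl 0))
    (hπhomog : ∀ (ℓ : ℤ), ∀ x ∈ 𝒞 0 ℓ, π x ∈ 𝒩 ℓ)
    (hN : depthGE (maxHomIdeal 𝒜) (N ⧸ torsionSubmodule (maxHomIdeal 𝒜) N) t)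
    (hH : ∀ q : ℕ, q + 1 < D + t → modDimLE (R := R) (Hmod C dl q) (q + 1))
    (hC : ∀ q : ℕ, q < D + t → depthGE (maxHomIdeal 𝒜) (C q) (min (D + t) (t + q + 1)))
    (hHom : ∀ a k : ℕ, 0 < a → a + k = t →
      depthGE (maxHomIdeal 𝒜) (C (D + a) →ₗ[R] ω) (k + 1)) {β γ : ℤ}
    (hβ : GenDegLE (R := R) (𝒞 D) β)
    (hγ : ∀ ℓ : ℤ, γ < ℓ → KVanish y (fun j => 𝒜 j) e (D + t) ℓ) :
    KGenLE y 𝒩 e 0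
      (β + (∑ j ∈ Finset.univ.filter (fun j : Fin n => (j : ℕ) < t), e j) + γ) := by
  have := Module.Finite.of_surjective π hπsurj
  obtain ⟨hωfin, hωdepth, hωext, hωinj⟩ := hω
  have hIy : maxHomIdeal 𝒜 ≤ (Ideal.span (Set.range y)).radical := hygen ▸ Ideal.le_radical
  refine kGenLE_zero_of_torsion hygen 𝒩 e _
    (torsion_mem_span_of_forall_exists hy hygen fun ℓ hℓ u hu huℓ => ?_)
  by_cases hne : maxHomIdeal 𝒜 = ⊤
  · obtain ⟨m, hm⟩ := hu
    have hu0 : u = 0 := by simpa using hm 1 (by rw [hne, Ideal.top_pow]; trivial)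
    exact ⟨0, fun _ => Submodule.zero_mem _, by simp [hu0]⟩
  have := isMaximal_maxHomIdeal hne
  obtain ⟨x, ε, hx, hxI, hIx, hxR, hxω⟩ :=
    exists_homogeneous_parameters hnonneg hloc hart hdim hCM hωdepth hne hy hygen
  obtain ⟨s₀, hs₀⟩ := (mem_torsionSubmodule_iff hxI hIx).1 hu
  obtain ⟨v, hv, huv⟩ := exists_torsion_eq_sum hCfin hcomplex hdl hπsurj hπker hπhomog ht hx hy
    (powCogen_of_isWeaklyRegular (by omega) hωext hωinj hxR hxω hxI hIx)
    (fun q m hq hm hmq => .of_depthGE ⊥ (hC q hq) hIx (by omega))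
    (fun q m hq hm => .of_modDimLE (hH q hq) hm)
    (fun m hm hmt => by
      obtain ⟨m, rfl⟩ : ∃ m', m = m' + 1 := ⟨m - 1, by omega⟩
      exact .succ_of_quotient _
        (fun u hu j => pow_smul_eq_zero_of_mem_torsionSubmodule hu (hxI j))
        (.of_depthGE ⊤ hN hIx hmt))
    (fun a k ha hak => .of_depthGE ⊥ (hHom a k ha hak) hIy (Nat.lt_succ_self k))
    (fun s S hS w hw => mem_smul_top_of_genDegLE (𝒜 := 𝒜) hβ
      (fun ℓ' hℓ' r hr => mem_pspan_of_lt hy hγ hx hxR (fun j => hIy (hxI j))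
        (hygen.le.trans hIx) s hℓ' hr)
      (by have := sum_le_sum_filter_val_lt hsorted hS; omega) hw)
    huℓ hs₀
  exact ⟨v, fun j => (mem_torsionSubmodule_iff hxI hIx).2 (hv j), huv⟩

theorem statement5
    (𝒜 : ℤ → AddSubgroup R) [GradedRing 𝒜]
    (hNoeth : IsNoetherianRing R)
    (hnonneg : ∀ i : ℤ, i < 0 → 𝒜 i = ⊥)
    -- `R₀` is an Artinian local ring
    (hloc : IsLocalRing ↥(𝒜 0)) (hart : IsArtinianRing ↥(𝒜 0))
    -- `R` is Cohen–Macaulay with `dim R = d`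
    (d : ℕ) (hdim : ringKrullDim R = (d : WithBot (WithTop ℕ)))
    (hCM : depthGE (maxHomIdeal 𝒜) R d)
    -- `ω_R` the canonical module
    (ω : Type) [AddCommGroup ω] [Module R ω]
    (hω : IsCanonicalModule (maxHomIdeal 𝒜) d ω)
    -- `y` is a minimal homogeneous generating set of `𝔪` with degrees
    -- `e 0 ≥ e 1 ≥ ⋯`; it also serves to compute local cohomology
    (n : ℕ) (y : Fin n → R) (e : Fin n → ℤ)
    (hyhomog : ∀ j, y j ∈ 𝒜 (e j))
    (hygen : Ideal.span (Set.range y) = maxHomIdeal 𝒜)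
    (hymin : ∀ j, y j ∉ Ideal.span (y '' {k | k ≠ j}))
    (hsorted : ∀ j k : Fin n, j ≤ k → e k ≤ e j)
    -- `C_•` a graded complex of finitely generated graded modules, `M = H₀(C_•)`
    (M : Type) [AddCommGroup M] [Module R M]
    (ℳ : ℤ → AddSubgroup M) [DirectSum.Decomposition ℳ] [SetLike.GradedSMul 𝒜 ℳ]
    (C : ℕ → Type) [∀ j, AddCommGroup (C j)] [∀ j, Module R (C j)]
    (hCfin : ∀ j, Module.Finite R (C j))
    (dl : ∀ j, C (j + 1) →ₗ[R] C j)
    (hcomplex : ∀ j, (dl j).comp (dl (j + 1)) = 0)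
    (𝒞 : ∀ j, ℤ → AddSubgroup (C j))
    [∀ j, DirectSum.Decomposition (𝒞 j)] [∀ j, SetLike.GradedSMul 𝒜 (𝒞 j)]
    (hdlhomog : ∀ (j : ℕ) (ℓ : ℤ), ∀ x ∈ 𝒞 (j + 1) ℓ, dl j x ∈ 𝒞 j ℓ)
    (π : C 0 →ₗ[R] M) (hπsurj : Function.Surjective π)
    (hπker : LinearMap.ker π = LinearMap.range (dl 0))
    (hπhomog : ∀ (ℓ : ℤ), ∀ x ∈ 𝒞 0 ℓ, π x ∈ ℳ ℓ)
    -- `1 ≤ t ≤ i ≤ d`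
    (i t : ℕ) (ht1 : 1 ≤ t) (hti : t ≤ i) (hid : i ≤ d)
    -- hypotheses (1)–(4) of Proposition `SJD-P`
    (h1 : depthGE (maxHomIdeal 𝒜)
      (M ⧸ torsionSubmodule (maxHomIdeal 𝒜) M) (d - i + t))
    (h2 : ∀ jm1 : ℕ, ((jm1 + 1 : ℕ) : ℤ) ≤ (i : ℤ) - 1 →
      modDimLE (R := R) (Hmod C dl jm1) (d - i + (jm1 + 1)))
    (h3 : ∀ j : ℕ, (j : ℤ) ≤ (i : ℤ) - 1 →
      depthGE (maxHomIdeal 𝒜) (C j) (min d (d - i + t + j + 1)))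
    (h4 : ∀ j : ℕ, i - t + 1 ≤ j → j ≤ i →
      depthGE (maxHomIdeal 𝒜) (C j →ₗ[R] ω) (i - j + 1))
    -- `H^{d-i}_𝔪(M)` is finitely generated as an `R`-module
    (hfg : Module.Finite R
      ↥((localCohomology (maxHomIdeal 𝒜) (d - i)).obj (ModuleCat.of R M))) :
    -- conclusion: `b₀(H^{d-i}_𝔪(M)) ≤ b₀(C_{i-t}) + Θ_t + a(R)`
    ∀ β γ : ℤ,
      GenDegLE (R := R) (𝒞 (i - t)) β →
      (∀ ℓ : ℤ, γ < ℓ → KVanish y (fun j => 𝒜 j) e d ℓ) →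
      KGenLE y ℳ e (d - i)
        (β + (∑ j ∈ Finset.univ.filter (fun j : Fin n => (j : ℕ) < t), e j) + γ) := by
  rcases hid.lt_or_eq with hlt | rfl
  · have hIy : maxHomIdeal 𝒜 ≤ (Ideal.span (Set.range y)).radical := hygen ▸ Ideal.le_radical
    intro β γ _ _
    refine kGenLE_of_kLim ?_ ℳ e _
    obtain ⟨k, hk⟩ : ∃ k, d - i = k + 1 := ⟨d - i - 1, by omega⟩
    rw [hk]
    exact .succ_of_quotient _ (fun u hu j =>
      pow_smul_eq_zero_of_mem_torsionSubmodule hu (hygen ▸ Ideal.subset_span ⟨j, rfl⟩))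
      (.of_depthGE ⊤ h1 hIy (by omega))
  · obtain ⟨D, rfl⟩ : ∃ D, i = D + t := ⟨i - t, by omega⟩
    intro β γ hβ hγ
    rw [Nat.add_sub_cancel] at hβ
    rw [Nat.sub_self]
    simp only [Nat.sub_self, Nat.zero_add] at h1 h2 h3
    exact kGenLE_zero hnonneg hloc hart ht1 hdim hCM hω hyhomog hygen hsorted hcomplex hdlhomog
      hπsurj hπker hπhomog h1 (fun q hq => h2 q (by push_cast; omega))
      (fun q hq => h3 q (by omega))
      (fun a k ha hak => by
        have := h4 (D + a) (by omega) (by omega)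
        rwa [show D + t - (D + a) = k by omega] at this)
      hβ hγ

end Paper
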